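/- arXiv:1511.00019 — 3 statements merged into one kernel-verified Lean document; each statement's English description precedes it below -/
import Mathlib

section
/- Let p ≥ 1, λ ≥ 1, j ≥ 1, and let E be a finite subset of (I_j ∩ ℕ) × ℤ^d with I_j = [2^j, 2^{j+1}), satisfying #(E ∩ Q) ≤ λ^p l(Q) for every cube Q ∈ D_j. Then there is a constant C_d depending only on d such that for every ball B ⊂ ℝ^{1+d} with diam(B) ≥ 1, #(E ∩ B) ≤ C_d (1 + diam(B)/2^j)^d λ^p diam(B). -/
open MeasureTheory Real Set
open scoped Classical FourierTransform RealInnerProductSpace NNReal ENNReal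

noncomputable section

/-- Euclidean space `ℝ^d`. -/
abbrev Rd (d : ℕ) := EuclideanSpace ℝ (Fin d)

/-- `a` is a "distance function": smooth away from the origin, positive away from the
origin, and homogeneous of degree one. -/
structure IsDistFn {d : ℕ} (a : Rd d → ℝ) : Prop where
  smooth : ContDiffOn ℝ (⊤ : ℕ∞) a {ξ : Rd d | ξ ≠ 0}
  pos : ∀ ξ : Rd d, ξ ≠ 0 → 0 < a ξ
  homog : ∀ t : ℝ, 0 < t → ∀ ξ : Rd d, a (t • ξ) = t * a ξ

/-- Nonvanishing Gaussian curvature of the cosphere `Σ = {a = 1}`: at every point `ξ` of `Σ`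
the second fundamental form, i.e. the Hessian of `a` restricted to the tangent space
`ker (da(ξ))`, is nondegenerate. -/
def CurvNondeg {d : ℕ} (a : Rd d → ℝ) : Prop :=
  ∀ ξ : Rd d, a ξ = 1 → ∀ v : Rd d, fderiv ℝ a ξ v = 0 → v ≠ 0 →
    ∃ w : Rd d, fderiv ℝ a ξ w = 0 ∧ iteratedFDeriv ℝ 2 a ξ ![v, w] ≠ 0

/-- The bump function `η`: smooth, supported in `[1/8,8]`, equal to `1` on `[1/4,4]`. -/
structure IsBump (η : ℝ → ℝ) : Prop where
  smooth : ContDiff ℝ (⊤ : ℕ∞) η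
  supp : ∀ x : ℝ, x ∉ Icc (1/8 : ℝ) 8 → η x = 0
  one : ∀ x ∈ Icc (1/4 : ℝ) 4, η x = 1

/-- The kernel `K_r`, given by the inverse Fourier transform of `ξ ↦ η(a(ξ)) e^{i r a(ξ)}`. -/
def Kker {d : ℕ} (a : Rd d → ℝ) (η : ℝ → ℝ) (r : ℝ) (x : Rd d) : ℂ :=
  ∫ ξ : Rd d, (η (a ξ) : ℂ) * Complex.exp (Complex.I * r * a ξ) *
    Complex.exp (2 * π * Complex.I * (inner ℝ x ξ : ℝ))

/-- Convolution `K ∗ b`. -/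
def conv {d : ℕ} (K b : Rd d → ℂ) (x : Rd d) : ℂ := ∫ y, K (x - y) * b y

/-- The measure `ν_d` on `ℝ`, `dν_d(r) = (1+|r|)^{d-1} dr`. -/
def nuMeas (d : ℕ) : Measure ℝ :=
  volume.withDensity fun r => ENNReal.ofReal ((1 + |r|) ^ (d - 1))

/-- The Lorentz quasinorm `‖f‖_{L^{p,q}(μ)}`. -/
def lorentzNorm {α : Type*} {E : Type*} [MeasurableSpace α] [NormedAddCommGroup E]
    (μ : Measure α) (p : ℝ) (q : ℝ≥0∞) (f : α → E) : ℝ≥0∞ :=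
  if q = ∞ then ⨆ t : ℝ, ENNReal.ofReal t * μ {x | t < ‖f x‖} ^ (1 / p)
  else (∫⁻ t in Ioi (0 : ℝ),
      (ENNReal.ofReal t * μ {x | t < ‖f x‖} ^ (1 / p)) ^ q.toReal / ENNReal.ofReal t) ^
      (1 / q.toReal)

/-- The unit cube `q_z = ∏ [z_i, z_i + 1)`. -/
def qcube (d : ℕ) (z : Fin d → ℤ) : Set (Rd d) :=
  {y : Rd d | ∀ i, (z i : ℝ) ≤ y i ∧ y i < z i + 1}

/-- A normalized function `b_{n,z}`: measurable, bounded by the characteristic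
function of `q_z`. -/
def IsNormalized {d : ℕ} (z : Fin d → ℤ) (b : Rd d → ℂ) : Prop :=
  Measurable b ∧ (∀ y, ‖b y‖ ≤ 1) ∧ ∀ y ∉ qcube d z, b y = 0

/-- A dyadic cube of side length `2^k`, `1 ≤ k ≤ j`, in the tiling of
`[2^j, 2^{j+1}) × ℝ^d`. -/
structure DyCube (d j : ℕ) where
  k : ℕ
  m : ℤ
  zv : Fin d → ℤ
  hk : 1 ≤ k ∧ k ≤ j
  hm : (2:ℤ) ^ (j - k) ≤ m ∧ m < 2 ^ (j + 1 - k)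

/-- side length of a dyadic cube -/
def DyCube.len {d j : ℕ} (Q : DyCube d j) : ℝ := 2 ^ Q.k

/-- a dyadic cube as a subset of `ℝ^{1+d}` -/
def DyCube.toSet {d j : ℕ} (Q : DyCube d j) : Set (ℝ × (Fin d → ℝ)) :=
  {p | ((Q.m : ℝ) * 2 ^ Q.k ≤ p.1 ∧ p.1 < (Q.m + 1) * 2 ^ Q.k) ∧
    ∀ i, (Q.zv i : ℝ) * 2 ^ Q.k ≤ p.2 i ∧ p.2 i < (Q.zv i + 1) * 2 ^ Q.k}

/-- center of a dyadic cube: the `r`-coordinate -/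
def DyCube.centerT {d j : ℕ} (Q : DyCube d j) : ℝ := ((Q.m : ℝ) + 1/2) * 2 ^ Q.k

/-- center of a dyadic cube: the `y`-coordinate -/
def DyCube.centerX {d j : ℕ} (Q : DyCube d j) : Rd d :=
  WithLp.toLp 2 fun i => ((Q.zv i : ℝ) + 1/2) * 2 ^ Q.k

/-- a point `(n,z) ∈ ℕ × ℤ^d` viewed as a point of `ℝ^{1+d}` -/
def embedPt (d : ℕ) (e : ℕ × (Fin d → ℤ)) : ℝ × (Fin d → ℝ) :=
  ((e.1 : ℝ), fun i => (e.2 i : ℝ))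

/-- the number of points of `E` lying in the cube `Q` -/
def cubeCount {d j : ℕ} (E : Finset (ℝ × (Fin d → ℝ))) (Q : DyCube d j) : ℕ :=
  (E.filter (· ∈ Q.toSet)).card

/-- `Q` is `λ`-dense: `#(E ∩ Q) > λ^p l(Q)` -/
def IsDense {d j : ℕ} (E : Finset (ℝ × (Fin d → ℝ))) (lam p : ℝ) (Q : DyCube d j) : Prop :=
  lam ^ p * Q.len < (cubeCount E Q : ℝ)

/-- `Q` is a maximal `λ`-dense dyadic cube -/
def IsMaxDense {d j : ℕ} (E : Finset (ℝ × (Fin d → ℝ))) (lam p : ℝ) (Q : DyCube d j) : Prop :=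
  IsDense E lam p Q ∧
    ∀ Q' : DyCube d j, IsDense E lam p Q' → Q.toSet ⊆ Q'.toSet → Q'.toSet = Q.toSet

/-- a lattice vector viewed as an element of `ℝ^d` -/
def latticeVec (d : ℕ) (z : Fin d → ℤ) : Rd d := WithLp.toLp 2 fun i => (z i : ℝ)

/-- The structural properties of the phase function `ψ = -ψ₋`: Lipschitz with constant `L`,
comparable to the norm, and homogeneous of degree one. -/
structure IsPsi {d : ℕ} (ψ : Rd d → ℝ) (L c₁ c₂ : ℝ) : Prop where
  lip : LipschitzWith (Real.toNNReal L) ψ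
  lower : ∀ x : Rd d, c₁ * ‖x‖ ≤ ψ x
  upper : ∀ x : Rd d, ψ x ≤ c₂ * ‖x‖
  homog : ∀ t : ℝ, 0 < t → ∀ x : Rd d, ψ (t • x) = t * ψ x

/-- The stationary phase kernel estimate for `K_r`, `r ≥ 2`:
`|K_r(x)| ≤ C_N (1+|x|+|r|)^{-(d-1)/2} (1+|ψ(x)-r|)^{-N}`. -/
def KernelEst {d : ℕ} (a : Rd d → ℝ) (η : ℝ → ℝ) (ψ : Rd d → ℝ) : Prop :=
  ∀ N : ℕ, ∃ C : ℝ, 0 < C ∧ ∀ r : ℝ, 2 ≤ r → ∀ x : Rd d,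
    ‖Kker a η r x‖ ≤ C * (1 + ‖x‖ + |r|) ^ (-(((d:ℝ) - 1) / 2)) * (1 + |ψ x - r|) ^ (-(N : ℝ))

/-- The two-sided stationary phase kernel estimate for `K_r`, `|r| ≥ 2`, with the
two phase functions `ψ₊`, `ψ₋`:
`|K_r(x)| ≤ C_N (1+|x|+|r|)^{-(d-1)/2} ∑_± (1+|ψ_±(x)+r|)^{-N}`. -/
def KernelEstPM {d : ℕ} (a : Rd d → ℝ) (η : ℝ → ℝ) (ψp ψm : Rd d → ℝ) : Prop :=
  ∀ N : ℕ, ∃ C : ℝ, 0 < C ∧ ∀ r : ℝ, 2 ≤ |r| → ∀ x : Rd d,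
    ‖Kker a η r x‖ ≤ C * (1 + ‖x‖ + |r|) ^ (-(((d:ℝ) - 1) / 2)) *
      ((1 + |ψp x + r|) ^ (-(N : ℝ)) + (1 + |ψm x + r|) ^ (-(N : ℝ)))

/-- A real `r ≥ 1` is comparable to a dyadic scale `2 ^ k`, unless it exceeds the largest
admissible scale `2 ^ j`. -/
lemma exists_dyadic_scale {j : ℕ} (hj : 1 ≤ j) {r : ℝ} (hr : 1 ≤ r) :
    ∃ k : ℕ, (1 ≤ k ∧ k ≤ j) ∧ (2 : ℝ) ^ k ≤ 2 * r ∧ (r ≤ 2 ^ k ∨ k = j) := by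
  induction j, hj using Nat.le_induction with
  | base => exact ⟨1, by simp, by linarith, Or.inr rfl⟩
  | succ n hn ih =>
    obtain ⟨k, ⟨hk1, hkn⟩, hk2, hk⟩ := ih
    by_cases h : r ≤ 2 ^ k
    · exact ⟨k, ⟨hk1, by omega⟩, hk2, Or.inl h⟩
    · obtain rfl : k = n := by tauto
      refine ⟨k + 1, ⟨by omega, le_rfl⟩, ?_, Or.inr rfl⟩
      rw [pow_succ]
      linarith

lemma floor_div_mem_Icc {L x c s : ℝ} (hL : 0 < L) (hx : |x - c| ≤ s) :
    ⌊x / L⌋ ∈ Finset.Icc ⌊(c - s) / L⌋ ⌊(c + s) / L⌋ := by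
  obtain ⟨h1, h2⟩ := abs_le.1 hx
  rw [Finset.mem_Icc]
  constructor <;> gcongr <;> linarith

lemma card_Icc_floor_div_le {L c r : ℝ} (hL : 0 < L) (hr : 0 ≤ r) :
    ((Finset.Icc ⌊(c - r / 2) / L⌋ ⌊(c + r / 2) / L⌋).card : ℝ) ≤ r / L + 2 := by
  have hle : ⌊(c - r / 2) / L⌋ ≤ ⌊(c + r / 2) / L⌋ := by gcongr; linarith
  rw [Int.card_Icc, ← Int.cast_natCast, Int.toNat_of_nonneg (by omega)]
  have h1 := Int.lt_floor_add_one ((c - r / 2) / L)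
  have h2 := Int.floor_le ((c + r / 2) / L)
  have h3 : (c + r / 2) / L - (c - r / 2) / L = r / L := by ring
  push_cast
  linarith

lemma card_le_mul_card_of_fiber_le {α β : Type*} [DecidableEq β] {s : Finset α} {t : Finset β}
    {f : α → β} (hf : ∀ a ∈ s, f a ∈ t) {M : ℝ}
    (hM : ∀ b ∈ t, ((s.filter fun a => f a = b).card : ℝ) ≤ M) :
    (s.card : ℝ) ≤ t.card * M := by
  rw [Finset.card_eq_sum_card_fiberwise hf, Nat.cast_sum, ← nsmul_eq_mul]
  exact Finset.sum_le_card_nsmul _ _ _ hM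

lemma embedPt_injective (d : ℕ) : Function.Injective (embedPt d) := by
  rintro ⟨n, z⟩ ⟨n', z'⟩ h
  simp only [embedPt, Prod.mk.injEq, Nat.cast_inj] at h
  refine Prod.ext h.1 (funext fun i => ?_)
  exact_mod_cast congrFun h.2 i

/-- The index, in the grid of cubes of side length `L`, of the cube containing a lattice point. -/
def gridIndex (d : ℕ) (L : ℝ) (e : ℕ × (Fin d → ℤ)) : ℤ × (Fin d → ℤ) :=
  (⌊(e.1 : ℝ) / L⌋, fun i => ⌊(e.2 i : ℝ) / L⌋)

lemma DyCube.embedPt_mem_toSet_iff {d j : ℕ} (Q : DyCube d j) (e : ℕ × (Fin d → ℤ)) :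
    embedPt d e ∈ Q.toSet ↔ gridIndex d (2 ^ Q.k) e = (Q.m, Q.zv) := by
  have hL : (0 : ℝ) < 2 ^ Q.k := by positivity
  simp only [DyCube.toSet, embedPt, gridIndex, Set.mem_ofPred_eq, Prod.mk.injEq, funext_iff,
    Int.floor_eq_iff, le_div_iff₀ hL, div_lt_iff₀ hL]

lemma card_gridIndex_fiber_le {d j k : ℕ} (hk : 1 ≤ k ∧ k ≤ j) {M : ℝ} (hM : 0 ≤ M)
    {E : Finset (ℕ × (Fin d → ℤ))}
    (hE : ∀ e ∈ E, (2 : ℝ) ^ j ≤ (e.1 : ℝ) ∧ (e.1 : ℝ) < 2 ^ (j + 1))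
    (hQ : ∀ Q : DyCube d j, (cubeCount (E.image (embedPt d)) Q : ℝ) ≤ M * Q.len)
    (b : ℤ × (Fin d → ℤ)) :
    ((E.filter fun e => gridIndex d (2 ^ k) e = b).card : ℝ) ≤ M * 2 ^ k := by
  rcases (E.filter fun e => gridIndex d (2 ^ k) e = b).eq_empty_or_nonempty with h | ⟨e, he⟩
  · rw [h, Finset.card_empty, Nat.cast_zero]
    positivity
  · obtain ⟨heE, rfl⟩ := Finset.mem_filter.1 he
    obtain ⟨h1, h2⟩ := hE e heE
    have hL : (0 : ℝ) < 2 ^ k := by positivity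
    let Q : DyCube d j :=
      { k := k
        m := (gridIndex d (2 ^ k) e).1
        zv := (gridIndex d (2 ^ k) e).2
        hk := hk
        hm := by
          constructor
          · rw [gridIndex, Int.le_floor, le_div_iff₀ hL]
            push_cast
            rwa [← pow_add, Nat.sub_add_cancel hk.2]
          · rw [gridIndex, Int.floor_lt, div_lt_iff₀ hL]
            push_cast
            rwa [← pow_add, Nat.sub_add_cancel (by omega)] }
    have hcount : cubeCount (E.image (embedPt d)) Q =
        (E.filter fun e' => gridIndex d (2 ^ k) e' = gridIndex d (2 ^ k) e).card := by
      rw [cubeCount, Finset.filter_image, Finset.card_image_of_injective _ (embedPt_injective d)]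
      simp only [Q.embedPt_mem_toSet_iff]
      rfl
    rw [← hcount]
    exact hQ Q

/-- if `#(E ∩ Q) ≤ λ^p l(Q)` for all dyadic cubes `Q ∈ D_j`, then for every
ball `B ⊂ ℝ^{1+d}` of diameter at least `1`,
`#(E ∩ B) ≤ C_d (1 + diam(B)/2^j)^d λ^p diam(B)`. -/
theorem statement6 (d : ℕ) :
    ∃ C : ℝ, 0 < C ∧ ∀ p lam : ℝ, 1 ≤ p → 1 ≤ lam → ∀ j : ℕ, 1 ≤ j →
      ∀ E : Finset (ℕ × (Fin d → ℤ)),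
      (∀ e ∈ E, (2 : ℝ) ^ j ≤ (e.1 : ℝ) ∧ (e.1 : ℝ) < 2 ^ (j + 1)) →
      (∀ Q : DyCube d j, (cubeCount (E.image (embedPt d)) Q : ℝ) ≤ lam ^ p * Q.len) →
      ∀ c : ℝ × (Fin d → ℝ), ∀ r : ℝ, 1 ≤ r →
        ((E.filter fun e => embedPt d e ∈ Metric.closedBall c (r / 2)).card : ℝ) ≤
          C * (1 + r / 2 ^ j) ^ d * lam ^ p * r := by
  refine ⟨6 * 3 ^ d, by positivity, fun p lam _ hlam j hj E hE hQ c r hr => ?_⟩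
  have hr0 : (0 : ℝ) ≤ r := by linarith
  obtain ⟨k, hk, hkr, hkj⟩ := exists_dyadic_scale hj hr
  have hL : (0 : ℝ) < 2 ^ k := by positivity
  have hM : (0 : ℝ) ≤ lam ^ p := by positivity
  have hball : ∀ e : ℕ × (Fin d → ℤ), embedPt d e ∈ Metric.closedBall c (r / 2) →
      |(e.1 : ℝ) - c.1| ≤ r / 2 ∧ ∀ i, |(e.2 i : ℝ) - c.2 i| ≤ r / 2 := by
    intro e he
    rw [Metric.mem_closedBall, Prod.dist_eq, max_le_iff, dist_pi_le_iff (by positivity)] at he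
    exact he
  have hratio : r / 2 ^ k + 2 ≤ 3 * (1 + r / 2 ^ j) := by
    have hj0 : 0 ≤ r / 2 ^ j := by positivity
    rcases hkj with h | rfl
    · have := (div_le_one hL).2 h
      linarith
    · linarith
  obtain ⟨T, hTcard, hT⟩ : ∃ T : Finset ℤ, (T.card : ℝ) ≤ 3 ∧
      ∀ e ∈ E, |(e.1 : ℝ) - c.1| ≤ r / 2 → ⌊(e.1 : ℝ) / 2 ^ k⌋ ∈ T := by
    rcases hkj with h | rfl
    · refine ⟨_, ?_, fun e _ he => floor_div_mem_Icc hL he⟩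
      have := (div_le_one hL).2 h
      linarith [card_Icc_floor_div_le (c := c.1) hL hr0]
    · refine ⟨{1}, by norm_num, fun e he _ => ?_⟩
      obtain ⟨h1, h2⟩ := hE e he
      rw [Finset.mem_singleton, Int.floor_eq_iff, le_div_iff₀ hL, div_lt_iff₀ hL]
      rw [pow_succ] at h2
      push_cast
      constructor <;> linarith
  let S : Finset (Fin d → ℤ) := Fintype.piFinset fun i =>
    Finset.Icc ⌊(c.2 i - r / 2) / 2 ^ k⌋ ⌊(c.2 i + r / 2) / 2 ^ k⌋
  have hScard : (S.card : ℝ) ≤ (3 * (1 + r / 2 ^ j)) ^ d := by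
    rw [Fintype.card_piFinset, Nat.cast_prod]
    calc _ ≤ ∏ _i : Fin d, 3 * (1 + r / 2 ^ j) := Finset.prod_le_prod (fun _ _ => by positivity)
          fun i _ => (card_Icc_floor_div_le hL hr0).trans hratio
      _ = _ := by simp
  have hcount := card_le_mul_card_of_fiber_le (t := T ×ˢ S) (f := gridIndex d (2 ^ k))
    (s := E.filter fun e => embedPt d e ∈ Metric.closedBall c (r / 2)) (M := lam ^ p * 2 ^ k)
    (by
      intro e he
      obtain ⟨heE, heB⟩ := Finset.mem_filter.1 he
      obtain ⟨h1, h2⟩ := hball e heB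
      exact Finset.mem_product.2 ⟨hT e heE h1,
        Fintype.mem_piFinset.2 fun i => floor_div_mem_Icc hL (h2 i)⟩)
    (by
      intro b _
      refine le_trans ?_ (card_gridIndex_fiber_le hk hM hE hQ b)
      gcongr
      exact Finset.filter_subset _ _)
  calc _ ≤ _ := hcount
    _ = T.card * S.card * (lam ^ p * 2 ^ k) := by rw [Finset.card_product]; push_cast; rfl
    _ ≤ 3 * (3 * (1 + r / 2 ^ j)) ^ d * (lam ^ p * (2 * r)) := by gcongr
    _ = _ := by rw [mul_pow]; ring
end
end

section
/- Let Q ∈ D_j have center (r_Q, y_Q), let C₁ = 5d(‖∇ψ‖_{L^∞} + 1), and set Ψ(Q) = { x ∈ ℝ^d : |ψ(x − y_Q) − r_Q| ≤ C₁ l(Q) }. If (n,z) ∈ (I_j ∩ ℕ) × ℤ^d and the point (n,z) lies in Q, then for every N there is a constant C_N such that ∫_{Ψ(Q)^c} |(K_n ∗ b_{n,z})(x)| dx ≤ C_N 2^{j(d−1)/2} l(Q)^{−N}, for any b_{n,z} with |b_{n,z}| ≤ χ_{q_z}. -/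
open MeasureTheory Real Set
open scoped Classical FourierTransform RealInnerProductSpace NNReal ENNReal

noncomputable section

lemma IsPsi.nonneg {d : ℕ} {ψ : Rd d → ℝ} {L c₁ c₂ : ℝ} (hψ : IsPsi ψ L c₁ c₂) (hc₁ : 0 < c₁)
    (x : Rd d) : 0 ≤ ψ x :=
  (by positivity : 0 ≤ c₁ * ‖x‖).trans (hψ.lower x)

lemma IsPsi.lipschitzConst_nonneg {d : ℕ} (hd : d ≠ 0) {ψ : Rd d → ℝ} {L c₁ c₂ : ℝ}
    (hψ : IsPsi ψ L c₁ c₂) (hc₁ : 0 < c₁) : 0 ≤ L := by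
  by_contra! hL
  have : Nonempty (Fin d) := ⟨⟨0, Nat.pos_of_ne_zero hd⟩⟩
  obtain ⟨x, hx⟩ := exists_ne (0 : Rd d)
  have h := hψ.lip.dist_le_mul x 0
  rw [Real.toNNReal_of_nonpos hL.le, NNReal.coe_zero, zero_mul] at h
  have h0 : ψ x = ψ 0 := dist_le_zero.mp h
  have h1 := hψ.upper 0
  have h2 := hψ.lower x
  have h3 : 0 < c₁ * ‖x‖ := mul_pos hc₁ (norm_pos_iff.mpr hx)
  rw [norm_zero, mul_zero] at h1
  linarith

lemma IsPsi.abs_apply_sub_apply_le {d : ℕ} {ψ : Rd d → ℝ} {L c₁ c₂ : ℝ} (hψ : IsPsi ψ L c₁ c₂) (hL : 0 ≤ L)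
    (x y : Rd d) : |ψ x - ψ y| ≤ L * ‖x - y‖ := by
  have h := hψ.lip.dist_le_mul x y
  rwa [Real.coe_toNNReal _ hL, Real.dist_eq, dist_eq_norm] at h

lemma IsPsi.volume_sublevel_one_lt_top {d : ℕ} {ψ : Rd d → ℝ} {L c₁ c₂ : ℝ}
    (hψ : IsPsi ψ L c₁ c₂) (hc₁ : 0 < c₁) : volume {u | ψ u < 1} < ∞ := by
  refine (measure_mono (t := Metric.closedBall (0 : Rd d) (1 / c₁)) fun u hu => ?_).trans_lt
    measure_closedBall_lt_top
  have h := hψ.lower u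
  have h1 : ψ u < 1 := hu
  rw [mem_closedBall_zero_iff, le_div_iff₀ hc₁]
  linarith

open scoped Pointwise in
lemma IsPsi.volume_sublevel {d : ℕ} (hd : d ≠ 0) {ψ : Rd d → ℝ} {L c₁ c₂ : ℝ}
    (hψ : IsPsi ψ L c₁ c₂) (hc₁ : 0 < c₁) {t : ℝ} (ht : 0 ≤ t) :
    volume {u | ψ u < t} = ENNReal.ofReal (t ^ d) * volume {u | ψ u < 1} := by
  rcases ht.eq_or_lt with rfl | ht
  · have : {u | ψ u < 0} = ∅ := by
      ext u
      simpa using hψ.nonneg hc₁ u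
    simp [this, hd]
  · have : {u | ψ u < t} = t • {u | ψ u < 1} := by
      ext u
      rw [Set.mem_smul_set_iff_inv_smul_mem₀ ht.ne']
      simp only [mem_ofPred_eq]
      rw [hψ.homog _ (inv_pos.mpr ht), inv_mul_lt_iff₀ ht, mul_one]
    rw [this, Measure.addHaar_smul, finrank_euclideanSpace_fin, abs_of_pos (by positivity)]

lemma add_one_pow_sub_pow_le {x : ℝ} (hx : 0 ≤ x) {d : ℕ} :
    (x + 1) ^ d - x ^ d ≤ d * (x + 1) ^ (d - 1) := by
  have h := abs_pow_sub_pow_le (x + 1) x d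
  rw [abs_of_nonneg (a := x + 1) (by linarith), abs_of_nonneg hx, max_eq_left (by linarith)] at h
  simpa using (le_abs_self _).trans h

lemma IsPsi.volume_shell_le {d : ℕ} (hd : d ≠ 0) {ψ : Rd d → ℝ} {L c₁ c₂ : ℝ}
    (hψ : IsPsi ψ L c₁ c₂) (hc₁ : 0 < c₁) {k : ℝ} (hk : 0 ≤ k) :
    volume {u | k ≤ ψ u ∧ ψ u < k + 1} ≤
      ENNReal.ofReal (d * (k + 1) ^ (d - 1) * (volume {u | ψ u < 1}).toReal) := by
  have hfin := (hψ.volume_sublevel_one_lt_top hc₁).ne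
  have hmeas : MeasurableSet {u | ψ u < k} :=
    measurableSet_lt hψ.lip.continuous.measurable measurable_const
  have hset : {u | k ≤ ψ u ∧ ψ u < k + 1} = {u | ψ u < k + 1} \ {u | ψ u < k} := by
    ext u
    simp [and_comm]
  have hsub : {u | ψ u < k} ⊆ {u | ψ u < k + 1} := fun u (hu : ψ u < k) =>
    show ψ u < k + 1 by linarith
  rw [hset, measure_sdiff hsub hmeas.nullMeasurableSet,
    hψ.volume_sublevel hd hc₁ hk, hψ.volume_sublevel hd hc₁ (by linarith : 0 ≤ k + 1),
    ENNReal.ofReal_mul (by positivity), ENNReal.ofReal_toReal hfin,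
    ← ENNReal.sub_mul (fun _ _ => hfin), ← ENNReal.ofReal_sub _ (by positivity)]
  · gcongr
    exact add_one_pow_sub_pow_le hk
  · rw [hψ.volume_sublevel hd hc₁ hk]
    exact ENNReal.mul_ne_top ENNReal.ofReal_ne_top hfin

lemma summable_int_one_add_abs_sq_inv : Summable fun k : ℤ => ((1 + |(k : ℝ)|) ^ 2)⁻¹ := by
  have h : Summable fun k : ℕ => ((1 + (k : ℝ)) ^ 2)⁻¹ := by
    have := (summable_nat_add_iff 1).mpr (Real.summable_nat_pow_inv.mpr one_lt_two)
    simpa [add_comm] using this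
  exact Summable.of_nat_of_neg (by simpa using h) (by simpa using h)

/-- On the shell `k ≤ t < k + 1`, the decay in `|t - n|` beats the growth `(k + 1) ^ (d - 1)`. -/
lemma shell_weight_le {d : ℕ} (hd : d ≠ 0) {k t n : ℝ} (hk : 0 ≤ k) (hn : 1 ≤ n)
    (h1 : k ≤ t) (h2 : t < k + 1) :
    ((1 + |t - n|) ^ (d + 1))⁻¹ * (k + 1) ^ (d - 1) ≤
      2 ^ (d + 1) * (2 * n) ^ (d - 1) * ((1 + |k - n|) ^ 2)⁻¹ := by
  have hA : 1 + |k - n| ≤ 2 * (1 + |t - n|) := by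
    have h3 : |k - n| ≤ |k - t| + |t - n| := abs_sub_le _ _ _
    have h4 : |k - t| ≤ 1 := abs_le.mpr ⟨by linarith, by linarith⟩
    linarith [abs_nonneg (t - n)]
  have hB : k + 1 ≤ 2 * n * (1 + |k - n|) := by
    nlinarith [le_abs_self (k - n), abs_nonneg (k - n)]
  have hA' : ((1 + |t - n|) ^ (d + 1))⁻¹ ≤ 2 ^ (d + 1) * ((1 + |k - n|) ^ (d + 1))⁻¹ := by
    rw [← div_eq_mul_inv, le_div_iff₀ (by positivity), inv_mul_le_iff₀ (by positivity), ← mul_pow,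
      mul_comm _ (2 : ℝ)]
    gcongr
  calc ((1 + |t - n|) ^ (d + 1))⁻¹ * (k + 1) ^ (d - 1)
      ≤ (2 ^ (d + 1) * ((1 + |k - n|) ^ (d + 1))⁻¹) * (2 * n * (1 + |k - n|)) ^ (d - 1) := by
        gcongr
    _ = _ := by
        rw [mul_pow (2 * n), show d + 1 = (d - 1) + 2 by omega, pow_add (1 + |k - n|)]
        field_simp

/-- The weight `(1 + |ψ - n|)^{-(d+1)}` has integral `O(n^{d-1})`. -/
lemma IsPsi.exists_lintegral_weight_le {d : ℕ} (hd : d ≠ 0) {ψ : Rd d → ℝ} {L c₁ c₂ : ℝ}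
    (hψ : IsPsi ψ L c₁ c₂) (hc₁ : 0 < c₁) : ∃ C : ℝ, 0 < C ∧ ∀ n : ℕ, 1 ≤ n →
      ∫⁻ u, ENNReal.ofReal (((1 + |ψ u - n|) ^ (d + 1))⁻¹) ≤
        ENNReal.ofReal (C * (n : ℝ) ^ (d - 1)) := by
  set V := (volume {u | ψ u < 1}).toReal
  have hV : 0 ≤ V := ENNReal.toReal_nonneg
  set T := ∑' k : ℤ, ((1 + |(k : ℝ)|) ^ 2)⁻¹
  have hT : 0 ≤ T := tsum_nonneg fun k => by positivity
  refine ⟨d * V * 2 ^ (d + 1) * 2 ^ (d - 1) * T + 1, by positivity, fun n hn => ?_⟩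
  have hn' : (1 : ℝ) ≤ n := by exact_mod_cast hn
  let S : ℤ → Set (Rd d) := fun k => {u | (k : ℝ) ≤ ψ u ∧ ψ u < k + 1}
  have hSm (k : ℤ) : MeasurableSet (S k) :=
    (measurableSet_le measurable_const hψ.lip.continuous.measurable).inter
      (measurableSet_lt hψ.lip.continuous.measurable measurable_const)
  have hU : (⋃ k, S k) = univ := by
    ext u
    simp only [mem_iUnion, mem_univ, iff_true]
    exact ⟨⌊ψ u⌋, Int.floor_le _, Int.lt_floor_add_one _⟩
  let w : ℤ → ℝ := fun k => d * V * 2 ^ (d + 1) * (2 * n) ^ (d - 1) * ((1 + |(k : ℝ) - n|) ^ 2)⁻¹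
  have hw (k : ℤ) : 0 ≤ w k := by positivity
  have key (k : ℤ) : ∫⁻ u in S k, ENNReal.ofReal (((1 + |ψ u - n|) ^ (d + 1))⁻¹) ≤
      ENNReal.ofReal (w k) := by
    by_cases hk : 0 ≤ k
    · have hk' : (0 : ℝ) ≤ k := by exact_mod_cast hk
      let c : ℝ := 2 ^ (d + 1) * (2 * n) ^ (d - 1) * ((1 + |(k : ℝ) - n|) ^ 2)⁻¹ /
        (k + 1) ^ (d - 1)
      have hc : 0 ≤ c := by positivity
      calc ∫⁻ u in S k, ENNReal.ofReal (((1 + |ψ u - n|) ^ (d + 1))⁻¹)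
          ≤ ∫⁻ _ in S k, ENNReal.ofReal c := by
            refine setLIntegral_mono measurable_const fun u hu => ENNReal.ofReal_le_ofReal ?_
            rw [le_div_iff₀ (by positivity)]
            exact shell_weight_le hd hk' hn' hu.1 hu.2
        _ = ENNReal.ofReal c * volume (S k) := setLIntegral_const _ _
        _ ≤ ENNReal.ofReal c * ENNReal.ofReal (d * (k + 1) ^ (d - 1) * V) := by
            gcongr
            exact hψ.volume_shell_le hd hc₁ hk'
        _ = ENNReal.ofReal (w k) := by
            rw [← ENNReal.ofReal_mul hc]
            congr 1
            have : ((k : ℝ) + 1) ^ (d - 1) ≠ 0 := by positivity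
            simp only [c, w]
            field_simp
    · have : S k = ∅ := by
        ext u
        simp only [S, mem_ofPred_eq, mem_empty_iff_false, iff_false, not_and, not_lt]
        intro _
        have h1 : (k : ℝ) + 1 ≤ 0 := by exact_mod_cast (by omega : k + 1 ≤ 0)
        exact h1.trans (hψ.nonneg hc₁ u)
      simp [this]
  have hsum : Summable fun k : ℤ => ((1 + |(k : ℝ) - n|) ^ 2)⁻¹ := by
    have := (Equiv.subRight (n : ℤ)).summable_iff.mpr summable_int_one_add_abs_sq_inv
    simpa [Function.comp_def] using this
  have htsum : ∑' k : ℤ, ((1 + |(k : ℝ) - n|) ^ 2)⁻¹ = T := by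
    have := (Equiv.subRight (n : ℤ)).tsum_eq fun k : ℤ => ((1 + |(k : ℝ)|) ^ 2)⁻¹
    simpa using this
  calc ∫⁻ u, ENNReal.ofReal (((1 + |ψ u - n|) ^ (d + 1))⁻¹)
      = ∫⁻ u in ⋃ k, S k, ENNReal.ofReal (((1 + |ψ u - n|) ^ (d + 1))⁻¹) := by
        rw [hU, Measure.restrict_univ]
    _ ≤ ∑' k, ∫⁻ u in S k, ENNReal.ofReal (((1 + |ψ u - n|) ^ (d + 1))⁻¹) :=
        lintegral_iUnion_le _ _
    _ ≤ ∑' k, ENNReal.ofReal (w k) := ENNReal.tsum_le_tsum key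
    _ = ENNReal.ofReal (∑' k, w k) :=
        (ENNReal.ofReal_tsum_of_nonneg hw (hsum.mul_left _)).symm
    _ ≤ _ := by
        refine ENNReal.ofReal_le_ofReal ?_
        rw [tsum_mul_left, htsum, mul_pow]
        nlinarith [pow_nonneg (zero_le_one.trans hn') (d - 1)]

lemma norm_le_card_mul_of_forall_abs_le {d : ℕ} (hd : d ≠ 0) {v : Rd d} {c : ℝ} (hc : 0 ≤ c)
    (h : ∀ i, |v i| ≤ c) : ‖v‖ ≤ d * c := by
  have hd' : (1 : ℝ) ≤ d := by exact_mod_cast Nat.one_le_iff_ne_zero.mpr hd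
  rw [EuclideanSpace.norm_eq, Real.sqrt_le_left (by positivity)]
  calc ∑ i, ‖v i‖ ^ 2 ≤ ∑ _i : Fin d, c ^ 2 := by
        gcongr with i
        exact h i
    _ = d * c ^ 2 := by simp
    _ ≤ (d * c) ^ 2 := by nlinarith [mul_nonneg (sq_nonneg c) (by linarith : (0 : ℝ) ≤ d - 1)]

lemma DyCube.two_le_len {d j : ℕ} (Q : DyCube d j) : 2 ≤ Q.len := by
  simpa [DyCube.len] using pow_le_pow_right₀ (one_le_two : (1 : ℝ) ≤ 2) Q.hk.1

lemma DyCube.abs_sub_centerT_le {d j : ℕ} {Q : DyCube d j} {n : ℕ} {z : Fin d → ℤ}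
    (h : embedPt d (n, z) ∈ Q.toSet) : |(n : ℝ) - Q.centerT| ≤ Q.len / 2 := by
  obtain ⟨⟨h1, h2⟩, -⟩ := h
  simp only [embedPt] at h1 h2
  rw [DyCube.centerT, DyCube.len, abs_le]
  constructor <;> linarith

lemma DyCube.norm_sub_centerX_le {d j : ℕ} (hd : d ≠ 0) {Q : DyCube d j} {n : ℕ}
    {z : Fin d → ℤ} (h : embedPt d (n, z) ∈ Q.toSet) {y : Rd d} (hy : y ∈ qcube d z) :
    ‖y - Q.centerX‖ ≤ d * Q.len := by
  have hl := Q.two_le_len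
  refine norm_le_card_mul_of_forall_abs_le hd (by linarith) fun i => ?_
  obtain ⟨h1, h2⟩ := h.2 i
  obtain ⟨h3, h4⟩ := hy i
  simp only [embedPt] at h1 h2
  simp only [DyCube.len] at hl
  simp only [PiLp.sub_apply, DyCube.centerX, DyCube.len]
  rw [abs_le]
  constructor <;> linarith

/-- Points of `q_z` see the complement of `Ψ(Q)` at phase distance at least `l(Q)`. -/
lemma IsPsi.len_le_abs_sub {d j : ℕ} (hd : d ≠ 0) {ψ : Rd d → ℝ} {L c₁ c₂ : ℝ}
    (hψ : IsPsi ψ L c₁ c₂) (hL : 0 ≤ L) {Q : DyCube d j} {n : ℕ} {z : Fin d → ℤ}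
    (h : embedPt d (n, z) ∈ Q.toSet) {x y : Rd d} (hy : y ∈ qcube d z)
    (hx : 5 * d * (L + 1) * Q.len < |ψ (x - Q.centerX) - Q.centerT|) :
    Q.len ≤ |ψ (x - y) - n| := by
  have hd' : (1 : ℝ) ≤ d := by exact_mod_cast Nat.one_le_iff_ne_zero.mpr hd
  have hl := Q.two_le_len
  have h1 := hψ.abs_apply_sub_apply_le hL (x - Q.centerX) (x - y)
  rw [sub_sub_sub_cancel_left] at h1
  have h2 := mul_le_mul_of_nonneg_left (DyCube.norm_sub_centerX_le hd h hy) hL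
  have h3 := DyCube.abs_sub_centerT_le h
  have h4 : |ψ (x - Q.centerX) - Q.centerT| ≤
      |ψ (x - Q.centerX) - ψ (x - y)| + |ψ (x - y) - n| + |(n : ℝ) - Q.centerT| :=
    (abs_sub_le _ (n : ℝ) _).trans (by gcongr; exact abs_sub_le _ _ _)
  have h5 : 0 ≤ L * (d * Q.len) := by positivity
  have h6 : Q.len ≤ d * Q.len := le_mul_of_one_le_left (by linarith) hd'
  nlinarith

lemma KernelEst.exists_bound {d : ℕ} (hd : d ≠ 0) {a : Rd d → ℝ} {η : ℝ → ℝ} {ψ : Rd d → ℝ}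
    (hker : KernelEst a η ψ) (N : ℕ) : ∃ C : ℝ, 0 < C ∧ ∀ n : ℕ, 2 ≤ n → ∀ l : ℝ, 0 < l →
      ∀ u : Rd d, l ≤ |ψ u - n| → ‖Kker a η n u‖ ≤
        C * (n : ℝ) ^ (-(((d : ℝ) - 1) / 2)) * l ^ (-(N : ℝ)) *
          ((1 + |ψ u - n|) ^ (d + 1))⁻¹ := by
  obtain ⟨C, hC, h⟩ := hker (N + (d + 1))
  refine ⟨C, hC, fun n hn l hl u hu => (h n (by exact_mod_cast hn) u).trans ?_⟩
  have hn0 : (0 : ℝ) < n := by exact_mod_cast (by omega : 0 < n)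
  have hd' : (1 : ℝ) ≤ d := by exact_mod_cast Nat.one_le_iff_ne_zero.mpr hd
  have h1 : (1 + ‖u‖ + |(n : ℝ)|) ^ (-(((d : ℝ) - 1) / 2)) ≤
      (n : ℝ) ^ (-(((d : ℝ) - 1) / 2)) := by
    refine Real.rpow_le_rpow_of_nonpos hn0 ?_ (by linarith)
    linarith [le_abs_self (n : ℝ), norm_nonneg u]
  have h2 : (1 + |ψ u - n|) ^ (-((N + (d + 1) : ℕ) : ℝ)) ≤
      l ^ (-(N : ℝ)) * ((1 + |ψ u - n|) ^ (d + 1))⁻¹ := by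
    rw [Real.rpow_neg (by positivity), Real.rpow_natCast, Real.rpow_neg hl.le, Real.rpow_natCast,
      pow_add, mul_inv]
    gcongr
    linarith
  calc _ ≤ C * (n : ℝ) ^ (-(((d : ℝ) - 1) / 2)) *
        (l ^ (-(N : ℝ)) * ((1 + |ψ u - n|) ^ (d + 1))⁻¹) := by gcongr
    _ = _ := by ring

/-- `L¹` bound for the convolution of a kernel with a function of modulus at most one supported
in a set `B`, when the kernel is dominated by `g` at all relevant points. -/
lemma lintegral_conv_le {d : ℕ} {K b : Rd d → ℂ} {g : Rd d → ℝ} {E B : Set (Rd d)}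
    (hE : MeasurableSet E) (hB : MeasurableSet B) (hg : Measurable g) (hb : ∀ y, ‖b y‖ ≤ 1)
    (hbB : ∀ y ∉ B, b y = 0) (hK : ∀ x ∈ E, ∀ y, b y ≠ 0 → ‖K (x - y)‖ ≤ g (x - y)) :
    ∫⁻ x in E, (‖conv K b x‖₊ : ℝ≥0∞) ≤ volume B * ∫⁻ u, ENNReal.ofReal (g u) := by
  have hpt : ∀ x ∈ E, (‖conv K b x‖₊ : ℝ≥0∞) ≤ ∫⁻ y in B, ENNReal.ofReal (g (x - y)) := by
    intro x hx
    refine (enorm_integral_le_lintegral_enorm _).trans ?_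
    rw [← lintegral_indicator hB]
    refine lintegral_mono fun y => ?_
    by_cases hy : b y = 0
    · simp [hy]
    · rw [indicator_of_mem (not_not.mp fun h => hy (hbB y h)), ← ofReal_norm, norm_mul]
      refine ENNReal.ofReal_le_ofReal ?_
      exact (mul_le_of_le_one_right (norm_nonneg _) (hb y)).trans (hK x hx y hy)
  calc ∫⁻ x in E, (‖conv K b x‖₊ : ℝ≥0∞)
      ≤ ∫⁻ x in E, ∫⁻ y in B, ENNReal.ofReal (g (x - y)) := setLIntegral_mono' hE hpt
    _ ≤ ∫⁻ x, ∫⁻ y in B, ENNReal.ofReal (g (x - y)) := setLIntegral_le_lintegral _ _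
    _ = ∫⁻ y in B, ∫⁻ x, ENNReal.ofReal (g (x - y)) :=
        lintegral_lintegral_swap
          (hg.comp (measurable_fst.sub measurable_snd)).ennreal_ofReal.aemeasurable
    _ = volume B * ∫⁻ u, ENNReal.ofReal (g u) := by
        simp_rw [lintegral_sub_right_eq_self fun u => ENNReal.ofReal (g u)]
        rw [setLIntegral_const, mul_comm]

/-- `K_n ∗ b_{n,z}` is essentially supported in
`Ψ(Q) = {x : |ψ(x - y_Q) - r_Q| ≤ C₁ l(Q)}` whenever `(n,z) ∈ Q`:
`‖K_n ∗ b_{n,z}‖_{L^1(Ψ(Q)^c)} ≤ C_N 2^{j(d-1)/2} l(Q)^{-N}`. -/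
theorem statement7 (d : ℕ) (hd : 2 ≤ d) (a : Rd d → ℝ) (ha : IsDistFn a)
    (hcurv : CurvNondeg a) (η : ℝ → ℝ) (hη : IsBump η)
    (ψ : Rd d → ℝ) (L c₁ c₂ : ℝ) (hc₁ : 0 < c₁) (hψ : IsPsi ψ L c₁ c₂)
    (hker : KernelEst a η ψ) :
    ∀ N : ℕ, ∃ C : ℝ, 0 < C ∧ ∀ j : ℕ, 1 ≤ j → ∀ Q : DyCube d j,
      ∀ n : ℕ, ∀ z : Fin d → ℤ,
      (2 : ℝ) ^ j ≤ (n : ℝ) → (n : ℝ) < 2 ^ (j + 1) →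
      embedPt d (n, z) ∈ Q.toSet →
      ∀ b : Rd d → ℂ, IsNormalized z b →
      (∫⁻ x in {x : Rd d | |ψ (x - Q.centerX) - Q.centerT| ≤ 5 * d * (L + 1) * Q.len}ᶜ,
          (‖conv (Kker a η (n : ℝ)) b x‖₊ : ℝ≥0∞)) ≤
        ENNReal.ofReal (C * 2 ^ (((j : ℝ) * ((d : ℝ) - 1)) / 2) * Q.len ^ (-(N : ℝ))) := by
  intro N
  have hd0 : d ≠ 0 := by omega
  have hd' : (1 : ℝ) ≤ d := by exact_mod_cast Nat.one_le_iff_ne_zero.mpr hd0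
  have hL := hψ.lipschitzConst_nonneg hd0 hc₁
  obtain ⟨C₀, hC₀, hK⟩ := hker.exists_bound hd0 N
  obtain ⟨C₁, hC₁, hI⟩ := hψ.exists_lintegral_weight_le hd0 hc₁
  set s : ℝ := ((d : ℝ) - 1) / 2 with hs
  have hs0 : 0 ≤ s := by rw [hs]; linarith
  set V := (volume (Metric.closedBall (0 : Rd d) d)).toReal with hV
  have hV0 : 0 < V := ENNReal.toReal_pos
    (Metric.measure_closedBall_pos _ _ (by linarith)).ne' measure_closedBall_lt_top.ne
  refine ⟨V * (C₀ * C₁) * 2 ^ s, by positivity, fun j hj Q n z hn1 hn2 hQ b hb => ?_⟩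
  have hn : 2 ≤ n := by
    have h1 : (2 : ℝ) ^ 1 ≤ 2 ^ j := pow_le_pow_right₀ one_le_two hj
    exact_mod_cast (by linarith : (2 : ℝ) ≤ n)
  have hn0 : (0 : ℝ) < n := by exact_mod_cast (by omega : 0 < n)
  have hl : 0 < Q.len := by linarith [Q.two_le_len]
  have hcont := hψ.lip.continuous
  set A : ℝ := C₀ * (n : ℝ) ^ (-s) * Q.len ^ (-(N : ℝ)) with hA
  have hA0 : 0 ≤ A := by positivity
  have hmeas : MeasurableSet
      {x : Rd d | |ψ (x - Q.centerX) - Q.centerT| ≤ 5 * d * (L + 1) * Q.len}ᶜ :=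
    (measurableSet_le (by fun_prop) measurable_const).compl
  have hmem (y : Rd d) (hy : b y ≠ 0) : y ∈ qcube d z := not_not.mp fun h => hy (hb.2.2 y h)
  have hconv := lintegral_conv_le (K := Kker a η n) (b := b)
    (g := fun u => A * ((1 + |ψ u - n|) ^ (d + 1))⁻¹)
    (B := Metric.closedBall (latticeVec d z) d) hmeas measurableSet_closedBall (by fun_prop) hb.2.1
    (by
      intro y hy
      by_contra h
      refine hy ?_
      rw [mem_closedBall_iff_norm]
      have := norm_le_card_mul_of_forall_abs_le (v := y - latticeVec d z) hd0 zero_le_one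
        fun i => by
          obtain ⟨h1, h2⟩ := hmem y h i
          simp only [PiLp.sub_apply, latticeVec]
          rw [abs_le]
          constructor <;> linarith
      simpa using this)
    (fun x hx y hy => hK n hn _ hl _ <| hψ.len_le_abs_sub hd0 hL hQ (hmem y hy) <| by
      simpa using hx)
  refine hconv.trans ?_
  have hball : volume (Metric.closedBall (latticeVec d z) d) = ENNReal.ofReal V := by
    rw [hV, ENNReal.ofReal_toReal measure_closedBall_lt_top.ne]
    exact Measure.addHaar_closedBall_center _ _ _
  simp_rw [ENNReal.ofReal_mul hA0]
  rw [lintegral_const_mul' _ _ ENNReal.ofReal_ne_top, hball]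
  have hpow : (n : ℝ) ^ (-s) * (n : ℝ) ^ (d - 1) ≤ 2 ^ s * 2 ^ ((j : ℝ) * ((d : ℝ) - 1) / 2) := by
    have h1 : (n : ℝ) ^ (-s) * (n : ℝ) ^ (d - 1) = (n : ℝ) ^ s := by
      rw [← Real.rpow_natCast, ← Real.rpow_add hn0, Nat.cast_sub (by omega), Nat.cast_one]
      congr 1
      rw [hs]
      ring
    rw [h1, show (j : ℝ) * ((d : ℝ) - 1) / 2 = j * s by rw [hs]; ring,
      Real.rpow_mul zero_le_two, Real.rpow_natCast, ← Real.mul_rpow zero_le_two (by positivity)]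
    refine Real.rpow_le_rpow hn0.le ?_ hs0
    rw [pow_succ] at hn2
    linarith
  calc ENNReal.ofReal V * (ENNReal.ofReal A *
        ∫⁻ u, ENNReal.ofReal (((1 + |ψ u - n|) ^ (d + 1))⁻¹))
      ≤ ENNReal.ofReal V * (ENNReal.ofReal A * ENNReal.ofReal (C₁ * (n : ℝ) ^ (d - 1))) := by
        gcongr
        exact hI n (by omega)
    _ = ENNReal.ofReal (V * (C₀ * C₁) * ((n : ℝ) ^ (-s) * (n : ℝ) ^ (d - 1)) *
          Q.len ^ (-(N : ℝ))) := by
        rw [← ENNReal.ofReal_mul hA0, ← ENNReal.ofReal_mul hV0.le, hA]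
        congr 1
        ring
    _ ≤ _ := by
        refine ENNReal.ofReal_le_ofReal ?_
        rw [mul_assoc (V * (C₀ * C₁)) (2 ^ s)]
        gcongr
end
end

section
/- Let d ≥ 4 and 1 < p < 2(d−1)/(d+1). For each j ≥ 1 let E_j ⊂ (I_j ∩ ℕ) × ℤ^d be finite, let B_{n,z} = K_n ∗ b_{n,z} with |b_{n,z}| ≤ χ_{q_z}, and let Q_j(λ) be the collection of maximal dyadic cubes Q ∈ D_j with #(E_j ∩ Q) > λ^p l(Q). Then there is a constant C₀ such that for all λ > C₀, the Lebesgue measure of { x ∈ ℝ^d : | Σ_{j≥1} 2^{j(d−1)/2} Σ_{Q ∈ Q_j(λ)} Σ_{(n,z) ∈ E_j ∩ Q} B_{n,z}(x) | > λ } is at most C λ^{−p} Σ_{j≥1} 2^{j(d−1)} #E_j, with C independent of λ, the sets E_j and the functions b_{n,z}. -/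
open MeasureTheory Real Set
open scoped Classical FourierTransform RealInnerProductSpace NNReal ENNReal

noncomputable section

/-- Integrating a smooth function over the unit interval in its last variable gives a smooth
function of the remaining variables. -/
theorem contDiff_nat_unitInterval_integral {E : Type} [NormedAddCommGroup E] [NormedSpace ℝ E]
    [FiniteDimensional ℝ E] (n : ℕ) :
    ∀ {F : Type} [NormedAddCommGroup F] [NormedSpace ℝ F] [CompleteSpace F] (f : E × ℝ → F),
      ContDiff ℝ (⊤ : ℕ∞) f → ContDiff ℝ n (fun x => ∫ t in (0 : ℝ)..1, f (x, t)) := by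
  have hE : ProperSpace E := FiniteDimensional.proper ℝ E
  induction n with
  | zero =>
    intro F _ _ _ f hf
    simp only [Nat.cast_zero, contDiff_zero]
    exact intervalIntegral.continuous_parametric_intervalIntegral_of_continuous'
      (f := fun x t => f (x, t))
      (show Continuous fun q : E × ℝ => f (q.1, q.2) from hf.continuous) 0 1
  | succ n ih =>
    intro F _ _ _ f hf
    have hdf : ContDiff ℝ (⊤ : ℕ∞) (fun y => (fderiv ℝ f y).comp
        (ContinuousLinearMap.inl ℝ E ℝ)) := by
      have h1 : ContDiff ℝ (⊤ : ℕ∞) (fderiv ℝ f) := (contDiff_infty_iff_fderiv.1 hf).2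
      exact h1.clm_comp contDiff_const
    rw [Nat.cast_succ, contDiff_succ_iff_hasFDerivAt]
    refine ⟨_, ih _ hdf, fun x₀ => ?_⟩
    have hcomp : IsCompact (Metric.closedBall x₀ 1 ×ˢ Icc (0 : ℝ) 1) :=
      (isCompact_closedBall x₀ 1).prod isCompact_Icc
    obtain ⟨C, hC⟩ := hcomp.exists_bound_of_continuousOn hdf.continuous.continuousOn
    have hc1 : ∀ x, Continuous fun t : ℝ => f (x, t) := fun x => hf.continuous.comp (by fun_prop)
    have hc2 : Continuous fun t : ℝ => (fderiv ℝ f (x₀, t)).comp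
        (ContinuousLinearMap.inl ℝ E ℝ) := hdf.continuous.comp (by fun_prop)
    refine intervalIntegral.hasFDerivAt_integral_of_dominated_of_fderiv_le
      (F := fun x t => f (x, t)) (F' := fun x t => (fderiv ℝ f (x, t)).comp
        (ContinuousLinearMap.inl ℝ E ℝ)) (bound := fun _ => C)
      (Metric.closedBall_mem_nhds x₀ one_pos)
      (Filter.Eventually.of_forall fun x => (hc1 x).aestronglyMeasurable)
      ((hc1 x₀).intervalIntegrable _ _) hc2.aestronglyMeasurable ?_
      (by simp) ?_
    · refine Filter.Eventually.of_forall fun t ht x hx => hC (x, t) ⟨hx, ?_⟩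
      rw [uIoc_of_le zero_le_one] at ht
      exact ⟨ht.1.le, ht.2⟩
    · refine Filter.Eventually.of_forall fun t _ x _ => ?_
      have h1 : HasFDerivAt f (fderiv ℝ f (x, t)) (x, t) :=
        (hf.differentiable (by simp) (x, t)).hasFDerivAt
      have h2 : HasFDerivAt (fun y : E => (y, t)) (ContinuousLinearMap.inl ℝ E ℝ) x :=
        hasFDerivAt_prodMk_left x t
      exact h1.comp x h2

theorem contDiff_unitInterval_integral {E F : Type} [NormedAddCommGroup E] [NormedSpace ℝ E]
    [FiniteDimensional ℝ E] [NormedAddCommGroup F] [NormedSpace ℝ F] [CompleteSpace F]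
    {f : E × ℝ → F} (hf : ContDiff ℝ (⊤ : ℕ∞) f) :
    ContDiff ℝ (⊤ : ℕ∞) (fun x => ∫ t in (0 : ℝ)..1, f (x, t)) :=
  contDiff_infty.2 fun n => contDiff_nat_unitInterval_integral n f hf

theorem norm_iteratedFDeriv_prodMk_right_le {P V F : Type*} [NormedAddCommGroup P]
    [NormedSpace ℝ P] [NormedAddCommGroup V] [NormedSpace ℝ V] [NormedAddCommGroup F]
    [NormedSpace ℝ F] {h : P × V → F} (hh : ContDiff ℝ (⊤ : ℕ∞) h) (n : ℕ) (p : P) (v : V) :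
    ‖iteratedFDeriv ℝ n (fun ζ => h (p, ζ)) v‖ ≤ ‖iteratedFDeriv ℝ n h (p, v)‖ := by
  have h1 : (fun ζ => h (p, ζ)) =
      (fun y => h ((p, (0 : V)) + y)) ∘ (ContinuousLinearMap.inr ℝ P V) := by
    funext ζ; simp
  have h2 : ContDiff ℝ (⊤ : ℕ∞) (fun y => h ((p, (0 : V)) + y)) :=
    hh.comp (contDiff_const.add contDiff_id)
  rw [h1, ContinuousLinearMap.iteratedFDeriv_comp_right _ h2 _ (by exact_mod_cast le_top),
    iteratedFDeriv_comp_add_left]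
  refine (ContinuousMultilinearMap.norm_compContinuousLinearMap_le _ _).trans ?_
  have h3 : ‖ContinuousLinearMap.inr ℝ P V‖ ≤ 1 := ContinuousLinearMap.norm_inr_le_one ℝ P V
  calc _ ≤ ‖iteratedFDeriv ℝ n h (p, v)‖ * 1 := by
        simp only [ContinuousLinearMap.inr_apply, Prod.mk_add_mk, add_zero, zero_add]
        gcongr
        exact Finset.prod_le_one (fun _ _ => norm_nonneg _) (fun _ _ => h3)
    _ = _ := mul_one _

/-- Uniform rapid decay of the Fourier transforms of a smooth compactly parametrized family of
test functions with supports in a common ball. -/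
theorem exists_fourier_decay {P V : Type*} [NormedAddCommGroup P] [NormedSpace ℝ P]
    [NormedAddCommGroup V] [InnerProductSpace ℝ V] [FiniteDimensional ℝ V] [MeasurableSpace V]
    [BorelSpace V] {K : Set P} (hK : IsCompact K) {h : P × V → ℂ}
    (hh : ContDiff ℝ (⊤ : ℕ∞) h) (B : ℝ) (hB : ∀ p ∈ K, ∀ v, h (p, v) ≠ 0 → ‖v‖ ≤ B) (M : ℕ) :
    ∃ C : ℝ, 0 < C ∧ ∀ p ∈ K, ∀ w : V,
      (1 + ‖w‖) ^ M * ‖𝓕 (fun ζ => h (p, ζ)) w‖ ≤ C := by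
  have hproper : ProperSpace V := FiniteDimensional.proper ℝ V
  have hcomp : IsCompact (K ×ˢ Metric.closedBall (0 : V) B) := hK.prod (isCompact_closedBall _ _)
  have hbd : ∀ n : ℕ, ∃ C : ℝ, 0 ≤ C ∧ ∀ p ∈ K, ∀ v : V,
      ‖iteratedFDeriv ℝ n (fun ζ => h (p, ζ)) v‖ ≤
        (Metric.closedBall (0 : V) B).indicator (fun _ => C) v := by
    intro n
    obtain ⟨C, hC⟩ := hcomp.exists_bound_of_continuousOn
      (hh.continuous_iteratedFDeriv (m := n) (by exact_mod_cast le_top)).continuousOn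
    refine ⟨max C 0, le_max_right _ _, fun p hp v => ?_⟩
    by_cases hv : v ∈ Metric.closedBall (0 : V) B
    · rw [indicator_of_mem hv]
      exact (norm_iteratedFDeriv_prodMk_right_le hh n p v).trans
        ((hC (p, v) ⟨hp, hv⟩).trans (le_max_left _ _))
    · rw [indicator_of_notMem hv, norm_le_zero_iff]
      by_contra hne
      apply hv
      have h1 : v ∈ tsupport (fun ζ => h (p, ζ)) :=
        tsupport_iteratedFDeriv_subset (𝕜 := ℝ) n (subset_tsupport _ hne)
      refine closure_minimal ?_ Metric.isClosed_closedBall h1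
      intro y hy
      simpa using hB p hp y hy
  choose D hD0 hD using hbd
  have hsm : ∀ p, ContDiff ℝ (⊤ : ℕ∞) (fun ζ => h (p, ζ)) := fun p =>
    hh.comp (contDiff_const.prodMk contDiff_id)
  set W : ℝ := volume.real (Metric.closedBall (0 : V) B)
  have hindint : ∀ c : ℝ, Integrable ((Metric.closedBall (0 : V) B).indicator fun _ => c) := by
    intro c
    rw [integrable_indicator_iff Metric.isClosed_closedBall.measurableSet]
    exact integrableOn_const (measure_closedBall_lt_top.ne)
  have hint : ∀ n : ℕ, ∀ p ∈ K, Integrable (fun v => ‖iteratedFDeriv ℝ n (fun ζ => h (p, ζ)) v‖) := by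
    intro n p hp
    refine (hindint (D n)).mono' ?_ (Filter.Eventually.of_forall fun v => by
      simpa using hD n p hp v)
    exact ((hsm p).continuous_iteratedFDeriv (m := n)
      (by exact_mod_cast le_top)).norm.aestronglyMeasurable
  have hintle : ∀ n : ℕ, ∀ p ∈ K,
      ∫ v, ‖iteratedFDeriv ℝ n (fun ζ => h (p, ζ)) v‖ ≤ D n * W := by
    intro n p hp
    refine (integral_mono (hint n p hp) (hindint (D n)) (hD n p hp)).trans ?_
    rw [integral_indicator Metric.isClosed_closedBall.measurableSet]
    simp [W, mul_comm]
  have hsupp : ∀ p ∈ K, ∀ k n : ℕ, Integrable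
      (fun v => ‖v‖ ^ k * ‖iteratedFDeriv ℝ n (fun ζ => h (p, ζ)) v‖) := by
    intro p hp k n
    refine ((hint n p hp).const_mul (|B| ^ k)).mono' ?_ (Filter.Eventually.of_forall fun v => ?_)
    · exact ((continuous_norm.pow k).mul ((hsm p).continuous_iteratedFDeriv (m := n)
        (by exact_mod_cast le_top)).norm).aestronglyMeasurable
    · rw [norm_mul, norm_pow, norm_norm, norm_norm]
      by_cases hv : v ∈ Metric.closedBall (0 : V) B
      · gcongr
        exact (mem_closedBall_zero_iff.1 hv).trans (le_abs_self B)
      · have h0 := hD n p hp v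
        rw [indicator_of_notMem hv] at h0
        rw [le_antisymm h0 (norm_nonneg _)]
        simp
  have hmain : ∀ n : ℕ, ∃ C : ℝ, 0 ≤ C ∧ ∀ p ∈ K, ∀ w : V,
      ‖w‖ ^ n * ‖𝓕 (fun ζ => h (p, ζ)) w‖ ≤ C := by
    intro n
    refine ⟨2 ^ n * ∑ q ∈ Finset.range (n + 1), D q * W,
      mul_nonneg (by positivity) (Finset.sum_nonneg fun q _ =>
        mul_nonneg (hD0 q) measureReal_nonneg), fun p hp w => ?_⟩
    have h1 := Real.pow_mul_norm_iteratedFDeriv_fourier_le (K := ⊤) (N := ⊤) (k := 0) (n := n)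
      (hsm p) (fun k n _ _ => hsupp p hp k n) le_top le_top w
    simp only [norm_iteratedFDeriv_zero, pow_zero, one_mul, mul_zero, zero_add,
      CharP.cast_eq_zero] at h1
    refine h1.trans ?_
    gcongr
    rw [Finset.range_one, Finset.singleton_product, Finset.sum_map]
    simp only [Function.Embedding.coeFn_mk, pow_zero, one_mul]
    exact Finset.sum_le_sum fun q _ => hintle q p hp
  obtain ⟨C0, hC0, h0⟩ := hmain 0
  obtain ⟨CM, hCM, hM⟩ := hmain M
  refine ⟨2 ^ (M - 1) * (C0 + CM) + 1, by positivity, fun p hp w => ?_⟩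
  have h1 := h0 p hp w
  have h2 := hM p hp w
  rw [pow_zero, one_mul] at h1
  calc (1 + ‖w‖) ^ M * ‖𝓕 (fun ζ => h (p, ζ)) w‖
      ≤ (2 ^ (M - 1) * (1 ^ M + ‖w‖ ^ M)) * ‖𝓕 (fun ζ => h (p, ζ)) w‖ := by
        gcongr
        exact add_pow_le zero_le_one (norm_nonneg w) M
    _ = 2 ^ (M - 1) * (‖𝓕 (fun ζ => h (p, ζ)) w‖ + ‖w‖ ^ M * ‖𝓕 (fun ζ => h (p, ζ)) w‖) := by
        rw [one_pow]; ring
    _ ≤ 2 ^ (M - 1) * (C0 + CM) := by gcongr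
    _ ≤ _ := by linarith

/-- The self-adjoint map `ζ ↦ ⟪τ, ζ⟫ τ + ε ζ`, of unit size along `τ` and of size `ε` on the
orthogonal complement of `τ`. -/
def squeeze {d : ℕ} (ε : ℝ) (τ : Rd d) : Rd d →L[ℝ] Rd d :=
  (innerSL ℝ τ).smulRight τ + ε • ContinuousLinearMap.id ℝ (Rd d)

theorem squeeze_apply {d : ℕ} (ε : ℝ) (τ ζ : Rd d) :
    squeeze ε τ ζ = (inner ℝ τ ζ : ℝ) • τ + ε • ζ := by
  simp [squeeze]

theorem inner_squeeze {d : ℕ} (ε : ℝ) (τ x y : Rd d) :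
    (inner ℝ x (squeeze ε τ y) : ℝ) = inner ℝ (squeeze ε τ x) y := by
  simp only [squeeze_apply, inner_add_left, inner_add_right, inner_smul_left, inner_smul_right,
    RCLike.conj_to_real, real_inner_comm]
  rw [real_inner_comm x τ]
  ring

theorem inner_self_squeeze {d : ℕ} (ε : ℝ) (τ y : Rd d) :
    (inner ℝ τ (squeeze ε τ y) : ℝ) = inner ℝ τ y * (‖τ‖ ^ 2 + ε) := by
  simp only [squeeze_apply, inner_add_right, inner_smul_right, real_inner_self_eq_norm_sq]
  ring

theorem norm_squeeze_le {d : ℕ} {ε : ℝ} (hε : 0 ≤ ε) (τ y : Rd d) :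
    ‖squeeze ε τ y‖ ≤ ‖τ‖ * |(inner ℝ τ y : ℝ)| + ε * ‖y‖ := by
  rw [squeeze_apply]
  refine (norm_add_le _ _).trans (le_of_eq ?_)
  rw [norm_smul, norm_smul, Real.norm_eq_abs, Real.norm_eq_abs, abs_of_nonneg hε]
  ring

theorem le_norm_squeeze {d : ℕ} {ε : ℝ} (τ y : Rd d) : ε * ‖y‖ ≤ ‖squeeze ε τ y‖ := by
  by_cases hy : y = 0
  · simp [hy]
  have hy0 : 0 < ‖y‖ := norm_pos_iff.2 hy
  have h1 : (inner ℝ y (squeeze ε τ y) : ℝ) = (inner ℝ τ y : ℝ) ^ 2 + ε * ‖y‖ ^ 2 := by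
    simp only [squeeze_apply, inner_add_right, inner_smul_right, real_inner_self_eq_norm_sq]
    rw [real_inner_comm τ y]; ring
  have h2 := real_inner_le_norm y (squeeze ε τ y)
  rw [h1] at h2
  have h3 : ‖y‖ * (ε * ‖y‖) ≤ ‖y‖ * ‖squeeze ε τ y‖ := by nlinarith [sq_nonneg (inner ℝ τ y : ℝ)]
  exact le_of_mul_le_mul_left h3 hy0

theorem abs_inner_le_norm_squeeze {d : ℕ} {ε : ℝ} (hε : 0 ≤ ε) {τ : Rd d} (hτ : τ ≠ 0) (y : Rd d) :
    ‖τ‖ * |(inner ℝ τ y : ℝ)| ≤ ‖squeeze ε τ y‖ := by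
  have hτ0 : 0 < ‖τ‖ := norm_pos_iff.2 hτ
  have h1 := abs_real_inner_le_norm τ (squeeze ε τ y)
  rw [inner_self_squeeze, abs_mul, abs_of_nonneg (by positivity : 0 ≤ ‖τ‖ ^ 2 + ε)] at h1
  have h3 : ‖τ‖ * (‖τ‖ * |(inner ℝ τ y : ℝ)|) ≤ ‖τ‖ * ‖squeeze ε τ y‖ := by
    nlinarith [mul_nonneg hε (abs_nonneg (inner ℝ τ y : ℝ))]
  exact le_of_mul_le_mul_left h3 hτ0

theorem norm_sq_mul_norm_sq_sub_squeeze {d : ℕ} (ε : ℝ) (τ y : Rd d) :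
    ‖squeeze ε τ y‖ ^ 2 * ‖τ‖ ^ 2 - (inner ℝ (squeeze ε τ y) τ : ℝ) ^ 2 =
      ε ^ 2 * (‖y‖ ^ 2 * ‖τ‖ ^ 2 - (inner ℝ τ y : ℝ) ^ 2) := by
  rw [real_inner_comm, inner_self_squeeze, ← real_inner_self_eq_norm_sq (squeeze ε τ y)]
  simp only [squeeze_apply, inner_add_right, inner_add_left, inner_smul_right, inner_smul_left,
    real_inner_self_eq_norm_sq, RCLike.conj_to_real]
  rw [real_inner_comm τ y]
  ring

theorem det_squeeze {d : ℕ} (hd : 1 ≤ d) {ε : ℝ} (hε : 0 < ε) (τ : Rd d) :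
    LinearMap.det (squeeze ε τ : Rd d →ₗ[ℝ] Rd d) = ε ^ (d - 1) * (ε + ‖τ‖ ^ 2) := by
  set b := (EuclideanSpace.basisFun (Fin d) ℝ).toBasis
  have hM : LinearMap.toMatrix b b (squeeze ε τ : Rd d →ₗ[ℝ] Rd d) =
      ε • (1 + Matrix.replicateCol Unit (fun i => ε⁻¹ * τ i) *
        Matrix.replicateRow Unit (fun i => τ i)) := by
    ext i j
    rw [LinearMap.toMatrix_apply]
    simp only [b, OrthonormalBasis.coe_toBasis, OrthonormalBasis.coe_toBasis_repr_apply,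
      EuclideanSpace.basisFun_repr, EuclideanSpace.basisFun_apply, ContinuousLinearMap.coe_coe,
      squeeze_apply, Matrix.smul_apply, Matrix.add_apply, Matrix.mul_apply,
      smul_eq_mul, PiLp.add_apply, PiLp.smul_apply, EuclideanSpace.inner_single_right]
    by_cases hij : i = j <;> simp [Matrix.one_apply, hij] <;> field_simp
    exact add_comm _ _
  rw [← LinearMap.det_toMatrix b, hM, Matrix.det_smul,
    Matrix.det_one_add_replicateCol_mul_replicateRow, Fintype.card_fin, EuclideanSpace.norm_sq_eq]
  have h1 : (fun i => τ i) ⬝ᵥ (fun i => ε⁻¹ * τ i) = ε⁻¹ * ∑ i, ‖τ i‖ ^ 2 := by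
    simp only [dotProduct, Finset.mul_sum, Real.norm_eq_abs, sq_abs]
    exact Finset.sum_congr rfl fun i _ => by ring
  rw [h1]
  obtain ⟨k, rfl⟩ : ∃ k, d = k + 1 := ⟨d - 1, by omega⟩
  simp only [Nat.add_sub_cancel]
  field_simp
  rw [pow_succ']

/-- The closed shell of radii between `1` and `R`. -/
def shell (d : ℕ) (R : ℝ) : Set (Rd d) := {τ | 1 ≤ ‖τ‖ ∧ ‖τ‖ ≤ R}

theorem isCompact_shell (d : ℕ) (R : ℝ) : IsCompact (shell d R) := by
  refine (isCompact_closedBall (0 : Rd d) R).of_isClosed_subset ?_ fun τ hτ => by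
    simpa using hτ.2
  exact (isClosed_le continuous_const continuous_norm).inter
    (isClosed_le continuous_norm continuous_const)

theorem measurableSet_shell (d : ℕ) (R : ℝ) : MeasurableSet (shell d R) :=
  (isCompact_shell d R).measurableSet

theorem ne_zero_of_mem_shell {d : ℕ} {R : ℝ} {τ : Rd d} (h : τ ∈ shell d R) : τ ≠ 0 := by
  rintro rfl
  have := h.1
  simp at this
  linarith

/-- The image of a ball around `2 τ` under `squeeze δ τ` has measure at least of order
`δ ^ (d - 1)`. -/
theorem volume_squeeze_image_ge {d : ℕ} (hd : 1 ≤ d) :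
    ∃ c : ℝ, 0 < c ∧ ∀ δ : ℝ, 0 < δ → ∀ τ : Rd d, 1 ≤ ‖τ‖ →
      ENNReal.ofReal (c * δ ^ (d - 1)) ≤
        volume (squeeze δ τ '' Metric.ball ((2 : ℝ) • τ) (1 / 4)) := by
  have hpos : 0 < volume (Metric.ball (0 : Rd d) (1 / 4)) :=
    Metric.measure_ball_pos _ _ (by norm_num)
  have hfin : volume (Metric.ball (0 : Rd d) (1 / 4)) ≠ ⊤ := measure_ball_lt_top.ne
  refine ⟨(volume (Metric.ball (0 : Rd d) (1 / 4))).toReal, ENNReal.toReal_pos hpos.ne' hfin,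
    fun δ hδ τ hτ => ?_⟩
  have h1 := Measure.addHaar_image_linearMap (volume : Measure (Rd d))
    (squeeze δ τ : Rd d →ₗ[ℝ] Rd d) (Metric.ball ((2 : ℝ) • τ) (1 / 4))
  rw [ContinuousLinearMap.coe_coe] at h1
  rw [h1, det_squeeze hd hδ, Measure.addHaar_ball_center volume ((2 : ℝ) • τ), mul_comm,
    ENNReal.ofReal_mul (by positivity), ENNReal.ofReal_toReal hfin]
  refine mul_le_mul' (ENNReal.ofReal_le_ofReal ?_) le_rfl
  rw [abs_of_nonneg (by positivity)]
  have : 1 ≤ δ + ‖τ‖ ^ 2 := by nlinarith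
  exact le_mul_of_one_le_right (by positivity) this

theorem inner_ge_of_mem_ball {d : ℕ} {τ ζ : Rd d} (hτ : 1 ≤ ‖τ‖)
    (hζ : ζ ∈ Metric.ball ((2 : ℝ) • τ) (1 / 4)) : 1 ≤ (inner ℝ τ ζ : ℝ) := by
  have h1 : (inner ℝ τ ζ : ℝ) = 2 * ‖τ‖ ^ 2 + inner ℝ τ (ζ - (2 : ℝ) • τ) := by
    rw [inner_sub_right, inner_smul_right, real_inner_self_eq_norm_sq]; ring
  have h2 := (abs_le.1 (abs_real_inner_le_norm τ (ζ - (2 : ℝ) • τ))).1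
  rw [mem_ball_iff_norm] at hζ
  nlinarith [norm_nonneg (ζ - (2 : ℝ) • τ)]

theorem one_le_norm_squeeze_of_mem_ball {d : ℕ} {δ : ℝ} (hδ : 0 ≤ δ) {τ ζ : Rd d} (hτ : 1 ≤ ‖τ‖)
    (hζ : ζ ∈ Metric.ball ((2 : ℝ) • τ) (1 / 4)) : 1 ≤ ‖squeeze δ τ ζ‖ := by
  have h1 := inner_ge_of_mem_ball hτ hζ
  have h2 := abs_inner_le_norm_squeeze hδ (norm_pos_iff.1 (by linarith)) ζ
  have h3 := le_abs_self (inner ℝ τ ζ : ℝ)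
  nlinarith

theorem norm_le_of_mem_ball {d : ℕ} {τ ζ : Rd d}
    (hζ : ζ ∈ Metric.ball ((2 : ℝ) • τ) (1 / 4)) : ‖ζ‖ ≤ 2 * ‖τ‖ + 1 / 4 := by
  rw [mem_ball_iff_norm] at hζ
  have h1 := norm_sub_norm_le ζ ((2 : ℝ) • τ)
  rw [norm_smul] at h1
  norm_num at h1
  linarith

theorem norm_squeeze_le_of_mem_ball {d : ℕ} {δ : ℝ} (hδ : 0 ≤ δ) (hδ1 : δ ≤ 1) {τ ζ : Rd d}
    (hζ : ζ ∈ Metric.ball ((2 : ℝ) • τ) (1 / 4)) :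
    ‖squeeze δ τ ζ‖ ≤ (‖τ‖ ^ 2 + 1) * (2 * ‖τ‖ + 1 / 4) := by
  refine (norm_squeeze_le hδ τ ζ).trans ?_
  have h1 := norm_le_of_mem_ball hζ
  have h2 := abs_real_inner_le_norm τ ζ
  have h3 : ‖τ‖ * |(inner ℝ τ ζ : ℝ)| ≤ ‖τ‖ * (‖τ‖ * (2 * ‖τ‖ + 1 / 4)) := by gcongr; exact h2.trans (by gcongr)
  have h4 : δ * ‖ζ‖ ≤ 1 * (2 * ‖τ‖ + 1 / 4) := by gcongr
  nlinarith

/-- A cutoff to those `τ` whose distance to the ray through `ξ` is at most of order `ε`. -/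
def angWeight {d : ℕ} (ε : ℝ) (ξ τ : Rd d) : ℝ :=
  smoothTransition (2 - 4 * ((ε⁻¹) ^ 2 * (‖τ‖ ^ 2 - (inner ℝ ξ τ : ℝ) ^ 2 / ‖ξ‖ ^ 2))) *
    (if 0 < (inner ℝ ξ τ : ℝ) then 1 else 0)

theorem angWeight_nonneg {d : ℕ} (ε : ℝ) (ξ τ : Rd d) : 0 ≤ angWeight ε ξ τ := by
  unfold angWeight
  have := smoothTransition.nonneg
    (2 - 4 * ((ε⁻¹) ^ 2 * (‖τ‖ ^ 2 - (inner ℝ ξ τ : ℝ) ^ 2 / ‖ξ‖ ^ 2)))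
  split_ifs
  · rw [mul_one]; exact this
  · rw [mul_zero]

theorem angWeight_le_one {d : ℕ} (ε : ℝ) (ξ τ : Rd d) : angWeight ε ξ τ ≤ 1 := by
  unfold angWeight
  have := smoothTransition.le_one
    (2 - 4 * ((ε⁻¹) ^ 2 * (‖τ‖ ^ 2 - (inner ℝ ξ τ : ℝ) ^ 2 / ‖ξ‖ ^ 2)))
  split_ifs
  · rw [mul_one]; exact this
  · rw [mul_zero]; exact zero_le_one

theorem measurable_angWeight {d : ℕ} (ε : ℝ) :
    Measurable fun q : Rd d × Rd d => angWeight ε q.1 q.2 := by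
  unfold angWeight
  have h1 : Measurable fun q : Rd d × Rd d => (inner ℝ q.1 q.2 : ℝ) :=
    (continuous_inner (𝕜 := ℝ)).measurable
  refine Measurable.mul ?_ (Measurable.ite (measurableSet_lt measurable_const h1)
    measurable_const measurable_const)
  exact smoothTransition.continuous.measurable.comp (by fun_prop)

theorem angWeight_smul {d : ℕ} (ε : ℝ) {t : ℝ} (ht : 0 < t) (ξ τ : Rd d) :
    angWeight ε (t • ξ) τ = angWeight ε ξ τ := by
  unfold angWeight
  have h1 : (0 < (inner ℝ (t • ξ) τ : ℝ)) ↔ 0 < (inner ℝ ξ τ : ℝ) := by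
    rw [inner_smul_left, RCLike.conj_to_real, mul_pos_iff_of_pos_left ht]
  have h2 : (inner ℝ (t • ξ) τ : ℝ) ^ 2 / ‖t • ξ‖ ^ 2 = (inner ℝ ξ τ : ℝ) ^ 2 / ‖ξ‖ ^ 2 := by
    rw [inner_smul_left, RCLike.conj_to_real, norm_smul, Real.norm_eq_abs, abs_of_pos ht, mul_pow,
      mul_pow, mul_div_mul_left _ _ (by positivity)]
  simp only [h1, h2]

theorem angWeight_map {d : ℕ} (ε : ℝ) (R : Rd d ≃ₗᵢ[ℝ] Rd d) (ξ τ : Rd d) :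
    angWeight ε (R ξ) (R τ) = angWeight ε ξ τ := by
  simp [angWeight]

theorem integrableOn_angWeight {d : ℕ} (ε R : ℝ) (ξ : Rd d) :
    IntegrableOn (angWeight ε ξ) (shell d R) := by
  refine Measure.integrableOn_of_bounded (M := 1) (isCompact_shell d R).measure_lt_top.ne
    ((measurable_angWeight ε).comp measurable_prodMk_left).aestronglyMeasurable
    (Filter.Eventually.of_forall fun τ => ?_)
  rw [Real.norm_eq_abs, abs_of_nonneg (angWeight_nonneg ε ξ τ)]
  exact angWeight_le_one ε ξ τ

theorem integral_angWeight_eq {d : ℕ} (ε R : ℝ) {ξ ξ' : Rd d} (hξ : ξ ≠ 0) (hξ' : ξ' ≠ 0) :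
    ∫ τ in shell d R, angWeight ε ξ τ = ∫ τ in shell d R, angWeight ε ξ' τ := by
  have h0 : 0 < ‖ξ‖ := norm_pos_iff.2 hξ
  have h0' : 0 < ‖ξ'‖ := norm_pos_iff.2 hξ'
  set v : Rd d := ‖ξ‖⁻¹ • ξ
  set w : Rd d := ‖ξ'‖⁻¹ • ξ'
  have hvw : ‖v‖ = ‖w‖ := by simp [v, w, norm_smul, h0.ne', h0'.ne']
  set S := (ℝ ∙ (v - w))ᗮ.reflection
  have hS : S v = w := Submodule.reflection_sub hvw
  have h1 : ∀ τ, angWeight ε ξ τ = angWeight ε ξ' (S τ) := fun τ => by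
    rw [← angWeight_smul ε (inv_pos.2 h0) ξ, ← angWeight_smul ε (inv_pos.2 h0') ξ',
      ← angWeight_map ε S]
    change angWeight ε (S v) _ = angWeight ε w _
    rw [hS]
  have h2 : S ⁻¹' shell d R = shell d R := by
    ext τ; simp [shell]
  simp_rw [h1]
  have h3 := S.measurePreserving.setIntegral_preimage_emb
    S.toHomeomorph.measurableEmbedding (angWeight ε ξ') (shell d R)
  rw [h2] at h3
  exact h3

theorem exists_integral_angWeight {d : ℕ} (hd : 1 ≤ d) :
    ∃ c : ℝ, 0 < c ∧ ∀ ε : ℝ, 0 < ε → ε ≤ 1 → ∃ N : ℝ, c * ε ^ (d - 1) ≤ N ∧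
      ∀ ξ : Rd d, ξ ≠ 0 → ∫ τ in shell d 5, angWeight ε ξ τ = N := by
  obtain ⟨c, hc, hvol⟩ := volume_squeeze_image_ge hd
  refine ⟨c, hc, fun ε hε hε1 => ?_⟩
  set ω : Rd d := EuclideanSpace.single ⟨0, hd⟩ 1
  have hω : ‖ω‖ = 1 := by simp [ω]
  have hω0 : ω ≠ 0 := norm_pos_iff.1 (by rw [hω]; exact one_pos)
  refine ⟨_, ?_, fun ξ hξ => integral_angWeight_eq ε 5 hξ hω0⟩
  set A : Set (Rd d) := {τ | 1 ≤ angWeight ε ω τ} ∩ shell d 5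
  have hA : MeasurableSet A := (measurableSet_le measurable_const
    ((measurable_angWeight ε).comp measurable_prodMk_left)).inter (measurableSet_shell d 5)
  have hAfin : volume A ≠ ⊤ :=
    ((measure_mono inter_subset_right).trans_lt (isCompact_shell d 5).measure_lt_top).ne
  have hsub : squeeze ε ω '' Metric.ball ((2 : ℝ) • ω) (1 / 4) ⊆ A := by
    rintro _ ⟨ζ, hζ, rfl⟩
    have hρ := inner_ge_of_mem_ball hω.ge hζ
    refine ⟨?_, one_le_norm_squeeze_of_mem_ball hε.le hω.ge hζ, ?_⟩
    · have h1 : 0 < (inner ℝ ω (squeeze ε ω ζ) : ℝ) := by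
        rw [inner_self_squeeze]; positivity
      have h2 := norm_sq_mul_norm_sq_sub_squeeze ε ω ζ
      rw [hω, real_inner_comm] at h2
      simp only [Set.mem_ofPred_eq, angWeight, if_pos h1, mul_one, hω, one_pow, div_one] at h2 ⊢
      have h5 : ∀ X : ℝ, ε⁻¹ ^ 2 * (ε ^ 2 * X) = X := fun X => by field_simp
      rw [h2, h5]
      rw [mem_ball_iff_norm] at hζ
      have h3 : ‖ζ‖ ^ 2 - (inner ℝ ω ζ : ℝ) ^ 2 ≤ ‖ζ - (2 : ℝ) • ω‖ ^ 2 := by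
        rw [norm_sub_sq_real, norm_smul, hω, inner_smul_right, real_inner_comm]
        norm_num
        nlinarith [sq_nonneg ((inner ℝ ζ ω : ℝ) - 2)]
      have h4 : ‖ζ - (2 : ℝ) • ω‖ ^ 2 ≤ (1 / 4) ^ 2 := by gcongr
      rw [smoothTransition.one_of_one_le]
      nlinarith
    · refine (norm_squeeze_le_of_mem_ball hε.le hε1 hζ).trans ?_
      rw [hω]; norm_num
  have h1 : c * ε ^ (d - 1) ≤ volume.real A := by
    have := (hvol ε hε ω hω.ge).trans (measure_mono hsub)
    exact (ENNReal.ofReal_le_iff_le_toReal hAfin).1 this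
  refine h1.trans ?_
  have h2 : volume.real A = ∫ τ in shell d 5, A.indicator (fun _ => (1 : ℝ)) τ := by
    rw [setIntegral_indicator hA, inter_eq_right.2 inter_subset_right]
    simp
    rfl
  rw [h2]
  refine setIntegral_mono_on ?_ (integrableOn_angWeight ε 5 ω) (measurableSet_shell d 5) ?_
  · exact (integrable_indicator_iff hA).2 (integrableOn_const hAfin) |>.integrableOn
  · intro τ _
    by_cases hτ : τ ∈ A
    · rw [indicator_of_mem hτ]; exact hτ.1
    · rw [indicator_of_notMem hτ]; exact angWeight_nonneg ε ω τ

theorem contDiff_mul_of_eventually_eq_zero {E : Type*} [NormedAddCommGroup E] [NormedSpace ℝ E]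
    {χ f : E → ℝ} {n : ℕ∞} (hχ : ContDiff ℝ n χ)
    (h : ∀ x, ContDiffAt ℝ n f x ∨ ∀ᶠ y in nhds x, χ y = 0) :
    ContDiff ℝ n fun x => χ x * f x := by
  refine contDiff_iff_contDiffAt.2 fun x => ?_
  rcases h x with hx | hx
  · exact hχ.contDiffAt.mul hx
  · refine (contDiffAt_const (c := (0 : ℝ))).congr_of_eventuallyEq ?_
    filter_upwards [hx] with y hy
    rw [hy, zero_mul]

/-- A smooth function on `ℝ` that agrees with `x ↦ x⁻¹` for `x ≥ c`. -/
def smoothInv (c x : ℝ) : ℝ := smoothTransition (2 * c⁻¹ * x - 1) * x⁻¹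

theorem contDiff_smoothInv {c : ℝ} (hc : 0 < c) : ContDiff ℝ (⊤ : ℕ∞) (smoothInv c) := by
  refine contDiff_mul_of_eventually_eq_zero
    (smoothTransition.contDiff.comp (by fun_prop)) fun x => ?_
  by_cases hx : x = 0
  · right
    have : ∀ᶠ y : ℝ in nhds x, y < c / 2 := by
      subst hx; exact eventually_lt_nhds (by positivity)
    filter_upwards [this] with y hy
    refine smoothTransition.zero_of_nonpos ?_
    have : 2 * c⁻¹ * y = y / (c / 2) := by field_simp
    rw [this, sub_nonpos, div_le_one (by positivity)]
    exact hy.le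
  · left; exact contDiffAt_inv ℝ hx

theorem smoothInv_eq {c x : ℝ} (hc : 0 < c) (hx : c ≤ x) : smoothInv c x = x⁻¹ := by
  rw [smoothInv, smoothTransition.one_of_one_le, one_mul]
  have : 2 * c⁻¹ * x = 2 * (x / c) := by field_simp
  rw [this]
  have := (one_le_div hc).2 hx
  linarith

namespace IsDistFn

variable {d : ℕ} {a : Rd d → ℝ}

theorem map_zero (ha : IsDistFn a) : a 0 = 0 := by
  have := ha.homog 2 two_pos 0
  rw [smul_zero] at this
  linarith

theorem contDiffAt (ha : IsDistFn a) {ξ : Rd d} (hξ : ξ ≠ 0) : ContDiffAt ℝ (⊤ : ℕ∞) a ξ :=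
  ha.smooth.contDiffAt (isOpen_ne.mem_nhds hξ)

theorem exists_bounds (ha : IsDistFn a) :
    ∃ c C : ℝ, 0 < c ∧ 0 < C ∧ ∀ ξ : Rd d, c * ‖ξ‖ ≤ a ξ ∧ a ξ ≤ C * ‖ξ‖ := by
  have hK : IsCompact (Metric.sphere (0 : Rd d) 1) := isCompact_sphere _ _
  have hne : ∀ ξ ∈ Metric.sphere (0 : Rd d) 1, ξ ≠ 0 := fun ξ hξ h0 => by
    rw [h0] at hξ; simp at hξ
  have hcont : ContinuousOn a (Metric.sphere (0 : Rd d) 1) := fun ξ hξ =>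
    (ha.contDiffAt (hne ξ hξ)).continuousAt.continuousWithinAt
  obtain ⟨c, hc, hlow⟩ : ∃ c : ℝ, 0 < c ∧ ∀ ξ ∈ Metric.sphere (0 : Rd d) 1, c ≤ a ξ := by
    rcases (Metric.sphere (0 : Rd d) 1).eq_empty_or_nonempty with h | h
    · exact ⟨1, one_pos, by simp [h]⟩
    · obtain ⟨x, hx, hmin⟩ := hK.exists_isMinOn h hcont
      exact ⟨a x, ha.pos x (hne x hx), fun ξ hξ => hmin hξ⟩
  obtain ⟨C, hC⟩ := hK.exists_bound_of_continuousOn hcont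
  refine ⟨c, max C 1, hc, by positivity, fun ξ => ?_⟩
  by_cases hξ : ξ = 0
  · simp [hξ, ha.map_zero]
  have h0 : 0 < ‖ξ‖ := norm_pos_iff.2 hξ
  have hmem : ‖ξ‖⁻¹ • ξ ∈ Metric.sphere (0 : Rd d) 1 := by simp [norm_smul, h0.ne']
  have h1 : a ξ = ‖ξ‖ * a (‖ξ‖⁻¹ • ξ) := by
    rw [← ha.homog _ h0, smul_smul, mul_inv_cancel₀ h0.ne', one_smul]
  have h2 := hlow _ hmem
  have h3 := (le_abs_self _).trans ((hC _ hmem).trans (le_max_left C 1))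
  rw [h1, mul_comm c, mul_comm _ ‖ξ‖]
  exact ⟨by gcongr, by gcongr⟩

end IsDistFn

theorem integral_one_sub_mul_fderiv_fderiv {E : Type*} [NormedAddCommGroup E] [NormedSpace ℝ E]
    {A : E → ℝ} (hA : ContDiff ℝ (⊤ : ℕ∞) A) (x w : E) :
    ∫ t in (0 : ℝ)..1, (1 - t) * fderiv ℝ (fderiv ℝ A) (x + t • w) w w =
      A (x + w) - A x - fderiv ℝ A x w := by
  have hA' : ContDiff ℝ (⊤ : ℕ∞) (fderiv ℝ A) := hA.fderiv_right (by simp)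
  have hl : ∀ t : ℝ, HasDerivAt (fun t : ℝ => x + t • w) w t := fun t => by
    simpa using ((hasDerivAt_id t).smul_const w).const_add x
  have h0 : ∀ t : ℝ, HasDerivAt (fun t : ℝ => A (x + t • w)) (fderiv ℝ A (x + t • w) w) t :=
    fun t => (hA.differentiable (by simp) _).hasFDerivAt.comp_hasDerivAt t (hl t)
  have h1 : ∀ t : ℝ, HasDerivAt (fun t : ℝ => fderiv ℝ A (x + t • w) w)
      (fderiv ℝ (fderiv ℝ A) (x + t • w) w w) t := fun t => by
    have hd : DifferentiableAt ℝ (fderiv ℝ A) (x + t • w) :=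
      hA'.differentiable (by simp) _
    have h : HasDerivAt (fun t : ℝ => fderiv ℝ A (x + t • w))
        (fderiv ℝ (fderiv ℝ A) (x + t • w) w) t :=
      HasFDerivAt.comp_hasDerivAt (l := fderiv ℝ A) t hd.hasFDerivAt (hl t)
    refine (h.clm_apply (hasDerivAt_const t w)).congr_deriv ?_
    simp
  have h2 : ∀ t : ℝ, HasDerivAt
      (fun t : ℝ => (1 - t) * fderiv ℝ A (x + t • w) w + A (x + t • w))
      ((1 - t) * fderiv ℝ (fderiv ℝ A) (x + t • w) w w) t := fun t => by
    have := (((hasDerivAt_id t).const_sub 1).mul (h1 t)).add (h0 t)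
    refine this.congr_deriv ?_
    simp
  have hc : Continuous fun t : ℝ => (1 - t) * fderiv ℝ (fderiv ℝ A) (x + t • w) w w := by
    have h3 : Continuous (fderiv ℝ (fderiv ℝ A)) := (hA'.fderiv_right (m := 0) (by simp)).continuous
    have h4 : Continuous fun t : ℝ => x + t • w := by fun_prop
    exact (continuous_const.sub continuous_id).mul
      (((h3.comp h4).clm_apply continuous_const).clm_apply continuous_const)
  rw [intervalIntegral.integral_eq_sub_of_hasDerivAt (fun t _ => h2 t) (hc.intervalIntegrable _ _)]
  simp
  ring

/-- `A` is a smooth function on the whole space extending `a` from the complement of a ball. -/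
structure IsSmoothExt {d : ℕ} (a A : Rd d → ℝ) : Prop where
  smooth : ContDiff ℝ (⊤ : ℕ∞) A
  eq : ∀ ξ : Rd d, 1 / 2 ≤ ‖ξ‖ → A ξ = a ξ

theorem IsDistFn.exists_smoothExt {d : ℕ} {a : Rd d → ℝ} (ha : IsDistFn a) :
    ∃ A, IsSmoothExt a A := by
  refine ⟨fun ξ => smoothTransition (8 * ‖ξ‖ ^ 2 - 1) * a ξ, ?_, fun ξ hξ => ?_⟩
  · refine contDiff_mul_of_eventually_eq_zero (smoothTransition.contDiff.comp ?_) fun ξ => ?_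
    · exact (contDiff_const.mul (contDiff_norm_sq ℝ)).sub contDiff_const
    · by_cases hξ : ξ = 0
      · right
        have : ∀ᶠ y : Rd d in nhds ξ, 8 * ‖y‖ ^ 2 - 1 < 0 := by
          have hc : Continuous fun y : Rd d => 8 * ‖y‖ ^ 2 - 1 := by fun_prop
          refine hc.continuousAt.eventually_lt continuousAt_const ?_
          simp [hξ]
        filter_upwards [this] with y hy
        exact smoothTransition.zero_of_nonpos hy.le
      · left; exact ha.contDiffAt hξ
  · rw [smoothTransition.one_of_one_le (by nlinarith), one_mul]

namespace IsSmoothExt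

variable {d : ℕ} {a A : Rd d → ℝ}

theorem contDiff_fderiv (hA : IsSmoothExt a A) : ContDiff ℝ (⊤ : ℕ∞) (fderiv ℝ A) :=
  hA.smooth.fderiv_right (by simp)

theorem continuous_gradient (hA : IsSmoothExt a A) : Continuous (gradient A) :=
  (InnerProductSpace.toDual ℝ (Rd d)).symm.continuous.comp hA.contDiff_fderiv.continuous

theorem differentiable (hA : IsSmoothExt a A) : Differentiable ℝ A :=
  hA.smooth.differentiable (by simp)

theorem inner_gradient (x v : Rd d) :
    (inner ℝ (gradient A x) v : ℝ) = fderiv ℝ A x v := by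
  simp [gradient]

theorem map_smul (ha : IsDistFn a) (hA : IsSmoothExt a A) {t : ℝ} {ξ : Rd d} (ht : 0 < t)
    (hξ : 1 / 2 ≤ ‖ξ‖) (htξ : 1 / 2 ≤ ‖t • ξ‖) : A (t • ξ) = t * A ξ := by
  rw [hA.eq _ hξ, hA.eq _ htξ, ha.homog t ht]

theorem inner_gradient_self (ha : IsDistFn a) (hA : IsSmoothExt a A) {ξ : Rd d} (hξ : 1 ≤ ‖ξ‖) :
    (inner ℝ (gradient A ξ) ξ : ℝ) = A ξ := by
  rw [inner_gradient]
  have h1 : HasDerivAt (fun t : ℝ => A (t • ξ)) (fderiv ℝ A ξ ξ) 1 := by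
    have hl : HasDerivAt (fun t : ℝ => t • ξ) ξ 1 := by
      simpa using (hasDerivAt_id (1 : ℝ)).smul_const ξ
    have hf : HasFDerivAt A (fderiv ℝ A ξ) ((1 : ℝ) • ξ) := by
      rw [one_smul]; exact (hA.differentiable ξ).hasFDerivAt
    exact hf.comp_hasDerivAt (1 : ℝ) hl
  have h2 : HasDerivAt (fun t : ℝ => t * A ξ) (A ξ) 1 := by
    simpa using (hasDerivAt_id (1 : ℝ)).mul_const (A ξ)
  refine h1.unique (h2.congr_of_eventuallyEq ?_)
  filter_upwards [lt_mem_nhds (show (1 / 2 : ℝ) < 1 by norm_num)] with t ht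
  refine hA.map_smul ha (by linarith) (by linarith) ?_
  rw [norm_smul, Real.norm_eq_abs, abs_of_pos (by linarith)]
  nlinarith

theorem gradient_smul (ha : IsDistFn a) (hA : IsSmoothExt a A) {t : ℝ} {ξ : Rd d} (ht : 0 < t)
    (hξ : 1 ≤ ‖ξ‖) (htξ : 1 ≤ ‖t • ξ‖) : gradient A (t • ξ) = gradient A ξ := by
  refine congrArg (InnerProductSpace.toDual ℝ (Rd d)).symm ?_
  have h1 : HasFDerivAt (fun y => A (t • y)) (t • fderiv ℝ A (t • ξ)) ξ := by
    have hl : HasFDerivAt (fun y : Rd d => t • y) (t • ContinuousLinearMap.id ℝ (Rd d)) ξ :=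
      (hasFDerivAt_id ξ).const_smul t
    refine ((hA.differentiable (t • ξ)).hasFDerivAt.comp ξ hl).congr_fderiv ?_
    ext v
    simp
  have h2 : HasFDerivAt (fun y => t * A y) (t • fderiv ℝ A ξ) ξ :=
    (hA.differentiable ξ).hasFDerivAt.const_mul t
  have h3 : t • fderiv ℝ A (t • ξ) = t • fderiv ℝ A ξ := by
    refine h1.unique (h2.congr_of_eventuallyEq ?_)
    have e1 : ∀ᶠ y : Rd d in nhds ξ, 1 / 2 < ‖y‖ :=
      continuous_norm.continuousAt.eventually_const_lt (by linarith)
    have e2 : ∀ᶠ y : Rd d in nhds ξ, 1 / 2 < ‖t • y‖ :=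
      (continuous_norm.comp (continuous_const_smul t)).continuousAt.eventually_const_lt
        (by simp only [Function.comp]; linarith)
    filter_upwards [e1, e2] with y hy1 hy2
    exact hA.map_smul ha ht hy1.le hy2.le
  exact smul_right_injective _ ht.ne' h3

/-- Taylor expansion to second order with integral remainder. -/
theorem taylor (hA : IsSmoothExt a A) (x w : Rd d) :
    ∫ t in (0 : ℝ)..1, (1 - t) * fderiv ℝ (fderiv ℝ A) (x + t • w) w w =
      A (x + w) - A x - inner ℝ (gradient A x) w := by
  rw [inner_gradient]
  exact integral_one_sub_mul_fderiv_fderiv hA.smooth x w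

end IsSmoothExt

namespace IsBump

variable {d : ℕ} {a : Rd d → ℝ} {η : ℝ → ℝ}

theorem exists_bounds (hη : IsBump η) (ha : IsDistFn a) :
    ∃ c C : ℝ, 0 < c ∧ 0 < C ∧ ∀ ξ : Rd d, η (a ξ) ≠ 0 → c ≤ ‖ξ‖ ∧ ‖ξ‖ ≤ C := by
  obtain ⟨c, C, hc, hC, h⟩ := ha.exists_bounds
  refine ⟨1 / 8 / C, 8 / c, by positivity, by positivity, fun ξ hξ => ?_⟩
  have h1 : a ξ ∈ Icc (1 / 8 : ℝ) 8 := by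
    by_contra h2; exact hξ (hη.supp _ h2)
  obtain ⟨h3, h4⟩ := h ξ
  rw [div_le_iff₀ hC, le_div_iff₀ hc]
  exact ⟨by linarith [h1.1], by linarith [h1.2]⟩

theorem contDiff_comp (hη : IsBump η) (ha : IsDistFn a) :
    ContDiff ℝ (⊤ : ℕ∞) fun ξ => η (a ξ) := by
  refine contDiff_iff_contDiffAt.2 fun ξ => ?_
  by_cases hξ : ξ = 0
  · obtain ⟨c, C, hc, hC, h⟩ := hη.exists_bounds ha
    refine (contDiffAt_const (c := (0 : ℝ))).congr_of_eventuallyEq ?_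
    have : ∀ᶠ y : Rd d in nhds ξ, ‖y‖ < c :=
      continuous_norm.continuousAt.eventually_lt_const (by simpa [hξ] using hc)
    filter_upwards [this] with y hy
    by_contra h0
    exact absurd (h y h0).1 (not_le.2 hy)
  · exact hη.smooth.contDiffAt.comp ξ (ha.contDiffAt hξ)

end IsBump

theorem contDiff_squeeze_apply {d : ℕ} :
    ContDiff ℝ (⊤ : ℕ∞) fun q : (ℝ × Rd d) × Rd d => squeeze q.1.1 q.1.2 q.2 := by
  simp only [squeeze_apply]
  have h1 : ContDiff ℝ (⊤ : ℕ∞) fun q : (ℝ × Rd d) × Rd d => q.1.2 := contDiff_fst.snd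
  have h2 : ContDiff ℝ (⊤ : ℕ∞) fun q : (ℝ × Rd d) × Rd d => q.1.1 := contDiff_fst.fst
  exact ((h1.inner ℝ contDiff_snd).smul h1).add (h2.smul contDiff_snd)

/-- The second order Taylor remainder of `A` along the segment from `τ` to `τ + ε v`, divided by
`ε ^ 2`. -/
def taylorRem {d : ℕ} (A : Rd d → ℝ) (ε : ℝ) (τ v : Rd d) : ℝ :=
  ∫ t in (0 : ℝ)..1, (1 - t) * fderiv ℝ (fderiv ℝ A) (τ + t • ε • v) v v

theorem contDiff_taylorRem {d : ℕ} {A : Rd d → ℝ} (hA : ContDiff ℝ (⊤ : ℕ∞) A) :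
    ContDiff ℝ (⊤ : ℕ∞) fun q : (ℝ × Rd d) × Rd d => taylorRem A q.1.1 q.1.2 q.2 := by
  have h2 : ContDiff ℝ (⊤ : ℕ∞) (fderiv ℝ (fderiv ℝ A)) :=
    (hA.fderiv_right (m := (⊤ : ℕ∞)) (by simp)).fderiv_right (by simp)
  refine contDiff_unitInterval_integral (f := fun q : ((ℝ × Rd d) × Rd d) × ℝ =>
    (1 - q.2) * fderiv ℝ (fderiv ℝ A) (q.1.1.2 + q.2 • q.1.1.1 • q.1.2) q.1.2 q.1.2) ?_
  have hv : ContDiff ℝ (⊤ : ℕ∞) fun q : ((ℝ × Rd d) × Rd d) × ℝ => q.1.2 := contDiff_fst.snd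
  have hτ : ContDiff ℝ (⊤ : ℕ∞) fun q : ((ℝ × Rd d) × Rd d) × ℝ => q.1.1.2 :=
    contDiff_fst.fst.snd
  have hε : ContDiff ℝ (⊤ : ℕ∞) fun q : ((ℝ × Rd d) × Rd d) × ℝ => q.1.1.1 :=
    contDiff_fst.fst.fst
  have hx := hτ.add (contDiff_snd.smul (hε.smul hv))
  exact (contDiff_const.sub contDiff_snd).mul (((h2.comp hx).clm_apply hv).clm_apply hv)

theorem contDiff_taylorRem_comp {d : ℕ} {A : Rd d → ℝ} (hA : ContDiff ℝ (⊤ : ℕ∞) A)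
    {E : Type*} [NormedAddCommGroup E] [NormedSpace ℝ E] {ε : E → ℝ} {τ v : E → Rd d}
    (hε : ContDiff ℝ (⊤ : ℕ∞) ε) (hτ : ContDiff ℝ (⊤ : ℕ∞) τ) (hv : ContDiff ℝ (⊤ : ℕ∞) v) :
    ContDiff ℝ (⊤ : ℕ∞) fun q => taylorRem A (ε q) (τ q) (v q) := by
  have h := contDiff_taylorRem hA
  have h1 : ContDiff ℝ (⊤ : ℕ∞) fun q => ((ε q, τ q), v q) := (hε.prodMk hτ).prodMk hv
  have h2 := h.comp h1
  exact h2

theorem sq_mul_taylorRem {d : ℕ} {a A : Rd d → ℝ} (hA : IsSmoothExt a A) (ε : ℝ) (τ v : Rd d) :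
    ε ^ 2 * taylorRem A ε τ v = A (τ + ε • v) - A τ - inner ℝ (gradient A τ) (ε • v) := by
  rw [← hA.taylor, taylorRem, ← intervalIntegral.integral_const_mul]
  congr 1
  ext t
  simp only [map_smul, smul_apply, smul_eq_mul]
  ring

theorem mul_taylorRem_eq {d : ℕ} {a A : Rd d → ℝ} (ha : IsDistFn a) (hA : IsSmoothExt a A)
    {ε : ℝ} (hε : 0 < ε) {τ ζ : Rd d} (hτ : 1 ≤ ‖τ‖) (hρ : 0 < (inner ℝ τ ζ : ℝ)) :
    (inner ℝ τ ζ : ℝ) * taylorRem A ε τ ((inner ℝ τ ζ : ℝ)⁻¹ • ζ) =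
      ε⁻¹ ^ 2 * (a (squeeze ε τ ζ) - inner ℝ (gradient A τ) (squeeze ε τ ζ)) := by
  set ρ : ℝ := inner ℝ τ ζ with hρdef
  have h1 : squeeze ε τ ζ = ρ • (τ + ε • ρ⁻¹ • ζ) := by
    rw [squeeze_apply, ← hρdef, smul_add, smul_comm ε ρ⁻¹ ζ, smul_smul ρ ρ⁻¹,
      mul_inv_cancel₀ hρ.ne', one_smul]
  have h2 : 1 ≤ ‖τ + ε • ρ⁻¹ • ζ‖ := by
    have h3 : (inner ℝ τ (τ + ε • ρ⁻¹ • ζ) : ℝ) = ‖τ‖ ^ 2 + ε := by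
      rw [inner_add_right, inner_smul_right, inner_smul_right, real_inner_self_eq_norm_sq,
        ← hρdef, inv_mul_cancel₀ hρ.ne', mul_one]
    have h4 := real_inner_le_norm τ (τ + ε • ρ⁻¹ • ζ)
    rw [h3] at h4
    by_contra! h5
    nlinarith
  have h5 := sq_mul_taylorRem hA ε τ (ρ⁻¹ • ζ)
  rw [h1, ha.homog ρ hρ, ← hA.eq _ (by linarith), inner_smul_right, ← mul_sub, inner_add_right,
    hA.inner_gradient_self ha hτ]
  have h6 : taylorRem A ε τ (ρ⁻¹ • ζ) = ε⁻¹ ^ 2 * (ε ^ 2 * taylorRem A ε τ (ρ⁻¹ • ζ)) := by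
    field_simp
  rw [h6, h5]
  ring

/-- The microlocalized symbols of `K_n`, after rescaling to unit size, form a smooth
compactly supported family. -/
theorem exists_rescaled_symbol {d : ℕ} {a A : Rd d → ℝ} {η : ℝ → ℝ} (ha : IsDistFn a)
    (hη : IsBump η) (hA : IsSmoothExt a A) :
    ∃ (h : (ℝ × Rd d) × Rd d → ℂ) (B : ℝ), ContDiff ℝ (⊤ : ℕ∞) h ∧
      (∀ p ∈ Icc (0 : ℝ) 1 ×ˢ shell d 5, ∀ ζ, h (p, ζ) ≠ 0 → ‖ζ‖ ≤ B) ∧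
      ∀ ε : ℝ, 0 < ε → ε ≤ 1 → ∀ τ ∈ shell d 5, ∀ ζ : Rd d, h ((ε, τ), ζ) =
        ((η (a (squeeze ε τ ζ)) * angWeight ε (squeeze ε τ ζ) τ : ℝ) : ℂ) *
          Complex.exp (Complex.I * (ε⁻¹ ^ 2 * (a (squeeze ε τ ζ) -
            inner ℝ (gradient A τ) (squeeze ε τ ζ)) : ℝ)) := by
  obtain ⟨c, C, hc, hC, hbd⟩ := hη.exists_bounds ha
  set c0 : ℝ := c / 40 with hc0def
  have hc0 : 0 < c0 := by positivity
  set X : (ℝ × Rd d) × Rd d → ℝ := fun q =>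
    (‖q.2‖ ^ 2 * ‖q.1.2‖ ^ 2 - (inner ℝ q.1.2 q.2 : ℝ) ^ 2) *
      smoothInv (c ^ 2) (‖squeeze q.1.1 q.1.2 q.2‖ ^ 2) with hX
  set f : (ℝ × Rd d) × Rd d → ℝ := fun q => η (a (squeeze q.1.1 q.1.2 q.2)) *
    (smoothTransition (2 - 4 * X q) * smoothTransition ((inner ℝ q.1.2 q.2 : ℝ) / c0)) with hf
  set G : (ℝ × Rd d) × Rd d → ℝ := fun q => (inner ℝ q.1.2 q.2 : ℝ) *
    taylorRem A q.1.1 q.1.2 (smoothInv c0 (inner ℝ q.1.2 q.2 : ℝ) • q.2) with hG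
  have hτ : ContDiff ℝ (⊤ : ℕ∞) fun q : (ℝ × Rd d) × Rd d => q.1.2 := contDiff_fst.snd
  have hε : ContDiff ℝ (⊤ : ℕ∞) fun q : (ℝ × Rd d) × Rd d => q.1.1 := contDiff_fst.fst
  have hζ : ContDiff ℝ (⊤ : ℕ∞) fun q : (ℝ × Rd d) × Rd d => q.2 := contDiff_snd
  have hin : ContDiff ℝ (⊤ : ℕ∞) fun q : (ℝ × Rd d) × Rd d => (inner ℝ q.1.2 q.2 : ℝ) :=
    hτ.inner ℝ hζ
  have hXs : ContDiff ℝ (⊤ : ℕ∞) X :=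
    (((hζ.norm_sq ℝ).mul (hτ.norm_sq ℝ)).sub (hin.pow 2)).mul
      ((contDiff_smoothInv (c := c ^ 2) (by positivity)).comp (contDiff_squeeze_apply.norm_sq ℝ))
  have hfs : ContDiff ℝ (⊤ : ℕ∞) f :=
    ((hη.contDiff_comp ha).comp contDiff_squeeze_apply).mul
      ((smoothTransition.contDiff.comp (contDiff_const.sub (contDiff_const.mul hXs))).mul
        (smoothTransition.contDiff.comp (hin.div_const c0)))
  have hGs : ContDiff ℝ (⊤ : ℕ∞) G := by
    have h1 : ContDiff ℝ (⊤ : ℕ∞) fun q : (ℝ × Rd d) × Rd d =>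
        smoothInv c0 (inner ℝ q.1.2 q.2 : ℝ) • q.2 := ((contDiff_smoothInv hc0).comp hin).smul hζ
    exact hin.mul (contDiff_taylorRem_comp hA.smooth hε hτ h1)
  have hkey : ∀ ε : ℝ, ∀ τ ζ : Rd d, η (a (squeeze ε τ ζ)) ≠ 0 →
      smoothTransition (2 - 4 * X ((ε, τ), ζ)) ≠ 0 →
      ‖ζ‖ ^ 2 * ‖τ‖ ^ 2 - (inner ℝ τ ζ : ℝ) ^ 2 ≤ ‖squeeze ε τ ζ‖ ^ 2 / 2 := by
    intro ε τ ζ h1 h2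
    obtain ⟨h3, -⟩ := hbd _ h1
    have h4 : X ((ε, τ), ζ) ≤ 1 / 2 := by
      by_contra! h5
      exact h2 (smoothTransition.zero_of_nonpos (by linarith))
    have h6 : 0 < ‖squeeze ε τ ζ‖ ^ 2 := by nlinarith
    simp only [hX] at h4
    rw [smoothInv_eq (by positivity) (by gcongr), ← div_eq_mul_inv, div_le_iff₀ h6] at h4
    linarith
  refine ⟨fun q => (f q : ℂ) * Complex.exp (Complex.I * (G q : ℝ)), 2 * C, ?_, ?_, ?_⟩
  · exact (Complex.ofRealCLM.contDiff.comp hfs).mul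
      ((contDiff_const.mul (Complex.ofRealCLM.contDiff.comp hGs)).cexp)
  · rintro ⟨ε, τ⟩ ⟨⟨hε0, -⟩, hτ1⟩ ζ hne
    have h0 : f ((ε, τ), ζ) ≠ 0 := by
      intro h; exact hne (by simp [h])
    simp only [hf] at h0
    have h1 := left_ne_zero_of_mul h0
    have h2 := left_ne_zero_of_mul (right_ne_zero_of_mul h0)
    have h3 := hkey ε τ ζ h1 h2
    have h4 := (hbd _ h1).2
    have h5 := abs_inner_le_norm_squeeze hε0 (ne_zero_of_mem_shell hτ1) ζ
    have hτ2 : 1 ≤ ‖τ‖ := hτ1.1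
    have h6 : |(inner ℝ τ ζ : ℝ)| ≤ ‖squeeze ε τ ζ‖ :=
      (le_mul_of_one_le_left (abs_nonneg _) hτ2).trans h5
    have h7 : (inner ℝ τ ζ : ℝ) ^ 2 ≤ ‖squeeze ε τ ζ‖ ^ 2 := by
      rw [← sq_abs]; gcongr
    have h8 : ‖ζ‖ ^ 2 * 1 ≤ ‖ζ‖ ^ 2 * ‖τ‖ ^ 2 := by gcongr; nlinarith
    have h9 : ‖squeeze ε τ ζ‖ ^ 2 ≤ C ^ 2 := by gcongr
    refine abs_le_of_sq_le_sq' ?_ (by positivity) |>.2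
    nlinarith
  · intro ε hε0 hε1 τ hτ1 ζ
    have hτ2 : 1 ≤ ‖τ‖ := hτ1.1
    have hτ5 : ‖τ‖ ≤ 5 := hτ1.2
    by_cases h1 : η (a (squeeze ε τ ζ)) = 0
    · simp [hf, h1]
    obtain ⟨h3, -⟩ := hbd _ h1
    have h6 : 0 < ‖squeeze ε τ ζ‖ ^ 2 := by nlinarith
    have h7 := norm_sq_mul_norm_sq_sub_squeeze ε τ ζ
    have hXeq : X ((ε, τ), ζ) = ε⁻¹ ^ 2 * (‖τ‖ ^ 2 -
        (inner ℝ (squeeze ε τ ζ) τ : ℝ) ^ 2 / ‖squeeze ε τ ζ‖ ^ 2) := by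
      simp only [hX]
      rw [smoothInv_eq (by positivity) (by gcongr)]
      have : ‖τ‖ ^ 2 - (inner ℝ (squeeze ε τ ζ) τ : ℝ) ^ 2 / ‖squeeze ε τ ζ‖ ^ 2 =
        ε ^ 2 * (‖ζ‖ ^ 2 * ‖τ‖ ^ 2 - (inner ℝ τ ζ : ℝ) ^ 2) / ‖squeeze ε τ ζ‖ ^ 2 := by
        rw [← h7, eq_div_iff h6.ne', sub_mul, div_mul_cancel₀ _ h6.ne']; ring
      rw [this]
      field_simp
    have hsgn : (0 < (inner ℝ (squeeze ε τ ζ) τ : ℝ)) ↔ 0 < (inner ℝ τ ζ : ℝ) := by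
      rw [real_inner_comm, inner_self_squeeze]
      exact mul_pos_iff_of_pos_right (by positivity)
    simp only [angWeight, ← hXeq, hsgn]
    by_cases h2 : smoothTransition (2 - 4 * X ((ε, τ), ζ)) = 0
    · simp [hf, h2]
    by_cases hρ : 0 < (inner ℝ τ ζ : ℝ)
    swap
    · simp only [hf, if_neg hρ]
      rw [smoothTransition.zero_of_nonpos (div_nonpos_of_nonpos_of_nonneg (not_lt.1 hρ) hc0.le)]
      simp
    have h8 := hkey ε τ ζ h1 h2
    have hρ0 : c0 ≤ (inner ℝ τ ζ : ℝ) := by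
      rw [real_inner_comm, inner_self_squeeze] at h7
      have h9 : c ^ 2 ≤ ‖squeeze ε τ ζ‖ ^ 2 := by gcongr
      have h10 : ε ^ 2 * (‖ζ‖ ^ 2 * ‖τ‖ ^ 2 - (inner ℝ τ ζ : ℝ) ^ 2) ≤
          1 * (‖squeeze ε τ ζ‖ ^ 2 / 2) := by
        have e2 : ε ^ 2 ≤ 1 := by nlinarith
        calc ε ^ 2 * (‖ζ‖ ^ 2 * ‖τ‖ ^ 2 - (inner ℝ τ ζ : ℝ) ^ 2)
            ≤ ε ^ 2 * (‖squeeze ε τ ζ‖ ^ 2 / 2) := by gcongr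
          _ ≤ _ := by gcongr
      have h11 : ‖squeeze ε τ ζ‖ ^ 2 * 1 ≤ ‖squeeze ε τ ζ‖ ^ 2 * ‖τ‖ ^ 2 := by
        gcongr; nlinarith
      have h12 : c ^ 2 / 2 ≤ ((inner ℝ τ ζ : ℝ) * (‖τ‖ ^ 2 + ε)) ^ 2 := by linarith
      by_contra! h13
      have h14 : (inner ℝ τ ζ : ℝ) * (‖τ‖ ^ 2 + ε) ≤ c0 * 26 := by
        gcongr
        nlinarith
      have h15 : ((inner ℝ τ ζ : ℝ) * (‖τ‖ ^ 2 + ε)) ^ 2 ≤ (c0 * 26) ^ 2 := by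
        gcongr
      rw [hc0def] at h15
      nlinarith [sq_pos_of_pos hc]
    have hGeq : G ((ε, τ), ζ) = ε⁻¹ ^ 2 * (a (squeeze ε τ ζ) -
        inner ℝ (gradient A τ) (squeeze ε τ ζ)) := by
      simp only [hG]
      rw [smoothInv_eq hc0 hρ0]
      exact mul_taylorRem_eq ha hA hε0 hτ2 hρ
    rw [← hGeq]
    simp only [hf, if_pos hρ]
    rw [smoothTransition.one_of_one_le ((one_le_div hc0).2 hρ0)]

theorem IsDistFn.continuous {d : ℕ} {a : Rd d → ℝ} (ha : IsDistFn a) : Continuous a := by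
  refine continuous_iff_continuousAt.2 fun ξ => ?_
  by_cases hξ : ξ = 0
  · obtain ⟨c, C, hc, -, h⟩ := ha.exists_bounds
    rw [ContinuousAt, hξ, ha.map_zero]
    refine squeeze_zero (fun ξ => (mul_nonneg hc.le (norm_nonneg ξ)).trans (h ξ).1)
      (fun ξ => (h ξ).2) ?_
    have : Continuous fun ξ : Rd d => C * ‖ξ‖ := by fun_prop
    simpa using this.tendsto 0
  · exact (ha.contDiffAt hξ).continuousAt

theorem abs_det_squeeze {d : ℕ} (hd : 1 ≤ d) {ε : ℝ} (hε : 0 < ε) (τ : Rd d) :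
    |(squeeze ε τ).det| = ε ^ (d - 1) * (ε + ‖τ‖ ^ 2) := by
  rw [ContinuousLinearMap.det, det_squeeze hd hε, abs_of_nonneg (by positivity)]

theorem squeeze_injective {d : ℕ} {ε : ℝ} (hε : 0 < ε) (τ : Rd d) :
    Function.Injective (squeeze ε τ) := by
  refine (injective_iff_map_eq_zero _).2 fun y hy => ?_
  have := le_norm_squeeze (ε := ε) τ y
  rw [hy, norm_zero] at this
  exact norm_le_zero_iff.1 (nonpos_of_mul_nonpos_right this hε)

theorem squeeze_surjective {d : ℕ} {ε : ℝ} (hε : 0 < ε) (τ : Rd d) :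
    Function.Surjective (squeeze ε τ) :=
  LinearMap.surjective_of_injective (f := (squeeze ε τ : Rd d →ₗ[ℝ] Rd d))
    (squeeze_injective hε τ)

theorem integral_eq_det_squeeze_smul {d : ℕ} (hd : 1 ≤ d) {ε : ℝ} (hε : 0 < ε) (τ : Rd d)
    (f : Rd d → ℂ) :
    ∫ ξ, f ξ = (ε ^ (d - 1) * (ε + ‖τ‖ ^ 2)) • ∫ ζ, f (squeeze ε τ ζ) := by
  have h := integral_image_eq_integral_abs_det_fderiv_smul (volume : Measure (Rd d))
    MeasurableSet.univ (fun x _ => (squeeze ε τ).hasFDerivAt.hasFDerivWithinAt)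
    (squeeze_injective hε τ).injOn f
  rw [image_univ, (squeeze_surjective hε τ).range_eq, setIntegral_univ, setIntegral_univ,
    abs_det_squeeze hd hε] at h
  rw [h, integral_smul]

theorem lintegral_eq_det_squeeze_mul {d : ℕ} (hd : 1 ≤ d) {ε : ℝ} (hε : 0 < ε) (τ : Rd d)
    (f : Rd d → ℝ≥0∞) :
    ∫⁻ ξ, f ξ = ENNReal.ofReal (ε ^ (d - 1) * (ε + ‖τ‖ ^ 2)) * ∫⁻ ζ, f (squeeze ε τ ζ) := by
  have h := lintegral_image_eq_lintegral_abs_det_fderiv_mul (volume : Measure (Rd d))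
    MeasurableSet.univ (fun x _ => (squeeze ε τ).hasFDerivAt.hasFDerivWithinAt)
    (squeeze_injective hε τ).injOn f
  rw [image_univ, (squeeze_surjective hε τ).range_eq, setLIntegral_univ, setLIntegral_univ,
    abs_det_squeeze hd hε] at h
  rw [h, lintegral_const_mul' _ _ ENNReal.ofReal_ne_top]

/-- The vector `x + (t / 2π) ∇A(τ)`, i.e. the gradient at `τ` of the phase of `K_t(x)`,
divided by `2π`. -/
def phaseGrad {d : ℕ} (A : Rd d → ℝ) (t : ℝ) (τ x : Rd d) : Rd d :=
  x + (t / (2 * π)) • gradient A τ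

theorem IsSmoothExt.continuous_phaseGrad {d : ℕ} {a A : Rd d → ℝ} (hA : IsSmoothExt a A) (t : ℝ) :
    Continuous fun q : Rd d × Rd d => phaseGrad A t q.2 q.1 := by
  have := hA.continuous_gradient
  unfold phaseGrad
  fun_prop

/-- The part of the kernel `K_n` with frequencies near the direction `τ`. -/
def microKer {d : ℕ} (a : Rd d → ℝ) (η : ℝ → ℝ) (ε n : ℝ) (τ x : Rd d) : ℂ :=
  ∫ ξ : Rd d, (angWeight ε ξ τ : ℂ) * ((η (a ξ) : ℂ) * Complex.exp (Complex.I * n * a ξ) *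
    Complex.exp (2 * π * Complex.I * (inner ℝ x ξ : ℝ)))

theorem exists_microKer_bound {d : ℕ} (hd : 1 ≤ d) {a A : Rd d → ℝ} {η : ℝ → ℝ} (ha : IsDistFn a)
    (hη : IsBump η) (hA : IsSmoothExt a A) (M : ℕ) :
    ∃ C : ℝ, 0 < C ∧ ∀ ε : ℝ, 0 < ε → ε ≤ 1 → ∀ τ ∈ shell d 5, ∀ x : Rd d,
      ‖microKer a η ε (ε⁻¹ ^ 2) τ x‖ ≤ C * ε ^ (d - 1) *
        ((1 + ‖squeeze ε τ (phaseGrad A (ε⁻¹ ^ 2) τ x)‖) ^ M)⁻¹ := by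
  obtain ⟨h, B, hh, hB, heq⟩ := exists_rescaled_symbol ha hη hA
  obtain ⟨C, hC, hdec⟩ := exists_fourier_decay (isCompact_Icc.prod (isCompact_shell d 5)) hh B hB M
  refine ⟨26 * C, by positivity, fun ε hε hε1 τ hτ x => ?_⟩
  have hp : (ε, τ) ∈ Icc (0 : ℝ) 1 ×ˢ shell d 5 := ⟨⟨hε.le, hε1⟩, hτ⟩
  set w := squeeze ε τ (phaseGrad A (ε⁻¹ ^ 2) τ x) with hw
  have h1 : microKer a η ε (ε⁻¹ ^ 2) τ x =
      (ε ^ (d - 1) * (ε + ‖τ‖ ^ 2)) • 𝓕 (fun ζ => h ((ε, τ), ζ)) (-w) := by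
    rw [microKer, integral_eq_det_squeeze_smul hd hε τ, Real.fourier_eq']
    congr 2
    ext ζ
    rw [heq ε hε hε1 τ hτ ζ]
    have e1 : (inner ℝ ζ (-w) : ℝ) = -((inner ℝ x (squeeze ε τ ζ) : ℝ) +
        ε⁻¹ ^ 2 / (2 * π) * inner ℝ (gradient A τ) (squeeze ε τ ζ)) := by
      rw [inner_neg_right, hw, inner_squeeze, real_inner_comm, phaseGrad, inner_add_left,
        inner_smul_left, RCLike.conj_to_real]
    rw [e1, smul_eq_mul]
    have hπ : (π : ℂ) ≠ 0 := by exact_mod_cast Real.pi_ne_zero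
    push_cast
    set Y : ℂ := ((inner ℝ (gradient A τ) (squeeze ε τ ζ) : ℝ) : ℂ)
    set Z : ℂ := ((inner ℝ x (squeeze ε τ ζ) : ℝ) : ℂ)
    have e2 : ∀ p q r s t : ℂ, p * (q * Complex.exp r * Complex.exp s) =
        p * q * Complex.exp (r + s) := fun p q r s t => by rw [Complex.exp_add]; ring
    have e3 : ∀ p q r s : ℂ, Complex.exp p * (q * r * Complex.exp s) =
        r * q * Complex.exp (p + s) := fun p q r s => by rw [Complex.exp_add]; ring
    rw [e2 _ _ _ _ 0, e3]
    congr 2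
    field_simp
    ring
  have h2 := hdec _ hp (-w)
  rw [norm_neg] at h2
  have h3 : 0 < (1 + ‖w‖) ^ M := by positivity
  have h4 : ‖𝓕 (fun ζ => h ((ε, τ), ζ)) (-w)‖ ≤ C * ((1 + ‖w‖) ^ M)⁻¹ := by
    rw [← div_eq_mul_inv, le_div_iff₀ h3, mul_comm]
    exact h2
  have hτ1 : 1 ≤ ‖τ‖ := hτ.1
  have hτ2 : ‖τ‖ ≤ 5 := hτ.2
  rw [h1, norm_smul, Real.norm_eq_abs, abs_of_nonneg (by positivity)]
  calc ε ^ (d - 1) * (ε + ‖τ‖ ^ 2) * ‖𝓕 (fun ζ => h ((ε, τ), ζ)) (-w)‖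
      ≤ ε ^ (d - 1) * 26 * (C * ((1 + ‖w‖) ^ M)⁻¹) := by
        gcongr
        nlinarith
    _ = _ := by ring

theorem integral_microKer {d : ℕ} {a : Rd d → ℝ} {η : ℝ → ℝ} (ha : IsDistFn a)
    (hη : IsBump η) {ε N : ℝ} (n : ℝ)
    (hN : ∀ ξ : Rd d, ξ ≠ 0 → ∫ τ in shell d 5, angWeight ε ξ τ = N) (x : Rd d) :
    ∫ τ in shell d 5, microKer a η ε n τ x = N * Kker a η n x := by
  set μ : Measure (Rd d) := volume.restrict (shell d 5) with hμ
  have : IsFiniteMeasure μ := ⟨by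
    rw [hμ, Measure.restrict_apply_univ]; exact (isCompact_shell d 5).measure_lt_top⟩
  set F : Rd d → ℂ := fun ξ => (η (a ξ) : ℂ) * Complex.exp (Complex.I * n * a ξ) *
    Complex.exp (2 * π * Complex.I * (inner ℝ x ξ : ℝ)) with hF
  have hFc : Continuous F := by
    have h1 := ha.continuous
    have h2 := hη.smooth.continuous
    have h3 : Continuous fun ξ : Rd d => (inner ℝ x ξ : ℝ) := by fun_prop
    exact ((Complex.continuous_ofReal.comp (h2.comp h1)).mul
      (continuous_const.mul (Complex.continuous_ofReal.comp h1)).cexp).mul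
      (continuous_const.mul (Complex.continuous_ofReal.comp h3)).cexp
  have hFi : Integrable F := by
    obtain ⟨c, C, -, -, h⟩ := hη.exists_bounds ha
    refine hFc.integrable_of_hasCompactSupport (HasCompactSupport.intro
      (isCompact_closedBall (0 : Rd d) C) fun ξ hξ => ?_)
    have : η (a ξ) = 0 := by
      by_contra h0
      exact hξ (by simpa using (h ξ h0).2)
    simp [hF, this]
  have hint : Integrable (Function.uncurry fun (τ ξ : Rd d) => (angWeight ε ξ τ : ℂ) * F ξ)
      (μ.prod volume) := by
    have h1 : Integrable (fun q : Rd d × Rd d => (1 : ℝ) * ‖F q.2‖) (μ.prod volume) :=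
      (integrable_const (1 : ℝ)).mul_prod hFi.norm
    refine h1.mono' ?_ (Filter.Eventually.of_forall fun q => ?_)
    · exact ((Complex.measurable_ofReal.comp ((measurable_angWeight ε).comp measurable_swap)).mul
        (hFc.measurable.comp measurable_snd)).aestronglyMeasurable
    · rw [Function.uncurry, norm_mul, Complex.norm_real, Real.norm_eq_abs,
        abs_of_nonneg (angWeight_nonneg _ _ _)]
      gcongr
      exact angWeight_le_one _ _ _
  change ∫ τ, (∫ ξ, (angWeight ε ξ τ : ℂ) * F ξ) ∂μ = N * ∫ ξ, F ξ
  rw [integral_integral_swap hint, ← integral_const_mul]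
  refine integral_congr_ae (Filter.Eventually.of_forall fun ξ => ?_)
  change ∫ τ, (angWeight ε ξ τ : ℂ) * F ξ ∂μ = N * F ξ
  rw [integral_mul_const, integral_complex_ofReal]
  by_cases hξ : ξ = 0
  · have : F ξ = 0 := by
      have h0 : η (a ξ) = 0 := hη.supp _ (by rw [hξ, ha.map_zero]; norm_num)
      simp [hF, h0]
    rw [this, mul_zero, mul_zero]
  · rw [hN ξ hξ]

/-- An integrable majorant of the rescaled kernel `K_n`. -/
def kerMajorant {d : ℕ} (A : Rd d → ℝ) (M : ℕ) (n : ℝ) (x : Rd d) : ℝ≥0∞ :=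
  ∫⁻ τ in shell d 5,
    ENNReal.ofReal (((1 + ‖squeeze (√n)⁻¹ τ (phaseGrad A n τ x)‖) ^ M)⁻¹)

theorem exists_Kker_bound {d : ℕ} (hd : 1 ≤ d) {a A : Rd d → ℝ} {η : ℝ → ℝ} (ha : IsDistFn a)
    (hη : IsBump η) (hA : IsSmoothExt a A) (M : ℕ) :
    ∃ C : ℝ, 0 < C ∧ ∀ n : ℝ, 1 ≤ n → ∀ x : Rd d,
      ‖Kker a η n x‖ₑ ≤ ENNReal.ofReal C * kerMajorant A M n x := by
  obtain ⟨c, hc, hN⟩ := exists_integral_angWeight hd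
  obtain ⟨C, hC, hK⟩ := exists_microKer_bound hd ha hη hA M
  refine ⟨C / c, by positivity, fun n hn x => ?_⟩
  have hn0 : 0 < √n := Real.sqrt_pos.2 (by linarith)
  set ε : ℝ := (√n)⁻¹ with hε
  have hε0 : 0 < ε := inv_pos.2 hn0
  have hε1 : ε ≤ 1 := inv_le_one_of_one_le₀ (Real.one_le_sqrt.2 hn)
  have hεn : ε⁻¹ ^ 2 = n := by rw [hε, inv_inv, Real.sq_sqrt (by linarith)]
  obtain ⟨N, hcN, hN⟩ := hN ε hε0 hε1
  have h1 := integral_microKer ha hη n hN x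
  have hNpos : 0 < N := lt_of_lt_of_le (by positivity) hcN
  have hεpos : 0 < c * ε ^ (d - 1) := by positivity
  have h2 : ENNReal.ofReal N * ‖Kker a η n x‖ₑ ≤
      ENNReal.ofReal (C * ε ^ (d - 1)) * kerMajorant A M n x := by
    have e1 : ENNReal.ofReal N * ‖Kker a η n x‖ₑ = ‖(N : ℂ) * Kker a η n x‖ₑ := by
      rw [enorm_mul, ← ofReal_norm (N : ℂ), Complex.norm_real, Real.norm_eq_abs,
        abs_of_pos hNpos]
    rw [e1, ← h1, kerMajorant, ← lintegral_const_mul' _ _ ENNReal.ofReal_ne_top]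
    refine (enorm_integral_le_lintegral_enorm _).trans
      (setLIntegral_mono' (measurableSet_shell d 5) fun τ hτ => ?_)
    have h3 := hK ε hε0 hε1 τ hτ x
    rw [hεn] at h3
    rw [← ENNReal.ofReal_mul (by positivity), ← ofReal_norm]
    exact ENNReal.ofReal_le_ofReal h3
  have h3 : ENNReal.ofReal (c * ε ^ (d - 1)) * ‖Kker a η n x‖ₑ ≤
      ENNReal.ofReal (c * ε ^ (d - 1)) * (ENNReal.ofReal (C / c) * kerMajorant A M n x) := by
    refine (mul_le_mul' (ENNReal.ofReal_le_ofReal hcN) le_rfl).trans (h2.trans (le_of_eq ?_))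
    rw [← mul_assoc, ← ENNReal.ofReal_mul hεpos.le]
    congr 2
    field_simp
  exact (ENNReal.mul_le_mul_iff_right (ENNReal.ofReal_pos.2 hεpos).ne' ENNReal.ofReal_ne_top).1 h3

theorem IsSmoothExt.continuous_kerMajorant_integrand {d : ℕ} {a A : Rd d → ℝ}
    (hA : IsSmoothExt a A) (M : ℕ) (n : ℝ) :
    Continuous fun q : Rd d × Rd d =>
      ENNReal.ofReal (((1 + ‖squeeze (√n)⁻¹ q.2 (phaseGrad A n q.2 q.1)‖) ^ M)⁻¹) := by
  have h0 := hA.continuous_phaseGrad n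
  have h1 : Continuous fun q : Rd d × Rd d => squeeze (√n)⁻¹ q.2 (phaseGrad A n q.2 q.1) := by
    simp only [squeeze_apply]
    fun_prop
  refine ENNReal.continuous_ofReal.comp (Continuous.inv₀ (by fun_prop) fun q => ?_)
  positivity

theorem IsSmoothExt.measurable_kerMajorant {d : ℕ} {a A : Rd d → ℝ} (hA : IsSmoothExt a A)
    (M : ℕ) (n : ℝ) : Measurable (kerMajorant A M n) :=
  (hA.continuous_kerMajorant_integrand M n).measurable.lintegral_prod_right'

theorem exists_lintegral_kerMajorant_le {d : ℕ} (hd : 1 ≤ d) {a A : Rd d → ℝ}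
    (hA : IsSmoothExt a A) : ∃ C : ℝ, 0 < C ∧ ∀ n : ℝ, 1 ≤ n →
      ∫⁻ x, kerMajorant A (d + 1) n x ≤ ENNReal.ofReal (C * √n ^ (d - 1)) := by
  have hJ : ∫⁻ ζ : Rd d, ENNReal.ofReal (((1 + ‖ζ‖) ^ (d + 1))⁻¹) < ⊤ := by
    have h := finite_integral_one_add_norm (E := Rd d) (μ := volume) (r := (d : ℝ) + 1) (by simp)
    refine lt_of_le_of_lt (le_of_eq ?_) h
    congr 1
    ext ζ
    rw [Real.rpow_neg (by positivity)]
    congr 2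
    rw [← Real.rpow_natCast]; norm_cast
  set J := ∫⁻ ζ : Rd d, ENNReal.ofReal (((1 + ‖ζ‖) ^ (d + 1))⁻¹)
  have hS : volume (shell d 5) ≠ ⊤ := (isCompact_shell d 5).measure_lt_top.ne
  refine ⟨(J * volume (shell d 5)).toReal + 1, by positivity, fun n hn => ?_⟩
  have hn0 : 0 < √n := Real.sqrt_pos.2 (by linarith)
  set ε : ℝ := (√n)⁻¹ with hε
  have hε0 : 0 < ε := inv_pos.2 hn0
  have h1 : ∫⁻ x, kerMajorant A (d + 1) n x = ∫⁻ τ in shell d 5, ∫⁻ x : Rd d,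
      ENNReal.ofReal (((1 + ‖squeeze ε τ (phaseGrad A n τ x)‖) ^ (d + 1))⁻¹) :=
    lintegral_lintegral_swap (hA.continuous_kerMajorant_integrand (d + 1) n).measurable.aemeasurable
  have h2 : ∀ τ ∈ shell d 5, ∫⁻ x : Rd d,
      ENNReal.ofReal (((1 + ‖squeeze ε τ (phaseGrad A n τ x)‖) ^ (d + 1))⁻¹) ≤
        ENNReal.ofReal (√n ^ (d - 1)) * J := by
    intro τ hτ
    have hτ1 : 1 ≤ ‖τ‖ := hτ.1
    have e1 := lintegral_add_right_eq_self (μ := (volume : Measure (Rd d)))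
      (fun x : Rd d => ENNReal.ofReal (((1 + ‖squeeze ε τ x‖) ^ (d + 1))⁻¹))
      ((n / (2 * π)) • gradient A τ)
    change ∫⁻ x : Rd d,
      ENNReal.ofReal (((1 + ‖squeeze ε τ (phaseGrad A n τ x)‖) ^ (d + 1))⁻¹) = _ at e1
    rw [e1]
    have e2 := lintegral_eq_det_squeeze_mul hd hε0 τ
      (fun ζ : Rd d => ENNReal.ofReal (((1 + ‖ζ‖) ^ (d + 1))⁻¹))
    change J = _ at e2
    rw [e2, ← mul_assoc, ← ENNReal.ofReal_mul (by positivity)]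
    refine le_mul_of_one_le_left zero_le (ENNReal.one_le_ofReal.2 ?_)
    rw [← mul_assoc, ← mul_pow, hε, mul_inv_cancel₀ hn0.ne', one_pow, one_mul, ← hε]
    nlinarith
  rw [h1]
  calc _ ≤ ∫⁻ τ in shell d 5, ENNReal.ofReal (√n ^ (d - 1)) * J :=
        setLIntegral_mono' (measurableSet_shell d 5) h2
    _ = ENNReal.ofReal (√n ^ (d - 1)) * (J * volume (shell d 5)) := by
        rw [setLIntegral_const, mul_assoc]
    _ ≤ ENNReal.ofReal (√n ^ (d - 1)) * ENNReal.ofReal ((J * volume (shell d 5)).toReal + 1) := by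
        gcongr
        rw [ENNReal.ofReal_add ENNReal.toReal_nonneg zero_le_one,
          ENNReal.ofReal_toReal (ENNReal.mul_ne_top hJ.ne hS)]
        exact le_self_add
    _ = _ := by rw [← ENNReal.ofReal_mul (by positivity), mul_comm]

/-- Away from the plates of thickness `l`, the kernel `K_n` is small of order `l ^ (-d)`. -/
theorem exists_Kker_bound_of_far {d : ℕ} (hd : 1 ≤ d) {a A : Rd d → ℝ} {η : ℝ → ℝ}
    (ha : IsDistFn a) (hη : IsBump η) (hA : IsSmoothExt a A) :
    ∃ C : ℝ, 0 < C ∧ ∀ r l n : ℝ, 1 ≤ l → l ≤ r → r ≤ n → n ≤ 2 * r → ∀ x : Rd d,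
      (∀ τ ∈ shell d 5, l ≤ ‖squeeze √(l / r) τ (phaseGrad A n τ x)‖) →
      ‖Kker a η n x‖ₑ ≤ ENNReal.ofReal (C * (l ^ d)⁻¹) * kerMajorant A (d + 1) n x := by
  obtain ⟨C, hC, hK⟩ := exists_Kker_bound hd ha hη hA (2 * d + (d + 1))
  refine ⟨C * 9 ^ d, by positivity, fun r l n hl hlr hrn hnr x hfar => ?_⟩
  refine (hK n (by linarith) x).trans ?_
  have hl0 : 0 < l := by linarith
  have hr0 : 0 < r := by linarith
  have hn0 : 0 < √n := Real.sqrt_pos.2 (by linarith)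
  rw [mul_assoc C, ENNReal.ofReal_mul hC.le, mul_assoc]
  gcongr
  rw [kerMajorant, kerMajorant, ← lintegral_const_mul' _ _ ENNReal.ofReal_ne_top]
  refine setLIntegral_mono' (measurableSet_shell d 5) fun τ hτ => ?_
  rw [← ENNReal.ofReal_mul (by positivity)]
  refine ENNReal.ofReal_le_ofReal ?_
  set v := phaseGrad A n τ x
  set Y := ‖squeeze (√n)⁻¹ τ v‖ with hY
  have h1 := hfar τ hτ
  have h2 := norm_squeeze_le (Real.sqrt_nonneg (l / r)) τ v
  have h3 := abs_inner_le_norm_squeeze (inv_pos.2 hn0).le (ne_zero_of_mem_shell hτ) v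
  have h4 := le_norm_squeeze (ε := (√n)⁻¹) τ v
  rw [← hY] at h3 h4
  have hY0 : 0 ≤ Y := norm_nonneg _
  have h5 : ‖v‖ ≤ √n * Y := by
    rw [inv_mul_le_iff₀ hn0] at h4; exact h4
  have h6 : √(l / r) * √n ≤ 2 * √l := by
    rw [← Real.sqrt_mul (by positivity)]
    have : l / r * n ≤ 2 ^ 2 * l := by
      rw [div_mul_eq_mul_div, div_le_iff₀ (by linarith)]
      nlinarith
    refine (Real.sqrt_le_sqrt this).trans (le_of_eq ?_)
    rw [Real.sqrt_mul (by norm_num), Real.sqrt_sq (by norm_num)]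
  have h7 : l ≤ Y + 2 * √l * Y := by
    have : √(l / r) * ‖v‖ ≤ 2 * √l * Y := by
      calc √(l / r) * ‖v‖ ≤ √(l / r) * (√n * Y) := by gcongr
        _ = √(l / r) * √n * Y := by ring
        _ ≤ _ := by gcongr
    linarith
  have hsl : 1 ≤ √l := Real.one_le_sqrt.2 hl
  have hll : √l * √l = l := Real.mul_self_sqrt (by linarith)
  have h8 : √l ≤ 3 * Y := by
    have : √l * √l ≤ √l * (3 * Y) := by nlinarith
    exact le_of_mul_le_mul_left this (by linarith)
  have h9 : l ≤ 9 * (1 + Y) ^ 2 := by nlinarith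
  have h10 : l ^ d ≤ 9 ^ d * (1 + Y) ^ (2 * d) := by
    rw [pow_mul, ← mul_pow]; gcongr
  have h11 : 0 < (1 + Y) ^ (2 * d) := by positivity
  have h12 : 0 < l ^ d := by positivity
  rw [pow_add, mul_inv]
  gcongr
  rw [← div_eq_mul_inv, le_div_iff₀ h12, inv_mul_le_iff₀ h11, mul_comm]
  exact h10

theorem exists_norm_sub_le_of_contDiff {E F : Type*} [NormedAddCommGroup E] [NormedSpace ℝ E]
    [ProperSpace E] [NormedAddCommGroup F] [NormedSpace ℝ F] {f : E → F} (hf : ContDiff ℝ 1 f)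
    (R : ℝ) : ∃ L : ℝ, 0 ≤ L ∧ ∀ x y : E, ‖x‖ ≤ R → ‖y‖ ≤ R → ‖f y - f x‖ ≤ L * ‖y - x‖ := by
  obtain ⟨L, hL⟩ := (isCompact_closedBall (0 : E) R).exists_bound_of_continuousOn
    (hf.continuous_fderiv one_ne_zero).continuousOn
  refine ⟨max L 0, le_max_right _ _, fun x y hx hy => ?_⟩
  exact (convex_closedBall (0 : E) R).norm_image_sub_le_of_norm_fderiv_le
    (fun z _ => hf.differentiable one_ne_zero z)
    (fun z hz => (hL z hz).trans (le_max_left _ _)) (by simpa using hx) (by simpa using hy)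

theorem IsSmoothExt.exists_norm_gradient_sub_le {d : ℕ} {a A : Rd d → ℝ} (hA : IsSmoothExt a A)
    (R : ℝ) : ∃ L : ℝ, 0 ≤ L ∧ ∀ x y : Rd d, ‖x‖ ≤ R → ‖y‖ ≤ R →
      ‖gradient A y - gradient A x‖ ≤ L * ‖y - x‖ := by
  obtain ⟨L, hL0, hL⟩ := exists_norm_sub_le_of_contDiff
    (hA.contDiff_fderiv.of_le (m := (1 : WithTop ℕ∞)) (by norm_cast)) R
  refine ⟨L, hL0, fun x y hx hy => ?_⟩
  have h2 : gradient A y - gradient A x =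
      (InnerProductSpace.toDual ℝ (Rd d)).symm (fderiv ℝ A y - fderiv ℝ A x) := by
    rw [map_sub]; rfl
  rw [h2, LinearIsometryEquiv.norm_map]
  exact hL x y hx hy

theorem exists_abs_taylorRem_le {d : ℕ} {A : Rd d → ℝ} (hA : ContDiff ℝ (⊤ : ℕ∞) A) (R : ℝ) :
    ∃ C : ℝ, 0 ≤ C ∧ ∀ δ : ℝ, 0 ≤ δ → δ ≤ 1 → ∀ τ v : Rd d, ‖τ‖ ≤ R → ‖v‖ ≤ R →
      |taylorRem A δ τ v| ≤ C := by
  have hK : IsCompact ((Icc (0 : ℝ) 1 ×ˢ Metric.closedBall (0 : Rd d) R) ×ˢ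
      Metric.closedBall (0 : Rd d) R) :=
    (isCompact_Icc.prod (isCompact_closedBall _ _)).prod (isCompact_closedBall _ _)
  obtain ⟨C, hC⟩ := hK.exists_bound_of_continuousOn (contDiff_taylorRem hA).continuous.continuousOn
  refine ⟨max C 0, le_max_right _ _, fun δ h0 h1 τ v hτ hv => ?_⟩
  exact (hC ((δ, τ), v) ⟨⟨⟨h0, h1⟩, by simpa using hτ⟩, by simpa using hv⟩).trans (le_max_left _ _)

theorem sq_sqrt_div_mul {r l : ℝ} (hr : 0 < r) (hl : 0 ≤ l) : √(l / r) ^ 2 * r = l := by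
  rw [Real.sq_sqrt (by positivity)]; field_simp

/-- If `x` lies in the plate associated with `τ`, it lies in the slightly larger plates
associated with all directions near `τ`. -/
theorem exists_plate_transfer {d : ℕ} {a A : Rd d → ℝ} (ha : IsDistFn a) (hA : IsSmoothExt a A)
    {C₁ : ℝ} (hC₁ : 0 ≤ C₁) :
    ∃ C : ℝ, 0 < C ∧ ∀ r l t : ℝ, 1 ≤ l → l ≤ r → 0 ≤ t → t ≤ 2 * r → ∀ τ ∈ shell d 5,
      ∀ ζ ∈ Metric.ball ((2 : ℝ) • τ) (1 / 4), ∀ x : Rd d,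
      ‖squeeze √(l / r) τ (phaseGrad A t τ x)‖ ≤ C₁ * l →
      squeeze √(l / r) τ ζ ∈ shell d 300 ∧
        ‖squeeze √(l / r) (squeeze √(l / r) τ ζ)
          (phaseGrad A t (squeeze √(l / r) τ ζ) x)‖ ≤ C * l := by
  obtain ⟨L, hL0, hL⟩ := hA.exists_norm_gradient_sub_le 16
  obtain ⟨R, hR0, hR⟩ := exists_abs_taylorRem_le hA.smooth 11
  refine ⟨300 * (60 * (12 * C₁ + 2 * R)) + (C₁ + 22 * L) + 1, by positivity,
    fun r l t hl hlr ht0 htr τ hτ ζ hζ x hx => ?_⟩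
  have hl0 : 0 < l := by linarith
  have hr0 : 0 < r := by linarith
  set δ := √(l / r) with hδ
  have hδ0 : 0 < δ := Real.sqrt_pos.2 (by positivity)
  have hδ1 : δ ≤ 1 := Real.sqrt_le_one.2 ((div_le_one hr0).2 hlr)
  have hδr : δ ^ 2 * r = l := sq_sqrt_div_mul hr0 hl0.le
  have hτ1 : 1 ≤ ‖τ‖ := hτ.1
  have hτ5 : ‖τ‖ ≤ 5 := hτ.2
  have hζ11 : ‖ζ‖ ≤ 11 := by linarith [norm_le_of_mem_ball hζ]
  set ρ : ℝ := inner ℝ τ ζ with hρdef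
  have hρ1 : 1 ≤ ρ := inner_ge_of_mem_ball hτ1 hζ
  have hρ0 : 0 < ρ := by linarith
  have hρ60 : ρ ≤ 60 := by
    have := real_inner_le_norm τ ζ
    nlinarith [norm_nonneg ζ]
  have hmem1 := one_le_norm_squeeze_of_mem_ball hδ0.le hτ1 hζ
  have hmem2 : ‖squeeze δ τ ζ‖ ≤ 300 := by
    refine (norm_squeeze_le_of_mem_ball hδ0.le hδ1 hζ).trans ?_
    nlinarith
  refine ⟨⟨hmem1, hmem2⟩, ?_⟩
  set τ' := squeeze δ τ ζ with hτ'
  set v := ρ⁻¹ • ζ with hv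
  have hv11 : ‖v‖ ≤ 11 := by
    rw [hv, norm_smul, Real.norm_eq_abs, abs_of_pos (by positivity)]
    have : ρ⁻¹ ≤ 1 := inv_le_one_of_one_le₀ hρ1
    calc ρ⁻¹ * ‖ζ‖ ≤ 1 * 11 := by gcongr
      _ = 11 := by norm_num
  have hτ'eq : τ' = ρ • (τ + δ • v) := by
    rw [hτ', squeeze_apply, ← hρdef, hv, smul_add, smul_comm δ ρ⁻¹ ζ, smul_smul ρ ρ⁻¹,
      mul_inv_cancel₀ hρ0.ne', one_smul]
  have hσ1 : 1 ≤ ‖τ + δ • v‖ := by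
    have h3 : (inner ℝ τ (τ + δ • v) : ℝ) = ‖τ‖ ^ 2 + δ := by
      rw [inner_add_right, inner_smul_right, hv, inner_smul_right, real_inner_self_eq_norm_sq,
        ← hρdef, inv_mul_cancel₀ hρ0.ne', mul_one]
    have h4 := real_inner_le_norm τ (τ + δ • v)
    rw [h3] at h4
    by_contra! h5
    nlinarith
  have hδv : ‖δ • v‖ ≤ δ * 11 := by
    rw [norm_smul, Real.norm_eq_abs, abs_of_pos hδ0]; gcongr
  have hσ16 : ‖τ + δ • v‖ ≤ 16 := by
    have := norm_add_le τ (δ • v)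
    nlinarith
  have hg : gradient A τ' = gradient A (τ + δ • v) := by
    rw [hτ'eq]
    exact hA.gradient_smul ha hρ0 hσ1 (by rw [← hτ'eq]; exact hmem1)
  set u := phaseGrad A t τ x with hu
  set s := t / (2 * π) with hs
  have hs0 : 0 ≤ s := by positivity
  have hs2 : s ≤ 2 * r := by
    rw [hs, div_le_iff₀ (by positivity)]
    nlinarith [Real.pi_gt_three]
  have hsδ : s * δ ^ 2 ≤ 2 * l := by
    calc s * δ ^ 2 ≤ 2 * r * δ ^ 2 := by gcongr
      _ = 2 * l := by rw [← hδr]; ring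
  have hu' : phaseGrad A t τ' x = u + s • (gradient A (τ + δ • v) - gradient A τ) := by
    rw [hu, phaseGrad, phaseGrad, hg, smul_sub]; abel
  have hτu : |(inner ℝ τ u : ℝ)| ≤ C₁ * l :=
    (le_mul_of_one_le_left (abs_nonneg _) hτ1).trans
      ((abs_inner_le_norm_squeeze hδ0.le (ne_zero_of_mem_shell hτ) u).trans hx)
  have hδu : δ * ‖u‖ ≤ C₁ * l := (le_norm_squeeze τ u).trans hx
  have hδu' : δ * ‖phaseGrad A t τ' x‖ ≤ (C₁ + 22 * L) * l := by
    have h1 : ‖phaseGrad A t τ' x‖ ≤ ‖u‖ + s * (L * (δ * 11)) := by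
      rw [hu']
      refine (norm_add_le _ _).trans ?_
      rw [norm_smul, Real.norm_eq_abs, abs_of_nonneg hs0]
      gcongr
      refine (hL τ (τ + δ • v) (by linarith) hσ16).trans ?_
      rw [add_sub_cancel_left]
      gcongr
    calc δ * ‖phaseGrad A t τ' x‖ ≤ δ * (‖u‖ + s * (L * (δ * 11))) := by gcongr
      _ = δ * ‖u‖ + 11 * L * (s * δ ^ 2) := by ring
      _ ≤ C₁ * l + 11 * L * (2 * l) := by gcongr
      _ = _ := by ring
  have hin : (inner ℝ τ' (phaseGrad A t τ' x) : ℝ) =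
      ρ * (inner ℝ τ u + δ * inner ℝ v u + s * δ ^ 2 * taylorRem A δ τ v) := by
    have h1 : (inner ℝ (τ + δ • v) (gradient A (τ + δ • v)) : ℝ) = A (τ + δ • v) := by
      rw [real_inner_comm]; exact hA.inner_gradient_self ha hσ1
    have h2 : (inner ℝ τ (gradient A τ) : ℝ) = A τ := by
      rw [real_inner_comm]; exact hA.inner_gradient_self ha hτ1
    have h3 := sq_mul_taylorRem hA δ τ v
    rw [inner_smul_right, real_inner_comm] at h3
    rw [mul_assoc s, h3, phaseGrad, hg, hτ'eq, inner_smul_left, RCLike.conj_to_real,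
      inner_add_right, inner_smul_right, h1, hu, phaseGrad, inner_add_right, inner_add_right,
      inner_smul_right, inner_smul_right, h2, inner_add_left, inner_smul_left,
      RCLike.conj_to_real, ← hs]
    ring
  have hτ'u : |(inner ℝ τ' (phaseGrad A t τ' x) : ℝ)| ≤ 60 * (12 * C₁ + 2 * R) * l := by
    have h1 : |δ * (inner ℝ v u : ℝ)| ≤ 11 * (C₁ * l) := by
      rw [abs_mul, abs_of_pos hδ0]
      calc δ * |(inner ℝ v u : ℝ)| ≤ δ * (‖v‖ * ‖u‖) := by
            gcongr; exact abs_real_inner_le_norm v u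
        _ = ‖v‖ * (δ * ‖u‖) := by ring
        _ ≤ 11 * (C₁ * l) := by gcongr
    have h2 : |s * δ ^ 2 * taylorRem A δ τ v| ≤ 2 * l * R := by
      rw [abs_mul, abs_of_nonneg (by positivity : 0 ≤ s * δ ^ 2)]
      gcongr
      exact hR δ hδ0.le hδ1 τ v (by linarith) hv11
    rw [hin, abs_mul, abs_of_pos hρ0]
    have h3 := abs_add_three (inner ℝ τ u : ℝ) (δ * inner ℝ v u) (s * δ ^ 2 * taylorRem A δ τ v)
    calc _ ≤ ρ * ((12 * C₁ + 2 * R) * l) := by gcongr; linarith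
      _ ≤ 60 * ((12 * C₁ + 2 * R) * l) := by gcongr
      _ = _ := by ring
  refine (norm_squeeze_le hδ0.le τ' _).trans ?_
  have : ‖τ'‖ * |(inner ℝ τ' (phaseGrad A t τ' x) : ℝ)| ≤
      300 * (60 * (12 * C₁ + 2 * R) * l) := by gcongr
  linarith

theorem volume_plate_le {d : ℕ} (hd : 1 ≤ d) (A : Rd d → ℝ) {δ ℓ : ℝ} (hδ : 0 < δ) (hℓ : 0 ≤ ℓ)
    (t : ℝ) {τ : Rd d} (hτ : 1 ≤ ‖τ‖) :
    ENNReal.ofReal (δ ^ (d - 1)) * volume {x | ‖squeeze δ τ (phaseGrad A t τ x)‖ ≤ ℓ} ≤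
      ENNReal.ofReal (ℓ ^ d) * volume (Metric.ball (0 : Rd d) 1) := by
  have h1 : volume {x | ‖squeeze δ τ (phaseGrad A t τ x)‖ ≤ ℓ} =
      volume ((squeeze δ τ : Rd d →ₗ[ℝ] Rd d) ⁻¹' Metric.closedBall 0 ℓ) := by
    rw [← measure_preimage_add_right volume ((t / (2 * π)) • gradient A τ)
      ((squeeze δ τ : Rd d →ₗ[ℝ] Rd d) ⁻¹' Metric.closedBall 0 ℓ)]
    congr 1
    ext x
    simp [phaseGrad]
  have hdet := det_squeeze hd hδ τ
  have hpos : 0 < δ ^ (d - 1) * (δ + ‖τ‖ ^ 2) := by positivity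
  rw [h1, Measure.addHaar_preimage_linearMap _ (by rw [hdet]; exact hpos.ne'), hdet,
    Measure.addHaar_closedBall _ _ hℓ, finrank_euclideanSpace_fin, ← mul_assoc,
    ← ENNReal.ofReal_mul (by positivity), abs_of_pos (inv_pos.2 hpos)]
  refine mul_le_of_le_one_left zero_le (ENNReal.ofReal_le_one.2 ?_)
  rw [← div_eq_mul_inv, div_le_one hpos]
  exact le_mul_of_one_le_right (by positivity) (by nlinarith)

/-- The measure of the exceptional set attached to a cube of side length `l` at height `t ∼ r`. -/
theorem exists_volume_exceptional_le {d : ℕ} (hd : 1 ≤ d) {a A : Rd d → ℝ} (ha : IsDistFn a)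
    (hA : IsSmoothExt a A) {C₁ : ℝ} (hC₁ : 0 ≤ C₁) :
    ∃ C : ℝ, 0 < C ∧ ∀ r l t : ℝ, 1 ≤ l → l ≤ r → 0 ≤ t → t ≤ 2 * r → ∀ x₀ : Rd d,
      volume {x | ∃ τ ∈ shell d 5, ‖squeeze √(l / r) τ (phaseGrad A t τ (x - x₀))‖ ≤ C₁ * l} ≤
        ENNReal.ofReal (C * r ^ (d - 1) * l) := by
  obtain ⟨C', hC', htr⟩ := exists_plate_transfer ha hA hC₁
  obtain ⟨c, hc, hvol⟩ := volume_squeeze_image_ge hd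
  have hS : volume (shell d 300) ≠ ⊤ := (isCompact_shell d 300).measure_lt_top.ne
  have hB : volume (Metric.ball (0 : Rd d) 1) ≠ ⊤ := measure_ball_lt_top.ne
  set K : ℝ := (volume (Metric.ball (0 : Rd d) 1) * volume (shell d 300)).toReal with hK
  refine ⟨C' ^ d * K / c + 1, by positivity, fun r l t hl hlr ht0 htr' x₀ => ?_⟩
  have hl0 : 0 < l := by linarith
  have hr0 : 0 < r := by linarith
  set δ := √(l / r) with hδ
  have hδ0 : 0 < δ := Real.sqrt_pos.2 (by positivity)
  have hδr : δ ^ 2 * r = l := sq_sqrt_div_mul hr0 hl0.le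
  have htrans : volume {x | ∃ τ ∈ shell d 5, ‖squeeze δ τ (phaseGrad A t τ (x - x₀))‖ ≤ C₁ * l} =
      volume {x | ∃ τ ∈ shell d 5, ‖squeeze δ τ (phaseGrad A t τ x)‖ ≤ C₁ * l} := by
    rw [← measure_preimage_add_right volume (-x₀)
      {x | ∃ τ ∈ shell d 5, ‖squeeze δ τ (phaseGrad A t τ x)‖ ≤ C₁ * l}]
    simp [sub_eq_add_neg]
  rw [htrans]
  set P : Set (Rd d × Rd d) := {q | ‖squeeze δ q.2 (phaseGrad A t q.2 q.1)‖ ≤ C' * l} with hP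
  have hPc : Continuous fun q : Rd d × Rd d => squeeze δ q.2 (phaseGrad A t q.2 q.1) := by
    have := hA.continuous_phaseGrad t
    simp only [squeeze_apply]
    fun_prop
  have hPm : MeasurableSet P := (isClosed_le hPc.norm continuous_const).measurableSet
  set φ : Rd d → ℝ≥0∞ := fun x => ∫⁻ τ in shell d 300, P.indicator 1 (x, τ) with hφ
  have hPi : Measurable fun q : Rd d × Rd d => (P.indicator 1 q : ℝ≥0∞) :=
    measurable_one.indicator hPm
  have hφm : Measurable φ := hPi.lintegral_prod_right'
  have hsub : {x | ∃ τ ∈ shell d 5, ‖squeeze δ τ (phaseGrad A t τ x)‖ ≤ C₁ * l} ⊆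
      {x | ENNReal.ofReal (c * δ ^ (d - 1)) ≤ φ x} := by
    rintro x ⟨τ, hτ, hx⟩
    have h1 : φ x = volume (Prod.mk x ⁻¹' P ∩ shell d 300) := by
      have : ∀ τ : Rd d, (P.indicator 1 (x, τ) : ℝ≥0∞) = (Prod.mk x ⁻¹' P).indicator 1 τ :=
        fun τ => rfl
      simp only [hφ, this]
      rw [lintegral_indicator_one (measurable_prodMk_left hPm),
        Measure.restrict_apply (measurable_prodMk_left hPm)]
    change _ ≤ φ x
    rw [h1]
    refine (hvol δ hδ0 τ hτ.1).trans (measure_mono ?_)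
    rintro _ ⟨ζ, hζ, rfl⟩
    obtain ⟨h2, h3⟩ := htr r l t hl hlr ht0 htr' τ hτ ζ hζ x hx
    exact ⟨h3, h2⟩
  have hint : ENNReal.ofReal (δ ^ (d - 1)) * ∫⁻ x, φ x ≤ ENNReal.ofReal ((C' * l) ^ d * K) := by
    have h1 : ∫⁻ x, φ x = ∫⁻ τ in shell d 300, volume ((fun x => (x, τ)) ⁻¹' P) := by
      simp only [hφ]
      rw [lintegral_lintegral_swap hPi.aemeasurable]
      refine lintegral_congr fun τ => ?_
      rw [← lintegral_indicator_one (measurable_prodMk_right hPm)]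
      rfl
    rw [h1, ← lintegral_const_mul' _ _ ENNReal.ofReal_ne_top]
    calc _ ≤ ∫⁻ τ in shell d 300, ENNReal.ofReal ((C' * l) ^ d) *
          volume (Metric.ball (0 : Rd d) 1) :=
          setLIntegral_mono' (measurableSet_shell d 300) fun τ hτ =>
            volume_plate_le hd A hδ0 (by positivity) t hτ.1
      _ = _ := by
        rw [setLIntegral_const, mul_assoc, ENNReal.ofReal_mul (by positivity), hK,
          ENNReal.ofReal_toReal (ENNReal.mul_ne_top hB hS)]
  set E := {x | ∃ τ ∈ shell d 5, ‖squeeze δ τ (phaseGrad A t τ x)‖ ≤ C₁ * l}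
  have h1 : ENNReal.ofReal (c * δ ^ (d - 1)) * volume E ≤ ∫⁻ x, φ x :=
    (mul_le_mul' le_rfl (measure_mono hsub)).trans (mul_meas_ge_le_lintegral hφm _)
  have hpos : 0 < c * (δ ^ (d - 1) * δ ^ (d - 1)) := by positivity
  have h2 : ENNReal.ofReal (c * (δ ^ (d - 1) * δ ^ (d - 1))) * volume E ≤
      ENNReal.ofReal ((C' * l) ^ d * K) := by
    refine le_trans (le_of_eq ?_) ((mul_le_mul' le_rfl h1).trans hint)
    rw [← mul_assoc (ENNReal.ofReal (δ ^ (d - 1))), ← ENNReal.ofReal_mul (by positivity)]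
    congr 2
    ring
  have h3 : (C' * l) ^ d * K ≤ c * (δ ^ (d - 1) * δ ^ (d - 1)) *
      ((C' ^ d * K / c + 1) * r ^ (d - 1) * l) := by
    have e1 : δ ^ (d - 1) * δ ^ (d - 1) * r ^ (d - 1) = l ^ (d - 1) := by
      rw [← mul_pow, ← mul_pow, ← hδr]; ring
    have e2 : l ^ (d - 1) * l = l ^ d := by rw [← pow_succ]; congr 1; omega
    calc (C' * l) ^ d * K = c * (C' ^ d * K / c) * l ^ d := by rw [mul_pow]; field_simp
      _ ≤ c * (C' ^ d * K / c + 1) * l ^ d := by gcongr; linarith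
      _ = c * (C' ^ d * K / c + 1) * (δ ^ (d - 1) * δ ^ (d - 1) * r ^ (d - 1) * l) := by
        rw [e1, e2]
      _ = _ := by ring
  refine (ENNReal.mul_le_mul_iff_right (ENNReal.ofReal_pos.2 hpos).ne' ENNReal.ofReal_ne_top).1
    (h2.trans ?_)
  rw [← ENNReal.ofReal_mul hpos.le]
  exact ENNReal.ofReal_le_ofReal h3

theorem dyadic_nested {c x : ℝ} (hc : 0 < c) {m m' : ℤ} (s : ℕ)
    (h1 : m * c ≤ x) (h2 : x < (m + 1) * c)
    (h1' : m' * (2 ^ s * c) ≤ x) (h2' : x < (m' + 1) * (2 ^ s * c)) :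
    m' * (2 ^ s * c) ≤ m * c ∧ (m + 1) * c ≤ (m' + 1) * (2 ^ s * c) := by
  have h3 : (m' : ℝ) * 2 ^ s < m + 1 := by
    refine lt_of_mul_lt_mul_right ?_ hc.le
    linarith
  have h4 : (m : ℝ) < (m' + 1) * 2 ^ s := by
    refine lt_of_mul_lt_mul_right ?_ hc.le
    linarith
  have h3' : m' * 2 ^ s ≤ m := Int.lt_add_one_iff.1 (by exact_mod_cast h3)
  have h4' : m + 1 ≤ (m' + 1) * 2 ^ s := Int.add_one_le_iff.2 (by exact_mod_cast h4)
  have h5 : (m' : ℝ) * 2 ^ s ≤ m := by exact_mod_cast h3'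
  have h6 : (m : ℝ) + 1 ≤ (m' + 1) * 2 ^ s := by exact_mod_cast h4'
  constructor
  · rw [← mul_assoc]; gcongr
  · rw [← mul_assoc]; gcongr

theorem dyadic_unique {c x : ℝ} (hc : 0 < c) {m m' : ℤ}
    (h1 : m * c ≤ x) (h2 : x < (m + 1) * c)
    (h1' : m' * c ≤ x) (h2' : x < (m' + 1) * c) : m = m' := by
  have h3 : (m' : ℝ) < m + 1 := lt_of_mul_lt_mul_right (h1'.trans_lt h2) hc.le
  have h4 : (m : ℝ) < m' + 1 := lt_of_mul_lt_mul_right (h1.trans_lt h2') hc.le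
  have h3' : m' < m + 1 := by exact_mod_cast h3
  have h4' : m < m' + 1 := by exact_mod_cast h4
  omega

namespace DyCube

variable {d j : ℕ}

theorem toSet_subset_of_le {Q Q' : DyCube d j} (hk : Q.k ≤ Q'.k) {u : ℝ × (Fin d → ℝ)}
    (hu : u ∈ Q.toSet) (hu' : u ∈ Q'.toSet) : Q.toSet ⊆ Q'.toSet := by
  have hpow : (2 : ℝ) ^ Q'.k = 2 ^ (Q'.k - Q.k) * 2 ^ Q.k := by rw [← pow_add]; congr 1; omega
  have hc : (0 : ℝ) < 2 ^ Q.k := by positivity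
  simp only [toSet, hpow, Set.mem_ofPred_eq] at hu hu' ⊢
  rintro v ⟨hv, hv'⟩
  have h0 := dyadic_nested hc _ hu.1.1 hu.1.2 hu'.1.1 hu'.1.2
  refine ⟨⟨h0.1.trans hv.1, hv.2.trans_le h0.2⟩, fun i => ?_⟩
  have hi := dyadic_nested hc _ (hu.2 i).1 (hu.2 i).2 (hu'.2 i).1 (hu'.2 i).2
  exact ⟨hi.1.trans (hv' i).1, (hv' i).2.trans_le hi.2⟩

theorem k_le_of_toSet_subset {Q Q' : DyCube d j} (h : Q'.toSet ⊆ Q.toSet) : Q'.k ≤ Q.k := by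
  have hc' : (0 : ℝ) < 2 ^ Q'.k := by positivity
  have h1 : Ico ((Q'.m : ℝ) * 2 ^ Q'.k) ((Q'.m + 1) * 2 ^ Q'.k) ⊆
      Ico ((Q.m : ℝ) * 2 ^ Q.k) ((Q.m + 1) * 2 ^ Q.k) := fun t ht =>
    (h (show (t, fun i => (Q'.zv i : ℝ) * 2 ^ Q'.k) ∈ Q'.toSet from
      ⟨ht, fun i => ⟨le_rfl, by dsimp only; gcongr; linarith⟩⟩)).1
  obtain ⟨h2, h3⟩ := (Ico_subset_Ico_iff (by gcongr; linarith)).1 h1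
  have h4 : (2 : ℝ) ^ Q'.k ≤ 2 ^ Q.k := by linarith
  exact (pow_le_pow_iff_right₀ (by norm_num)).1 h4

theorem eq_of_k_eq {Q Q' : DyCube d j} (hk : Q.k = Q'.k) {u : ℝ × (Fin d → ℝ)}
    (hu : u ∈ Q.toSet) (hu' : u ∈ Q'.toSet) : Q = Q' := by
  obtain ⟨k, m, zv, _, _⟩ := Q
  obtain ⟨k', m', zv', _, _⟩ := Q'
  obtain rfl : k = k' := hk
  have hc : (0 : ℝ) < 2 ^ k := by positivity
  obtain rfl : m = m' := dyadic_unique hc hu.1.1 hu.1.2 hu'.1.1 hu'.1.2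
  obtain rfl : zv = zv' :=
    funext fun i => dyadic_unique hc (hu.2 i).1 (hu.2 i).2 (hu'.2 i).1 (hu'.2 i).2
  rfl

theorem eq_of_isMaxDense {E : Finset (ℝ × (Fin d → ℝ))} {lam p : ℝ} {Q Q' : DyCube d j}
    (hQ : IsMaxDense E lam p Q) (hQ' : IsMaxDense E lam p Q') {u : ℝ × (Fin d → ℝ)}
    (hu : u ∈ Q.toSet) (hu' : u ∈ Q'.toSet) : Q = Q' := by
  rcases le_total Q.k Q'.k with h | h
  · have := hQ.2 Q' hQ'.1 (toSet_subset_of_le h hu hu')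
    exact eq_of_k_eq (le_antisymm h (k_le_of_toSet_subset this.subset)) hu hu'
  · have := hQ'.2 Q hQ.1 (toSet_subset_of_le h hu' hu)
    exact (eq_of_k_eq (le_antisymm h (k_le_of_toSet_subset this.subset)) hu' hu).symm

instance : Countable (DyCube d j) := by
  refine Function.Injective.countable (f := fun Q : DyCube d j => (Q.k, Q.m, Q.zv)) ?_
  rintro ⟨k, m, zv, _, _⟩ ⟨k', m', zv', _, _⟩ h
  simp only [Prod.mk.injEq] at h
  obtain ⟨rfl, rfl, rfl⟩ := h
  rfl

theorem one_le_len (Q : DyCube d j) : 1 ≤ Q.len := one_le_pow₀ (by norm_num)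

theorem two_le_len_s8 (Q : DyCube d j) : 2 ≤ Q.len := by
  have : (2 : ℝ) ^ 1 ≤ 2 ^ Q.k := pow_le_pow_right₀ (by norm_num) Q.hk.1
  simpa [len] using this

theorem len_le (Q : DyCube d j) : Q.len ≤ 2 ^ j := pow_le_pow_right₀ (by norm_num) Q.hk.2

theorem centerT_nonneg (Q : DyCube d j) : 0 ≤ Q.centerT := by
  have h1 : (0 : ℤ) ≤ Q.m := le_trans (by positivity) Q.hm.1
  have h2 : (0 : ℝ) ≤ Q.m := by exact_mod_cast h1
  unfold centerT
  positivity

theorem centerT_le (Q : DyCube d j) : Q.centerT ≤ 2 * 2 ^ j := by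
  have h1 : Q.m + 1 ≤ 2 ^ (j + 1 - Q.k) := Int.add_one_le_iff.2 Q.hm.2
  have h2 : (Q.m : ℝ) + 1 ≤ 2 ^ (j + 1 - Q.k) := by exact_mod_cast h1
  have hk := Q.hk
  calc Q.centerT ≤ 2 ^ (j + 1 - Q.k) * 2 ^ Q.k := by
        unfold centerT; gcongr; linarith
    _ = 2 * 2 ^ j := by rw [← pow_add, ← pow_succ']; congr 1; omega

theorem abs_sub_centerT_le_s8 {Q : DyCube d j} {e : ℕ × (Fin d → ℤ)} (he : embedPt d e ∈ Q.toSet) :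
    |(e.1 : ℝ) - Q.centerT| ≤ Q.len := by
  have h1 : (Q.m : ℝ) * 2 ^ Q.k ≤ e.1 := he.1.1
  have h2 : (e.1 : ℝ) < (Q.m + 1) * 2 ^ Q.k := he.1.2
  have hc : (0 : ℝ) < 2 ^ Q.k := by positivity
  unfold centerT len
  rw [abs_le]
  constructor <;> linarith

theorem norm_sub_centerX_le_s8 {Q : DyCube d j} {e : ℕ × (Fin d → ℤ)} (he : embedPt d e ∈ Q.toSet)
    {y : Rd d} (hy : y ∈ qcube d e.2) : ‖y - Q.centerX‖ ≤ d * Q.len := by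
  have hl := Q.two_le_len_s8
  have hi : ∀ i, ‖(y - Q.centerX) i‖ ^ 2 ≤ Q.len ^ 2 := fun i => by
    have h1 : (Q.zv i : ℝ) * 2 ^ Q.k ≤ e.2 i := (he.2 i).1
    have h2 : (e.2 i : ℝ) < (Q.zv i + 1) * 2 ^ Q.k := (he.2 i).2
    have h3 := hy i
    gcongr
    have h4 : (y - Q.centerX) i = y i - ((Q.zv i : ℝ) + 1 / 2) * 2 ^ Q.k := rfl
    unfold len at hl ⊢
    rw [h4, Real.norm_eq_abs, abs_le]
    constructor <;> linarith
  rcases Nat.eq_zero_or_pos d with rfl | hd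
  · rw [Subsingleton.elim y Q.centerX]; simp
  have hd' : (1 : ℝ) ≤ d := by exact_mod_cast hd
  refine le_of_sq_le_sq ?_ (by positivity)
  rw [EuclideanSpace.norm_sq_eq]
  calc ∑ i, ‖(y - Q.centerX) i‖ ^ 2 ≤ ∑ _i : Fin d, Q.len ^ 2 := Finset.sum_le_sum fun i _ => hi i
    _ = d * Q.len ^ 2 := by simp
    _ ≤ (d * Q.len) ^ 2 := by rw [mul_pow]; gcongr; nlinarith

theorem cubeCount_image_le_card (E : Finset (ℕ × (Fin d → ℤ))) (Q : DyCube d j) :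
    cubeCount (E.image (embedPt d)) Q ≤ (E.filter fun e => embedPt d e ∈ Q.toSet).card := by
  unfold cubeCount
  rw [Finset.filter_image]
  exact Finset.card_image_le

theorem card_filter_mem_le (E : Finset (ℕ × (Fin d → ℤ))) (Q : DyCube d j) :
    (E.filter fun e => embedPt d e ∈ Q.toSet).card ≤ 2 ^ Q.k * (2 ^ Q.k) ^ d := by
  set T : Finset (ℤ × (Fin d → ℤ)) := Finset.Ico (Q.m * 2 ^ Q.k) ((Q.m + 1) * 2 ^ Q.k) ×ˢ
    Fintype.piFinset fun i => Finset.Ico (Q.zv i * 2 ^ Q.k) ((Q.zv i + 1) * 2 ^ Q.k) with hT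
  have hcard : T.card = 2 ^ Q.k * (2 ^ Q.k) ^ d := by
    have h1 : ∀ m : ℤ, ((m + 1) * 2 ^ Q.k - m * 2 ^ Q.k).toNat = 2 ^ Q.k := fun m => by
      rw [← sub_mul, add_sub_cancel_left, one_mul]
      exact_mod_cast Int.toNat_natCast (2 ^ Q.k)
    simp [hT, Fintype.card_piFinset, Int.card_Ico, h1]
  rw [← hcard]
  refine Finset.card_le_card_of_injOn (fun e => ((e.1 : ℤ), e.2)) ?_ ?_
  · intro e he
    have he' := (Finset.mem_filter.1 he).2
    simp only [hT, Finset.coe_product, Set.mem_prod, Finset.mem_coe, Finset.mem_Ico,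
      Fintype.mem_piFinset]
    have h1 : (Q.m : ℝ) * 2 ^ Q.k ≤ e.1 := he'.1.1
    have h2 : (e.1 : ℝ) < (Q.m + 1) * 2 ^ Q.k := he'.1.2
    refine ⟨⟨by exact_mod_cast h1, by exact_mod_cast h2⟩, fun i => ?_⟩
    have h3 : (Q.zv i : ℝ) * 2 ^ Q.k ≤ e.2 i := (he'.2 i).1
    have h4 : (e.2 i : ℝ) < (Q.zv i + 1) * 2 ^ Q.k := (he'.2 i).2
    exact ⟨by exact_mod_cast h3, by exact_mod_cast h4⟩
  · rintro ⟨n, z⟩ _ ⟨n', z'⟩ _ h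
    simpa using h

theorem rpow_lt_len_pow {E : Finset (ℕ × (Fin d → ℤ))} {lam p : ℝ} {Q : DyCube d j}
    (hQ : IsDense (E.image (embedPt d)) lam p Q) : lam ^ p < Q.len ^ d := by
  have h1 : (cubeCount (E.image (embedPt d)) Q : ℝ) ≤ Q.len * Q.len ^ d := by
    unfold len
    exact_mod_cast (cubeCount_image_le_card E Q).trans (card_filter_mem_le E Q)
  have h2 : lam ^ p * Q.len < Q.len ^ d * Q.len := by
    have := hQ.trans_le h1
    linarith
  exact lt_of_mul_lt_mul_right h2 (by linarith [Q.one_le_len])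

end DyCube

/-- Outside the exceptional set of a cube, all the points of the cube are far. -/
theorem exists_far_of_not_exceptional {d : ℕ} {a A : Rd d → ℝ} (hA : IsSmoothExt a A) :
    ∃ C₁ : ℝ, 0 ≤ C₁ ∧ ∀ r l t n : ℝ, 0 < l → l ≤ r → |n - t| ≤ l → ∀ x x₀ y : Rd d,
      ‖y - x₀‖ ≤ d * l → ∀ τ ∈ shell d 5,
      C₁ * l < ‖squeeze √(l / r) τ (phaseGrad A t τ (x - x₀))‖ →
      l ≤ ‖squeeze √(l / r) τ (phaseGrad A n τ (x - y))‖ := by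
  obtain ⟨G, hG⟩ := (isCompact_shell d 5).exists_bound_of_continuousOn
    hA.continuous_gradient.continuousOn
  refine ⟨30 * (d + max G 0) + 1, by positivity,
    fun r l t n hl hlr hnt x x₀ y hy τ hτ hfar => ?_⟩
  set δ := √(l / r)
  have hδ1 : δ ≤ 1 := Real.sqrt_le_one.2 ((div_le_one (hl.trans_le hlr)).2 hlr)
  have hδ0 : 0 ≤ δ := Real.sqrt_nonneg _
  set w : Rd d := (y - x₀) + ((t - n) / (2 * π)) • gradient A τ with hw
  have hdiff : phaseGrad A t τ (x - x₀) = phaseGrad A n τ (x - y) + w := by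
    rw [phaseGrad, phaseGrad, hw, sub_div, sub_smul]; abel
  have hwn : ‖w‖ ≤ (d + max G 0) * l := by
    refine (norm_add_le _ _).trans ?_
    rw [norm_smul, Real.norm_eq_abs, abs_div, abs_of_pos (by positivity : 0 < 2 * π), add_mul,
      mul_comm (max G 0), abs_sub_comm]
    gcongr
    · exact (div_le_self (abs_nonneg _) (by nlinarith [Real.pi_gt_three])).trans hnt
    · exact (hG τ hτ).trans (le_max_left _ _)
  have hsw : ‖squeeze δ τ w‖ ≤ 30 * ‖w‖ := by
    refine (norm_squeeze_le hδ0 τ w).trans ?_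
    have h1 := abs_real_inner_le_norm τ w
    have h2 : ‖τ‖ ≤ 5 := hτ.2
    have h3 : ‖τ‖ * |(inner ℝ τ w : ℝ)| ≤ 5 * (5 * ‖w‖) := by
      gcongr
      exact h1.trans (by gcongr)
    have h4 : δ * ‖w‖ ≤ 1 * ‖w‖ := by gcongr
    linarith [norm_nonneg w]
  rw [hdiff, map_add] at hfar
  have := norm_add_le (squeeze δ τ (phaseGrad A n τ (x - y))) (squeeze δ τ w)
  linarith

theorem volume_qcube_le_one {d : ℕ} (z : Fin d → ℤ) : volume (qcube d z) ≤ 1 := by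
  have h1 : qcube d z = (fun y : Rd d => WithLp.ofLp y) ⁻¹'
      Set.pi univ fun i => Ico (z i : ℝ) (z i + 1) := by
    ext y; simp [qcube]
  rw [h1, (PiLp.volume_preserving_ofLp (Fin d)).measure_preimage
    (MeasurableSet.univ_pi fun i => measurableSet_Ico).nullMeasurableSet, volume_pi_pi]
  simp

theorem measurableSet_qcube {d : ℕ} (z : Fin d → ℤ) : MeasurableSet (qcube d z) := by
  have h1 : qcube d z = ⋂ i, {y : Rd d | (z i : ℝ) ≤ y i ∧ y i < z i + 1} := by
    ext y; simp [qcube]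
  rw [h1]
  refine MeasurableSet.iInter fun i => ?_
  have : Measurable fun y : Rd d => y i := by fun_prop
  exact (measurableSet_le measurable_const this).inter (measurableSet_lt this measurable_const)

/-- The average of the majorant of `K_n` over translates by points of `q_z`. -/
def cubeMajorant {d : ℕ} (A : Rd d → ℝ) (n : ℝ) (z : Fin d → ℤ) (x : Rd d) : ℝ≥0∞ :=
  ∫⁻ y in qcube d z, kerMajorant A (d + 1) n (x - y)

theorem IsSmoothExt.measurable_cubeMajorant {d : ℕ} {a A : Rd d → ℝ} (hA : IsSmoothExt a A)
    (n : ℝ) (z : Fin d → ℤ) : Measurable (cubeMajorant A n z) := by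
  have h : Measurable fun q : Rd d × Rd d => kerMajorant A (d + 1) n (q.1 - q.2) :=
    (hA.measurable_kerMajorant (d + 1) n).comp measurable_sub
  exact h.lintegral_prod_right'

theorem IsSmoothExt.lintegral_cubeMajorant_le {d : ℕ} {a A : Rd d → ℝ} (hA : IsSmoothExt a A)
    (n : ℝ) (z : Fin d → ℤ) :
    ∫⁻ x, cubeMajorant A n z x ≤ ∫⁻ x, kerMajorant A (d + 1) n x := by
  have h : Measurable fun q : Rd d × Rd d => kerMajorant A (d + 1) n (q.1 - q.2) :=
    (hA.measurable_kerMajorant (d + 1) n).comp measurable_sub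
  unfold cubeMajorant
  rw [lintegral_lintegral_swap h.aemeasurable]
  have h1 : ∀ y : Rd d, ∫⁻ x, kerMajorant A (d + 1) n (x - y) = ∫⁻ x, kerMajorant A (d + 1) n x :=
    fun y => lintegral_sub_right_eq_self _ y
  simp only [h1]
  rw [setLIntegral_const]
  exact mul_le_of_le_one_right zero_le (volume_qcube_le_one z)

theorem enorm_conv_le {d : ℕ} {K b : Rd d → ℂ} {z : Fin d → ℤ} (hb : IsNormalized z b) {x : Rd d}
    {g : Rd d → ℝ≥0∞} {M : ℝ≥0∞} (hM : M ≠ ⊤) (hK : ∀ y ∈ qcube d z, ‖K (x - y)‖ₑ ≤ M * g (x - y)) :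
    ‖conv K b x‖ₑ ≤ M * ∫⁻ y in qcube d z, g (x - y) := by
  refine (enorm_integral_le_lintegral_enorm _).trans ?_
  rw [← lintegral_const_mul' _ _ hM, ← lintegral_indicator (measurableSet_qcube z)]
  refine lintegral_mono fun y => ?_
  by_cases hy : y ∈ qcube d z
  · rw [indicator_of_mem hy, enorm_mul]
    refine le_trans (mul_le_of_le_one_right zero_le ?_) (hK y hy)
    rw [← ofReal_norm]
    exact ENNReal.ofReal_le_one.2 (hb.2.1 y)
  · simp [hb.2.2 y hy]

/-- The exceptional set of a dyadic cube. -/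
def exceptionalSet {d j : ℕ} (A : Rd d → ℝ) (C₁ : ℝ) (Q : DyCube d j) : Set (Rd d) :=
  {x | ∃ τ ∈ shell d 5,
    ‖squeeze √(Q.len / 2 ^ j) τ (phaseGrad A Q.centerT τ (x - Q.centerX))‖ ≤ C₁ * Q.len}

theorem exists_exceptionalSet {d : ℕ} (hd : 1 ≤ d) {a A : Rd d → ℝ} {η : ℝ → ℝ}
    (ha : IsDistFn a) (hη : IsBump η) (hA : IsSmoothExt a A) :
    ∃ C₁ C : ℝ, 0 < C ∧
      (∀ (j : ℕ) (Q : DyCube d j), volume (exceptionalSet A C₁ Q) ≤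
        ENNReal.ofReal (C * (2 ^ j) ^ (d - 1) * Q.len)) ∧
      ∀ (j : ℕ) (Q : DyCube d j) (e : ℕ × (Fin d → ℤ)), (2 : ℝ) ^ j ≤ e.1 → (e.1 : ℝ) < 2 ^ (j + 1) →
        embedPt d e ∈ Q.toSet → ∀ b : Rd d → ℂ, IsNormalized e.2 b → ∀ x ∉ exceptionalSet A C₁ Q,
        ‖conv (Kker a η (e.1 : ℝ)) b x‖ₑ ≤
          ENNReal.ofReal (C * (Q.len ^ d)⁻¹) * cubeMajorant A e.1 e.2 x := by
  obtain ⟨C₁, hC₁, hfar⟩ := exists_far_of_not_exceptional hA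
  obtain ⟨C, hC, hvol⟩ := exists_volume_exceptional_le hd ha hA hC₁
  obtain ⟨C', hC', hK⟩ := exists_Kker_bound_of_far hd ha hη hA
  refine ⟨C₁, max C C', lt_max_of_lt_left hC, fun j Q => ?_, fun j Q e h1 h2 he b hb x hx => ?_⟩
  · have hl := Q.one_le_len
    refine (hvol (2 ^ j) Q.len Q.centerT hl Q.len_le Q.centerT_nonneg Q.centerT_le Q.centerX).trans
      (ENNReal.ofReal_le_ofReal ?_)
    gcongr
    exact le_max_left _ _
  · have hl := Q.one_le_len
    refine enorm_conv_le hb ENNReal.ofReal_ne_top fun y hy => ?_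
    refine (hK (2 ^ j) Q.len e.1 hl Q.len_le h1 (by rw [← pow_succ']; exact h2.le) (x - y)
      fun τ hτ => ?_).trans ?_
    · refine hfar _ _ Q.centerT _ (by linarith) Q.len_le (DyCube.abs_sub_centerT_le_s8 he) x Q.centerX y
        (DyCube.norm_sub_centerX_le_s8 he hy) τ hτ ?_
      by_contra! h
      exact hx ⟨τ, hτ, h⟩
    · gcongr
      exact le_max_right _ _

theorem tsum_sum_maxDense_le {d j : ℕ} (E : Finset (ℕ × (Fin d → ℤ)))
    (F : Finset (ℝ × (Fin d → ℝ))) (lam p : ℝ) (f : ℕ × (Fin d → ℤ) → ℝ≥0∞) :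
    ∑' Q : {Q : DyCube d j // IsMaxDense F lam p Q},
      ∑ e ∈ E, (if embedPt d e ∈ Q.1.toSet then f e else 0) ≤ ∑ e ∈ E, f e := by
  rw [Summable.tsum_finsetSum fun _ _ => ENNReal.summable]
  refine Finset.sum_le_sum fun e _ => ?_
  by_cases h : ∃ Q₀ : {Q : DyCube d j // IsMaxDense F lam p Q}, embedPt d e ∈ Q₀.1.toSet
  · obtain ⟨Q₀, hQ₀⟩ := h
    rw [tsum_eq_single Q₀ fun Q hQ => if_neg fun hQe =>
      hQ (Subtype.ext (DyCube.eq_of_isMaxDense Q.2 Q₀.2 hQe hQ₀)), if_pos hQ₀]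
  · rw [ENNReal.tsum_eq_zero.2 fun Q => if_neg fun hQ => h ⟨Q, hQ⟩]
    exact zero_le

theorem tsum_ofReal_len_le {d j : ℕ} (E : Finset (ℕ × (Fin d → ℤ))) {lam p : ℝ} (hlam : 0 < lam) :
    ∑' Q : {Q : DyCube d j // IsMaxDense (E.image (embedPt d)) lam p Q}, ENNReal.ofReal Q.1.len ≤
      ENNReal.ofReal (lam ^ (-p)) * (E.card : ℝ≥0∞) := by
  have h : ∀ Q : {Q : DyCube d j // IsMaxDense (E.image (embedPt d)) lam p Q},
      ENNReal.ofReal Q.1.len ≤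
        ENNReal.ofReal (lam ^ (-p)) * ∑ e ∈ E, (if embedPt d e ∈ Q.1.toSet then 1 else 0) := by
    intro Q
    have h1 : lam ^ p * Q.1.len ≤ ((E.filter fun e => embedPt d e ∈ Q.1.toSet).card : ℝ) :=
      Q.2.1.le.trans (by exact_mod_cast Q.1.cubeCount_image_le_card E)
    rw [Finset.sum_boole, ← ENNReal.ofReal_natCast, ← ENNReal.ofReal_mul (by positivity)]
    refine ENNReal.ofReal_le_ofReal ?_
    have hp : 0 < lam ^ p := Real.rpow_pos_of_pos hlam p
    rw [Real.rpow_neg hlam.le, ← div_eq_inv_mul, le_div_iff₀ hp]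
    linarith
  refine (ENNReal.tsum_le_tsum h).trans ?_
  rw [ENNReal.tsum_mul_left]
  gcongr
  refine (tsum_sum_maxDense_le E (E.image (embedPt d)) lam p fun _ => 1).trans ?_
  simp

theorem rpow_mul_sqrt_pow_le {d : ℕ} (hd : 1 ≤ d) (j : ℕ) {n : ℝ} (hn : n ≤ 2 ^ (j + 1)) :
    (2 : ℝ) ^ (((j : ℝ) * ((d : ℝ) - 1)) / 2) * √n ^ (d - 1) ≤ 2 ^ d * 2 ^ (j * (d - 1)) := by
  set s : ℝ := √(2 ^ j) with hs
  have hs2 : s ^ 2 = 2 ^ j := Real.sq_sqrt (by positivity)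
  have hs0 : 0 ≤ s := Real.sqrt_nonneg _
  have h1 : (2 : ℝ) ^ (((j : ℝ) * ((d : ℝ) - 1)) / 2) = s ^ (d - 1) := by
    rw [hs, Real.sqrt_eq_rpow, ← Real.rpow_natCast, ← Real.rpow_natCast, ← Real.rpow_mul (by norm_num),
      ← Real.rpow_mul (by norm_num), Nat.cast_sub hd]
    congr 1
    push_cast
    ring
  have h2 : √n ≤ 2 * s := by
    refine Real.sqrt_le_iff.2 ⟨by positivity, ?_⟩
    rw [mul_pow, hs2]
    calc n ≤ 2 ^ (j + 1) := hn
      _ = 2 * 2 ^ j := by ring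
      _ ≤ 2 ^ 2 * 2 ^ j := by gcongr; norm_num
  rw [h1]
  calc s ^ (d - 1) * √n ^ (d - 1) ≤ s ^ (d - 1) * (2 * s) ^ (d - 1) := by gcongr
    _ = 2 ^ (d - 1) * (s ^ 2) ^ (d - 1) := by rw [mul_pow]; ring
    _ = 2 ^ (d - 1) * 2 ^ (j * (d - 1)) := by rw [hs2, ← pow_mul]
    _ ≤ 2 ^ d * 2 ^ (j * (d - 1)) := by
      gcongr
      · norm_num
      · omega

theorem enorm_tsum_le_of_forall_le {ι : Type*} {f : ι → ℂ} {g : ι → ℝ≥0∞}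
    (h : ∀ i, ‖f i‖ₑ ≤ g i) : ‖∑' i, f i‖ₑ ≤ ∑' i, g i :=
  enorm_tsum_le_tsum_enorm.trans (ENNReal.tsum_le_tsum h)

/-- The combinatorial part of the estimate: exceptional sets and a majorant off them give
the weak type bound. -/
theorem measure_lt_norm_tsum_le {d : ℕ} (hd : 1 ≤ d) {p C lam : ℝ} (hC : 0 < C) (hlam : 1 < lam)
    {E : ℕ → Finset (ℕ × (Fin d → ℤ))}
    (hE : ∀ j : ℕ, ∀ e ∈ E j, (2 : ℝ) ^ j ≤ (e.1 : ℝ) ∧ (e.1 : ℝ) < 2 ^ (j + 1))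
    {B : ℕ × (Fin d → ℤ) → Rd d → ℂ} {g : ℕ × (Fin d → ℤ) → Rd d → ℝ≥0∞}
    {X : ∀ j, DyCube d j → Set (Rd d)}
    (hX : ∀ (j : ℕ) (Q : DyCube d j), volume (X j Q) ≤
      ENNReal.ofReal (C * (2 ^ j) ^ (d - 1) * Q.len))
    (hB : ∀ (j : ℕ) (Q : DyCube d j), ∀ e ∈ E j, embedPt d e ∈ Q.toSet → ∀ x ∉ X j Q,
      ‖B e x‖ₑ ≤ ENNReal.ofReal (C * (Q.len ^ d)⁻¹) * g e x)
    (hgm : ∀ e, Measurable (g e))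
    (hg : ∀ j, ∀ e ∈ E j, ∫⁻ x, g e x ≤ ENNReal.ofReal (C * √(e.1 : ℝ) ^ (d - 1))) :
    volume {x : Rd d | lam <
          ‖∑' j : ℕ, (((2 : ℝ) ^ (((j : ℝ) * ((d : ℝ) - 1)) / 2) : ℝ) : ℂ) *
            ∑' Q : {Q : DyCube d j // IsMaxDense ((E j).image (embedPt d)) lam p Q},
              ∑ e ∈ E j, (if embedPt d e ∈ Q.1.toSet then B e x else 0)‖} ≤
      ENNReal.ofReal ((C + C ^ 2 * 2 ^ d) * lam ^ (-p)) *
        ∑' j : ℕ, 2 ^ (j * (d - 1)) * ((E j).card : ℝ≥0∞) := by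
  have hlam0 : 0 < lam := by linarith
  have hlp : 0 < lam ^ (-p) := Real.rpow_pos_of_pos hlam0 _
  set w : ℕ → ℝ := fun j => (2 : ℝ) ^ (((j : ℝ) * ((d : ℝ) - 1)) / 2) with hw
  have hw0 : ∀ j, 0 < w j := fun j => Real.rpow_pos_of_pos (by norm_num) _
  set U : Set (Rd d) :=
    ⋃ j, ⋃ Q : {Q : DyCube d j // IsMaxDense ((E j).image (embedPt d)) lam p Q}, X j Q.1 with hU
  set G : Rd d → ℝ≥0∞ := fun x => ∑' j : ℕ, ENNReal.ofReal (w j) *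
    ∑ e ∈ E j, ENNReal.ofReal (C * lam ^ (-p)) * g e x with hG
  have hGm : Measurable G := by
    refine Measurable.tsum fun j => Measurable.const_mul ?_ _
    exact Finset.measurable_sum _ fun e _ => (hgm e).const_mul _
  have hUvol : volume U ≤ ENNReal.ofReal (C * lam ^ (-p)) *
      ∑' j : ℕ, 2 ^ (j * (d - 1)) * ((E j).card : ℝ≥0∞) := by
    refine (measure_iUnion_le _).trans ?_
    rw [← ENNReal.tsum_mul_left]
    refine ENNReal.tsum_le_tsum fun j => (measure_iUnion_le _).trans ?_
    calc ∑' Q : {Q : DyCube d j // IsMaxDense ((E j).image (embedPt d)) lam p Q}, volume (X j Q.1)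
        ≤ ∑' Q : {Q : DyCube d j // IsMaxDense ((E j).image (embedPt d)) lam p Q},
          ENNReal.ofReal (C * (2 ^ j) ^ (d - 1)) * ENNReal.ofReal Q.1.len :=
          ENNReal.tsum_le_tsum fun Q => by
            rw [← ENNReal.ofReal_mul (by positivity)]; exact hX j Q.1
      _ ≤ ENNReal.ofReal (C * (2 ^ j) ^ (d - 1)) *
          (ENNReal.ofReal (lam ^ (-p)) * ((E j).card : ℝ≥0∞)) := by
          rw [ENNReal.tsum_mul_left]
          gcongr
          exact tsum_ofReal_len_le (E j) hlam0
      _ = _ := by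
          have h2 : ENNReal.ofReal ((2 ^ j) ^ (d - 1)) = 2 ^ (j * (d - 1)) := by
            rw [← pow_mul, ENNReal.ofReal_pow (by norm_num)]; simp
          rw [ENNReal.ofReal_mul hC.le, ENNReal.ofReal_mul hC.le, h2]
          ring
  have hGint : ∫⁻ x, G x ≤ ENNReal.ofReal (C ^ 2 * 2 ^ d * lam ^ (-p)) *
      ∑' j : ℕ, 2 ^ (j * (d - 1)) * ((E j).card : ℝ≥0∞) := by
    have hmj : ∀ j, Measurable fun x =>
        ∑ e ∈ E j, ENNReal.ofReal (C * lam ^ (-p)) * g e x := fun j =>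
      Finset.measurable_sum _ fun e _ => (hgm e).const_mul _
    rw [hG, lintegral_tsum fun j => ((hmj j).const_mul _).aemeasurable, ← ENNReal.tsum_mul_left]
    refine ENNReal.tsum_le_tsum fun j => ?_
    rw [lintegral_const_mul' _ _ ENNReal.ofReal_ne_top,
      lintegral_finsetSum _ fun e _ => (hgm e).const_mul _, Finset.mul_sum]
    calc ∑ e ∈ E j, ENNReal.ofReal (w j) * ∫⁻ x, ENNReal.ofReal (C * lam ^ (-p)) * g e x
        ≤ ∑ _e ∈ E j, ENNReal.ofReal (C ^ 2 * 2 ^ d * lam ^ (-p)) * 2 ^ (j * (d - 1)) := by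
          refine Finset.sum_le_sum fun e he => ?_
          rw [lintegral_const_mul' _ _ ENNReal.ofReal_ne_top]
          calc ENNReal.ofReal (w j) * (ENNReal.ofReal (C * lam ^ (-p)) * ∫⁻ x, g e x)
              ≤ ENNReal.ofReal (w j) * (ENNReal.ofReal (C * lam ^ (-p)) *
                ENNReal.ofReal (C * √(e.1 : ℝ) ^ (d - 1))) := by gcongr; exact hg j e he
            _ = ENNReal.ofReal (w j * (C * lam ^ (-p) * (C * √(e.1 : ℝ) ^ (d - 1)))) := by
                rw [ENNReal.ofReal_mul (hw0 j).le, ENNReal.ofReal_mul (p := C * lam ^ (-p)) (by positivity)]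
            _ ≤ ENNReal.ofReal (C ^ 2 * 2 ^ d * lam ^ (-p) * 2 ^ (j * (d - 1))) := by
                refine ENNReal.ofReal_le_ofReal ?_
                have := rpow_mul_sqrt_pow_le hd j (hE j e he).2.le
                calc w j * (C * lam ^ (-p) * (C * √(e.1 : ℝ) ^ (d - 1)))
                    = C ^ 2 * lam ^ (-p) * (w j * √(e.1 : ℝ) ^ (d - 1)) := by ring
                  _ ≤ C ^ 2 * lam ^ (-p) * (2 ^ d * 2 ^ (j * (d - 1))) := by gcongr
                  _ = _ := by ring
            _ = _ := by
                rw [ENNReal.ofReal_mul (by positivity), ENNReal.ofReal_pow (by norm_num)]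
                simp
      _ = _ := by rw [Finset.sum_const, nsmul_eq_mul]; ring
  have hsub : {x : Rd d | lam < ‖∑' j : ℕ, ((w j : ℝ) : ℂ) *
      ∑' Q : {Q : DyCube d j // IsMaxDense ((E j).image (embedPt d)) lam p Q},
        ∑ e ∈ E j, (if embedPt d e ∈ Q.1.toSet then B e x else 0)‖} ⊆
      U ∪ {x | 1 ≤ G x} := by
    intro x hx
    by_cases hxU : x ∈ U
    · exact Or.inl hxU
    refine Or.inr ?_
    simp only [hU, mem_iUnion, not_exists] at hxU
    have h1 : 1 ≤ ‖∑' j : ℕ, ((w j : ℝ) : ℂ) *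
        ∑' Q : {Q : DyCube d j // IsMaxDense ((E j).image (embedPt d)) lam p Q},
        ∑ e ∈ E j, (if embedPt d e ∈ Q.1.toSet then B e x else 0)‖ₑ := by
      rw [← ofReal_norm, ← ENNReal.ofReal_one]
      exact ENNReal.ofReal_le_ofReal (hlam.le.trans (le_of_lt hx))
    refine h1.trans (enorm_tsum_le_of_forall_le fun j => ?_)
    rw [enorm_mul]
    gcongr
    · rw [← ofReal_norm, Complex.norm_real, Real.norm_of_nonneg (hw0 j).le]
    · refine (enorm_tsum_le_of_forall_le (g := fun Q => ∑ e ∈ E j,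
        (if embedPt d e ∈ Q.1.toSet then ENNReal.ofReal (C * lam ^ (-p)) * g e x else 0))
        fun Q => ?_).trans (tsum_sum_maxDense_le (E j) _ lam p _)
      refine (enorm_sum_le _ _).trans (Finset.sum_le_sum fun e he => ?_)
      split_ifs with hQ
      · refine (hB j Q.1 e he hQ x (hxU j Q)).trans ?_
        gcongr
        rw [Real.rpow_neg hlam0.le]
        have hp := Real.rpow_pos_of_pos hlam0 p
        gcongr
        exact (DyCube.rpow_lt_len_pow Q.2.1).le
      · simp
  refine (measure_mono hsub).trans ((measure_union_le _ _).trans ?_)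
  have hcheb : volume {x | 1 ≤ G x} ≤ ∫⁻ x, G x := by
    simpa using mul_meas_ge_le_lintegral (μ := volume) hGm 1
  rw [add_mul, ENNReal.ofReal_add (by positivity) (by positivity), add_mul]
  exact add_le_add hUvol (hcheb.trans hGint)

/-- the high density part of the restricted weak type estimate:
`meas{x : |∑_{j≥1} 2^{j(d-1)/2} ∑_{Q ∈ Q_j(λ)} ∑_{(n,z) ∈ E_j ∩ Q} B_{n,z}| > λ}
  ≲ λ^{-p} ∑_{j≥1} 2^{j(d-1)} #E_j` for `λ` larger than a fixed constant. -/
theorem statement8 (d : ℕ) (hd : 4 ≤ d) (a : Rd d → ℝ) (ha : IsDistFn a)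
    (hcurv : CurvNondeg a) (η : ℝ → ℝ) (hη : IsBump η)
    (p : ℝ) (hp1 : 1 < p) (hp2 : p < 2 * ((d : ℝ) - 1) / ((d : ℝ) + 1)) :
    ∃ C₀ C : ℝ, 0 < C₀ ∧ 0 < C ∧ ∀ lam : ℝ, C₀ < lam →
      ∀ E : ℕ → Finset (ℕ × (Fin d → ℤ)), E 0 = ∅ →
      (∀ j : ℕ, ∀ e ∈ E j, (2 : ℝ) ^ j ≤ (e.1 : ℝ) ∧ (e.1 : ℝ) < 2 ^ (j + 1)) →
      ∀ b : ℕ × (Fin d → ℤ) → Rd d → ℂ, (∀ e, IsNormalized e.2 (b e)) →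
      volume {x : Rd d | lam <
          ‖∑' j : ℕ, (((2 : ℝ) ^ (((j : ℝ) * ((d : ℝ) - 1)) / 2) : ℝ) : ℂ) *
            ∑' Q : {Q : DyCube d j // IsMaxDense ((E j).image (embedPt d)) lam p Q},
              ∑ e ∈ E j,
                (if embedPt d e ∈ Q.1.toSet then conv (Kker a η (e.1 : ℝ)) (b e) x else 0)‖} ≤
        ENNReal.ofReal (C * lam ^ (-p)) *
          ∑' j : ℕ, 2 ^ (j * (d - 1)) * ((E j).card : ℝ≥0∞) := by
  have hd1 : 1 ≤ d := by omega
  obtain ⟨A, hA⟩ := ha.exists_smoothExt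
  obtain ⟨C₁, C, hC, hvol, hker⟩ := exists_exceptionalSet hd1 ha hη hA
  obtain ⟨C', hC', hint⟩ := exists_lintegral_kerMajorant_le hd1 hA
  have hmax : 0 < max C C' := lt_max_of_lt_left hC
  refine ⟨1, max C C' + max C C' ^ 2 * 2 ^ d, one_pos, by positivity,
    fun lam hlam E _ hE b hb => ?_⟩
  refine measure_lt_norm_tsum_le hd1 hmax hlam hE (g := fun e => cubeMajorant A e.1 e.2)
    (X := fun _ Q => exceptionalSet A C₁ Q) (fun j Q => ?_) (fun j Q e he hQ x hx => ?_)
    (fun e => hA.measurable_cubeMajorant _ _) (fun j e he => ?_)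
  · refine (hvol j Q).trans (ENNReal.ofReal_le_ofReal ?_)
    have := Q.one_le_len
    gcongr
    exact le_max_left _ _
  · refine (hker j Q e (hE j e he).1 (hE j e he).2 hQ (b e) (hb e) x hx).trans ?_
    have := Q.one_le_len
    gcongr
    exact le_max_left _ _
  · have hn : (1 : ℝ) ≤ e.1 := (one_le_pow₀ (by norm_num)).trans (hE j e he).1
    refine (hA.lintegral_cubeMajorant_le _ _).trans ((hint e.1 hn).trans ?_)
    gcongr
    exact le_max_right _ _
end
end
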